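/- For all real t with |t| ≥ 3, there are no zeros of ζ(β + it) in the region β ≥ 1 − ν₂(t), where ν₂(t) = (1/(3.359·log|t|)) · (1 − 8.02·(log log|t|)/log|t|). That is, if β is real with β ≥ 1 − ν₂(t), then ζ(β + it) ≠ 0. -/

import Mathlib

/-- The zero-free region width `ν₂(t)`. -/
noncomputable def nu2 (t : ℝ) : ℝ :=
  1 / (3.359 * Real.log |t|) * (1 - 8.02 * Real.log (Real.log |t|) / Real.log |t|)

section
open Finset

/-- `ee x = exp (2 π i x)`. -/
noncomputable def ee (x : ℝ) : ℂ := Complex.exp ((2 * Real.pi * x : ℝ) * Complex.I)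

lemma ee_norm (x : ℝ) : ‖ee x‖ = 1 := by
  unfold ee; exact Complex.norm_exp_ofReal_mul_I _

lemma ee_add (x y : ℝ) : ee (x + y) = ee x * ee y := by
  unfold ee; rw [← Complex.exp_add]; congr 1; push_cast; ring

lemma ee_int (m : ℤ) : ee m = 1 := by
  unfold ee
  rw [Complex.exp_eq_one_iff]
  exact ⟨m, by push_cast; ring⟩

lemma ee_neg (x : ℝ) : ee (-x) = (starRingEnd ℂ) (ee x) := by
  unfold ee
  rw [← Complex.exp_conj, map_mul, Complex.conj_ofReal, Complex.conj_I]; congr 1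
  push_cast; ring

/-- The Kusmin–Landau multiplier. -/
noncomputable def klc (g : ℝ) : ℝ := Real.cos (Real.pi * g) / Real.sin (Real.pi * g)

noncomputable def klG (g : ℝ) : ℂ := 1 / 2 + (Complex.I / 2) * (klc g : ℝ)

lemma klG_eq (g : ℝ) (h0 : 0 < g) (h1 : g < 1) : (1 - ee g) * klG g = 1 := by
  have hs : 0 < Real.sin (Real.pi * g) :=
    Real.sin_pos_of_pos_of_lt_pi (by positivity) (by nlinarith [Real.pi_pos])
  unfold klG klc ee
  rw [Complex.exp_mul_I, ← Complex.ofReal_cos, ← Complex.ofReal_sin]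
  have e1 : (2 * Real.pi * g) = 2 * (Real.pi * g) := by ring
  rw [e1, Real.cos_two_mul, Real.sin_two_mul]
  set s := Real.sin (Real.pi * g)
  set c := Real.cos (Real.pi * g)
  have hsc : s ^ 2 + c ^ 2 = 1 := Real.sin_sq_add_cos_sq _
  have hs' : s ≠ 0 := hs.ne'
  apply Complex.ext
  · simp [Complex.mul_re, Complex.mul_im, pow_two]
    field_simp
    nlinarith
  · simp [Complex.mul_re, Complex.mul_im, pow_two]
    field_simp
    have : c ^ 2 = 1 - s ^ 2 := by linarith
    ring_nf
    try rw [show c ^ 3 = c * c ^ 2 by ring, this]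
    try ring

lemma klG_norm (g : ℝ) (h0 : 0 < g) (h1 : g < 1) :
    ‖klG g‖ = 1 / (2 * Real.sin (Real.pi * g)) := by
  have hs : 0 < Real.sin (Real.pi * g) :=
    Real.sin_pos_of_pos_of_lt_pi (by positivity) (by nlinarith [Real.pi_pos])
  have : ‖klG g‖ ^ 2 = (1 / (2 * Real.sin (Real.pi * g))) ^ 2 := by
    rw [← Complex.normSq_eq_norm_sq, Complex.normSq_apply]
    have hre : (klG g).re = 1 / 2 := by unfold klG; simp
    have him : (klG g).im = klc g / 2 := by unfold klG; simp; ring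
    rw [hre, him]
    unfold klc
    have hsc := Real.sin_sq_add_cos_sq (Real.pi * g)
    field_simp
    nlinarith
  exact (pow_left_inj₀ (norm_nonneg _) (by positivity) two_ne_zero).1 this

lemma klc_anti {g g' : ℝ} (h0 : 0 < g) (h : g ≤ g') (h1 : g' < 1) : klc g' ≤ klc g := by
  have hs : 0 < Real.sin (Real.pi * g) :=
    Real.sin_pos_of_pos_of_lt_pi (by positivity) (by nlinarith [Real.pi_pos])
  have hs' : 0 < Real.sin (Real.pi * g') :=
    Real.sin_pos_of_pos_of_lt_pi (mul_pos Real.pi_pos (by linarith)) (by nlinarith [Real.pi_pos])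
  unfold klc
  rw [div_le_div_iff₀ hs' hs]
  have : 0 ≤ Real.sin (Real.pi * g' - Real.pi * g) := by
    apply Real.sin_nonneg_of_nonneg_of_le_pi
    · nlinarith [Real.pi_pos]
    · nlinarith [Real.pi_pos]
  rw [Real.sin_sub] at this
  linarith

lemma klG_sub {g g' : ℝ} (h0 : 0 < g) (h : g ≤ g') (h1 : g' < 1) :
    ‖klG g' - klG g‖ = (klc g - klc g') / 2 := by
  have : klG g' - klG g = ((klc g' - klc g : ℝ) : ℂ) * (Complex.I / 2) := by
    unfold klG; push_cast; ring
  rw [this, norm_mul, Complex.norm_real]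
  simp
  rw [abs_of_nonpos (by linarith [klc_anti h0 h h1])]; ring

lemma kl_end (g δ : ℝ) (hδ : 0 < δ) (h0 : δ ≤ g) (h1 : g < 1) :
    1 / (2 * Real.sin (Real.pi * g)) + klc g / 2 ≤ 1 / (Real.pi * δ) := by
  have hg : 0 < g := by linarith
  have hx0 : 0 < Real.pi * g / 2 := by positivity
  have hx1 : Real.pi * g / 2 < Real.pi / 2 := by nlinarith [Real.pi_pos]
  have hs : 0 < Real.sin (Real.pi * g / 2) := Real.sin_pos_of_pos_of_lt_pi hx0 (by linarith [Real.pi_pos])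
  have hc : 0 < Real.cos (Real.pi * g / 2) := Real.cos_pos_of_mem_Ioo ⟨by linarith, hx1⟩
  have ht := Real.le_tan hx0.le hx1
  unfold klc
  have e1 : (Real.pi * g) = 2 * (Real.pi * g / 2) := by ring
  rw [e1, Real.cos_two_mul, Real.sin_two_mul]
  rw [Real.tan_eq_sin_div_cos] at ht
  set s := Real.sin (Real.pi * g / 2)
  set c := Real.cos (Real.pi * g / 2)
  have : 1 / (2 * (2 * s * c)) + (2 * c ^ 2 - 1) / (2 * s * c) / 2 = c / s / 2 := by
    field_simp; ring
  rw [this]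
  have h2 : Real.pi * g / 2 * c ≤ s := by
    rwa [le_div_iff₀ hc] at ht
  have h3 : c / s ≤ 2 / (Real.pi * g) := by
    rw [div_le_div_iff₀ hs (by positivity)]; linarith
  have h4 : 2 / (Real.pi * g) ≤ 2 / (Real.pi * δ) := by
    gcongr
  calc c / s / 2 ≤ 2 / (Real.pi * δ) / 2 := by linarith
    _ = _ := by field_simp

lemma kl_aux (x : ℕ → ℝ) (a : ℕ) (k : ℕ) 
    (hr : ∀ n, a ≤ n → n < a + (k + 1) → 0 < x (n+1) - x n ∧ x (n+1) - x n < 1)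
    (hm : ∀ n, a ≤ n → n + 1 < a + (k + 1) → x (n+1) - x n ≤ x (n+2) - x (n+1)) :
    ‖∑ n ∈ Ico a (a + (k + 1)), ee (x n) + ee (x (a + (k+1))) * klG (x (a + k + 1) - x (a + k))‖
      ≤ 1 / (2 * Real.sin (Real.pi * (x (a+1) - x a))) +
        (klc (x (a+1) - x a) - klc (x (a + k + 1) - x (a + k))) / 2 := by
  induction k with
  | zero =>
    have h := hr a le_rfl (by omega)
    simp
    have : ee (x (a+1)) = ee (x a) * ee (x (a+1) - x a) := by rw [← ee_add]; congr 1; ring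
    have h2 := klG_eq _ h.1 h.2
    have : ee (x a) + ee (x (a+1)) * klG (x (a+1) - x a) = ee (x a) * klG (x (a+1) - x a) := by
      rw [this]
      linear_combination (-ee (x a)) * h2
    rw [this, norm_mul, ee_norm, klG_norm _ h.1 h.2]
    simp
  | succ k ih =>
    have ih' := ih (fun n h1 h2 => hr n h1 (by omega)) (fun n h1 h2 => hm n h1 (by omega))
    have h := hr (a + k + 1) (by omega) (by omega)
    have hp := hr (a + k) (by omega) (by omega)
    have hmm := hm (a + k) (by omega) (by omega)
    rw [show a + (k + 1 + 1) = (a + (k + 1)) + 1 by ring, Finset.sum_Ico_succ_top (by omega)]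
    have e1 : ee (x (a+(k+1)+1)) = ee (x (a+(k+1))) * ee (x (a+(k+1)+1) - x (a+(k+1))) := by
      rw [← ee_add]; congr 1; ring
    have h2 := klG_eq _ h.1 h.2
    have e2 : ∑ n ∈ Ico a (a + (k + 1)), ee (x n) + ee (x (a + (k+1))) + ee (x (a+(k+1)+1)) * klG (x (a + (k+1) + 1) - x (a + (k+1)))
      = (∑ n ∈ Ico a (a + (k + 1)), ee (x n) + ee (x (a + (k+1))) * klG (x (a + k + 1) - x (a + k))) +
        ee (x (a + (k+1))) * (klG (x (a + (k+1) + 1) - x (a + (k+1))) - klG (x (a + k + 1) - x (a + k))) := by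
      rw [e1]
      have : a + (k+1) = a + k + 1 := rfl
      rw [this] at *
      linear_combination (-ee (x (a+k+1))) * h2
    rw [e2]
    refine (norm_add_le _ _).trans ?_
    rw [norm_mul, ee_norm, one_mul]
    have := klG_sub hp.1 hmm h.2
    have e3 : a + (k+1) = a + k + 1 := rfl
    rw [e3] at ih' ⊢
    rw [this]
    have e4 : x (a + k + 2) = x (a+k+1+1) := rfl
    rw [e4]
    linarith

lemma kusmin_landau (x : ℕ → ℝ) (a b : ℕ) (m : ℤ) (δ : ℝ) (hδ : 0 < δ)
    (hr : ∀ n, a ≤ n → n < b → m + δ ≤ x (n+1) - x n ∧ x (n+1) - x n ≤ m + 1 - δ)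
    (hm : ∀ n, a ≤ n → n + 1 < b → x (n+1) - x n ≤ x (n+2) - x (n+1)) :
    ‖∑ n ∈ Ico a b, ee (x n)‖ ≤ 2 / (Real.pi * δ) := by
  rcases le_or_gt b a with hab | hab
  · rw [Finset.Ico_eq_empty (by omega)]; simp; positivity
  obtain ⟨k, rfl⟩ : ∃ k, b = a + (k + 1) := ⟨b - a - 1, by omega⟩
  set y : ℕ → ℝ := fun n => x n - m * n with hy
  have hxy : ∀ n, ee (x n) = ee (y n) := by
    intro n
    have : x n = y n + ((m * n : ℤ) : ℝ) := by simp [hy]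
    rw [this, ee_add, ee_int, mul_one]
  have hd : ∀ n, y (n+1) - y n = x (n+1) - x n - m := by intro n; simp [hy]; ring
  simp_rw [hxy]
  have hr' : ∀ n, a ≤ n → n < a + (k+1) → δ ≤ y (n+1) - y n ∧ y (n+1) - y n ≤ 1 - δ := by
    intro n h1 h2
    have := hr n h1 h2
    rw [hd]; constructor <;> linarith
  have := kl_aux y a k (fun n h1 h2 => by have := hr' n h1 h2; constructor <;> linarith)
    (fun n h1 h2 => by
      have := hm n h1 h2
      have e := hd (n+1)
      rw [show n + 1 + 1 = n + 2 by ring] at e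
      rw [hd, e]; linarith)
  have ha := hr' a le_rfl (by omega)
  have hb := hr' (a+k) (by omega) (by omega)
  have h1 := kl_end _ δ hδ ha.1 (by linarith)
  have h2 := kl_end (1 - (y (a+k+1) - y (a+k))) δ hδ (by linarith) (by linarith)
  have h3 : klc (1 - (y (a+k+1) - y (a+k))) = - klc (y (a+k+1) - y (a+k)) := by
    unfold klc
    rw [mul_sub, mul_one, Real.cos_pi_sub, Real.sin_pi_sub, neg_div]
  rw [h3, mul_sub, mul_one, Real.sin_pi_sub] at h2
  have h4 : ‖ee (y (a + (k+1))) * klG (y (a + k + 1) - y (a + k))‖ = 1 / (2 * Real.sin (Real.pi * (y (a + k + 1) - y (a + k)))) := by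
    rw [norm_mul, ee_norm, one_mul, klG_norm _ (by linarith) (by linarith)]
  have h5 := norm_sub_le (∑ n ∈ Ico a (a + (k + 1)), ee (y n) + ee (y (a + (k+1))) * klG (y (a + k + 1) - y (a + k)))
    (ee (y (a + (k+1))) * klG (y (a + k + 1) - y (a + k)))
  rw [add_sub_cancel_right, h4] at h5
  calc _ ≤ _ := h5
    _ ≤ 1 / (Real.pi * δ) + 1 / (Real.pi * δ) := by linarith
    _ = _ := by ring

end

section
open Finset

lemma split_mono (g : ℕ → ℝ) (a b : ℕ) (hab : a ≤ b)
    (hm : ∀ n, a ≤ n → n + 1 < b → g n ≤ g (n+1)) (y : ℝ) :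
    ∃ c, a ≤ c ∧ c ≤ b ∧ (∀ n, a ≤ n → n < c → g n < y) ∧ (∀ n, c ≤ n → n < b → y ≤ g n) := by
  induction b, hab using Nat.le_induction with
  | base => exact ⟨a, le_rfl, le_rfl, fun n h1 h2 => by omega, fun n h1 h2 => by omega⟩
  | succ b hab ih =>
    obtain ⟨c, h1, h2, h3, h4⟩ := ih (fun n h1 h2 => hm n h1 (by omega))
    rcases Nat.lt_or_ge c b with hc | hc
    · refine ⟨c, h1, by omega, h3, fun n hn1 hn2 => ?_⟩
      rcases Nat.lt_or_ge n b with h | h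
      · exact h4 n hn1 h
      · have : n = (b - 1) + 1 := by omega
        have h5 := h4 (b-1) (by omega) (by omega)
        have h6 := hm (b-1) (by omega) (by omega)
        rw [this]; linarith
    · have : c = b := by omega
      subst this
      by_cases hy : g c < y
      · refine ⟨c+1, by omega, le_rfl, fun n hn1 hn2 => ?_, fun n hn1 hn2 => by omega⟩
        rcases Nat.lt_or_ge n c with h | h
        · exact h3 n hn1 h
        · have : n = c := by omega
          rw [this]; exact hy
      · refine ⟨c, h1, by omega, h3, fun n hn1 hn2 => ?_⟩
        have : n = c := by omega
        rw [this]; linarith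

lemma short_sum (x : ℕ → ℝ) (a b : ℕ) (l d y : ℝ) (hl : 0 < l) (hd : 0 < d)
    (h : ∀ n, a ≤ n → n + 1 < b → l ≤ x (n+2) - 2 * x (n+1) + x n)
    (hr : ∀ n, a ≤ n → n < b → y ≤ x (n+1) - x n ∧ x (n+1) - x n ≤ y + d) :
    ‖∑ n ∈ Ico a b, ee (x n)‖ ≤ d / l + 1 := by
  rcases le_or_gt b a with hab | hab
  · rw [Finset.Ico_eq_empty (by omega)]; simp; positivity
  have h1 : ‖∑ n ∈ Ico a b, ee (x n)‖ ≤ (b - a : ℕ) := by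
    refine (norm_sum_le _ _).trans ?_
    simp [ee_norm]
  have h2 : ∀ k, a + k < b → k * l ≤ (x (a+k+1) - x (a+k)) - (x (a+1) - x a) := by
    intro k
    induction k with
    | zero => intro _; simp
    | succ k ih =>
      intro hk
      have := ih (by omega)
      have h3 := h (a+k) (by omega) (by omega)
      push_cast
      rw [show a + (k+1) = a + k + 1 by ring, show a + k + 1 + 1 = a + k + 2 by ring]
      linarith
  have h3 := h2 (b - a - 1) (by omega)
  have h4 := hr a le_rfl hab
  have h5 := hr (a + (b-a-1)) (by omega) (by omega)
  have h6 : ((b - a - 1 : ℕ) : ℝ) ≤ d / l := by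
    rw [le_div_iff₀ hl]; linarith
  have h7 : ((b - a : ℕ) : ℝ) = ((b - a - 1 : ℕ) : ℝ) + 1 := by
    rw [← Nat.cast_add_one]; congr 1; omega
  linarith

lemma sum_split (f : ℕ → ℂ) {a c b : ℕ} (h1 : a ≤ c) (h2 : c ≤ b) :
    ‖∑ n ∈ Ico a b, f n‖ ≤ ‖∑ n ∈ Ico a c, f n‖ + ‖∑ n ∈ Ico c b, f n‖ := by
  rw [← Finset.sum_Ico_consecutive f h1 h2]; exact norm_add_le _ _

lemma one_block (x : ℕ → ℝ) (a b : ℕ) (l d : ℝ) (hl : 0 < l) (hd : 0 < d) (hab : a ≤ b) (m : ℤ)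
    (h : ∀ n, a ≤ n → n + 1 < b → l ≤ x (n+2) - 2 * x (n+1) + x n)
    (hr : ∀ n, a ≤ n → n < b → (m:ℝ) ≤ x (n+1) - x n ∧ x (n+1) - x n < m + 1) :
    ‖∑ n ∈ Ico a b, ee (x n)‖ ≤ 2 * (d / l + 1) + 2 / (Real.pi * d) := by
  obtain ⟨c, c1, c2, c3, c4⟩ := split_mono (fun n => x (n+1) - x n) a b hab
    (fun n h1 h2 => by have := h n h1 h2; rw [show n+1+1 = n+2 by ring]; linarith) (m + d)
  obtain ⟨e, e1, e2, e3, e4⟩ := split_mono (fun n => x (n+1) - x n) c b c2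
    (fun n h1 h2 => by have := h n (by omega) h2; rw [show n+1+1 = n+2 by ring]; linarith) (m + 1 - d)
  have s1 := short_sum x a c l d m hl hd (fun n h1 h2 => h n h1 (by omega))
    (fun n h1 h2 => ⟨(hr n h1 (by omega)).1, (c3 n h1 h2).le⟩)
  have s2 := kusmin_landau x c e m d hd (fun n h1 h2 => ⟨c4 n h1 (by omega), (e3 n h1 h2).le⟩)
    (fun n h1 h2 => by have := h n (by omega) (by omega); linarith)
  have s3 := short_sum x e b l d (m + 1 - d) hl hd (fun n h1 h2 => h n (by omega) (by omega))
    (fun n h1 h2 => ⟨e4 n h1 h2, by linarith [(hr n (by omega) h2).2]⟩)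
  have t1 := sum_split (fun n => ee (x n)) c1 c2
  have t2 := sum_split (fun n => ee (x n)) e1 e2
  linarith

lemma many_blocks (x : ℕ → ℝ) (l d : ℝ) (hl : 0 < l) (hd : 0 < d) (m : ℤ) (a : ℕ) (K : ℕ) :
    ∀ b, a ≤ b → 
    (∀ n, a ≤ n → n + 1 < b → l ≤ x (n+2) - 2 * x (n+1) + x n) →
    (∀ n, a ≤ n → n < b → (m:ℝ) ≤ x (n+1) - x n ∧ x (n+1) - x n < m + K) →
    ‖∑ n ∈ Ico a b, ee (x n)‖ ≤ K * (2 * (d / l + 1) + 2 / (Real.pi * d)) := by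
  induction K with
  | zero =>
    intro b hab h hr
    rcases Nat.lt_or_ge a b with hh | hh
    · have := hr a le_rfl hh
      simp at this; linarith
    · rw [Finset.Ico_eq_empty (by omega)]; simp
  | succ K ih =>
    intro b hab h hr
    obtain ⟨c, c1, c2, c3, c4⟩ := split_mono (fun n => x (n+1) - x n) a b hab
      (fun n h1 h2 => by have := h n h1 h2; rw [show n+1+1 = n+2 by ring]; linarith) (m + K)
    have s1 := ih c c1 (fun n h1 h2 => h n h1 (by omega)) 
      (fun n h1 h2 => ⟨(hr n h1 (by omega)).1, c3 n h1 h2⟩)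
    have s2 := one_block x c b l d hl hd c2 (m + K) (fun n h1 h2 => h n (by omega) h2)
      (fun n h1 h2 => ⟨by push_cast; exact c4 n h1 h2, by have := (hr n (by omega) h2).2; push_cast at this ⊢; linarith⟩)
    have t1 := sum_split (fun n => ee (x n)) c1 c2
    push_cast
    linarith

lemma second_diff (x : ℕ → ℝ) (a b : ℕ) (l W : ℝ) (hl : 0 < l) (hW : 0 ≤ W)
    (h : ∀ n, a ≤ n → n + 1 < b → l ≤ x (n+2) - 2 * x (n+1) + x n)
    (hw : ∀ n, a ≤ n → n < b → x (n+1) - x n ≤ x (a+1) - x a + W) :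
    ‖∑ n ∈ Ico a b, ee (x n)‖ ≤ (W + 2) * (2.26 / √l + 2) := by
  rcases le_or_gt b a with hab | hab
  · rw [Finset.Ico_eq_empty (by omega)]; simp; positivity
  have hsl : 0 < √l := Real.sqrt_pos.2 hl
  have hmono : ∀ k, a + k < b → x (a+1) - x a ≤ x (a+k+1) - x (a+k) := by
    intro k
    induction k with
    | zero => intro _; simp
    | succ k ih =>
      intro hk
      have := ih (by omega)
      have h3 := h (a+k) (by omega) (by omega)
      rw [show a + (k+1) = a + k + 1 by ring, show a + k + 1 + 1 = a + k + 2 by ring]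
      linarith
  have hK : ((⌈W⌉₊ + 1 : ℕ) : ℝ) ≤ W + 2 := by
    push_cast; linarith [Nat.ceil_lt_add_one hW]
  have key := many_blocks x l (0.56 * √l) hl (by positivity) ⌊x (a+1) - x a⌋ a (⌈W⌉₊ + 1) b hab.le h
    (fun n h1 h2 => by
      constructor
      · have := hmono (n - a) (by omega)
        rw [show a + (n - a) = n by omega] at this
        linarith [Int.floor_le (x (a+1) - x a)]
      · have := hw n h1 h2
        push_cast
        linarith [Int.lt_floor_add_one (x (a+1) - x a), Nat.le_ceil W])
  have hB : 2 * (0.56 * √l / l + 1) + 2 / (Real.pi * (0.56 * √l)) ≤ 2.26 / √l + 2 := by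
    have e1 : 0.56 * √l / l = 0.56 / √l := by
      rw [div_eq_div_iff hl.ne' hsl.ne', mul_assoc, Real.mul_self_sqrt hl.le]
    have e2 : 2 / (Real.pi * (0.56 * √l)) ≤ 1.14 / √l := by
      rw [div_le_div_iff₀ (by positivity) hsl]
      nlinarith [Real.pi_gt_d2]
    rw [e1]
    have : 2.26 / √l = 2 * (0.56 / √l) + 1.14 / √l := by ring
    linarith
  calc _ ≤ _ := key
    _ ≤ ((⌈W⌉₊ + 1 : ℕ) : ℝ) * (2.26 / √l + 2) := by gcongr
    _ ≤ _ := by gcongr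

end

section
open Finset

/-- correlation sums -/
noncomputable def corr (z : ℕ → ℂ) (a b d : ℕ) : ℂ :=
  ∑ n ∈ Ico a (b - d), z (n + d) * (starRingEnd ℂ) (z n)

lemma corr_pair (z : ℕ → ℂ) (a b q q' : ℕ) (h : q ≤ q') :
    ∑ n ∈ Ico a b, ∑ n' ∈ Ico a b, (if n + q = n' + q' then z n * (starRingEnd ℂ) (z n') else 0)
      = corr z a b (q' - q) := by
  rw [Finset.sum_comm]
  unfold corr
  have h1 : ∀ n' ∈ Ico a b, (∑ n ∈ Ico a b, (if n + q = n' + q' then z n * (starRingEnd ℂ) (z n') else 0))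
      = if n' + (q' - q) < b then z (n' + (q' - q)) * (starRingEnd ℂ) (z n') else 0 := by
    intro n' hn'
    rw [mem_Ico] at hn'
    have : ∀ n, (n + q = n' + q') ↔ (n = n' + (q' - q)) := by intro n; omega
    simp_rw [this]
    rw [Finset.sum_ite_eq']
    simp only [mem_Ico]
    have : (a ≤ n' + (q' - q) ∧ n' + (q' - q) < b) ↔ n' + (q' - q) < b := by omega
    simp only [this]
  rw [Finset.sum_congr rfl h1, ← Finset.sum_filter]
  apply Finset.sum_congr
  · ext n; simp only [mem_filter, mem_Ico]; omega
  · intros; rfl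

lemma corr_pair_norm (z : ℕ → ℂ) (a b q q' : ℕ) :
    ‖∑ n ∈ Ico a b, ∑ n' ∈ Ico a b, (if n + q = n' + q' then z n * (starRingEnd ℂ) (z n') else 0)‖
      = ‖corr z a b (Nat.dist q q')‖ := by
  rcases le_total q q' with h | h
  · rw [corr_pair z a b q q' h, Nat.dist_eq_sub_of_le h]
  · rw [Nat.dist_eq_sub_of_le_right h, ← corr_pair z a b q' q h, Finset.sum_comm,
      ← Complex.norm_conj]
    congr 1
    rw [map_sum]
    apply Finset.sum_congr rfl; intro n _
    rw [map_sum]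
    apply Finset.sum_congr rfl; intro n' _
    by_cases hh : n' + q = n + q'
    · rw [if_pos hh, if_pos hh.symm]; simp [mul_comm]
    · rw [if_neg hh, if_neg (fun h => hh h.symm)]; simp

lemma dist_sum (c : ℕ → ℝ) (Q : ℕ) :
    ∑ q ∈ range Q, ∑ q' ∈ range Q, c (Nat.dist q q')
      = Q * c 0 + 2 * ∑ d ∈ Ico 1 Q, ((Q : ℝ) - d) * c d := by
  induction Q with
  | zero => simp
  | succ Q ih =>
    rw [Finset.sum_range_succ]
    simp_rw [Finset.sum_range_succ (fun q' => c (Nat.dist _ q'))]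
    rw [Finset.sum_add_distrib, ih]
    have h1 : ∑ q ∈ range Q, c (Nat.dist q Q) = ∑ d ∈ Ico 1 (Q+1), c d := by
      rw [← Finset.sum_range_reflect, Finset.sum_Ico_eq_sum_range]
      apply Finset.sum_congr (by simp)
      intro q hq
      rw [mem_range] at hq
      rw [Nat.dist_eq_sub_of_le (by omega)]
      congr 1; omega
    have h2 : ∑ q ∈ range Q, c (Nat.dist Q q) = ∑ d ∈ Ico 1 (Q+1), c d := by
      rw [← h1]; apply Finset.sum_congr rfl; intro q _; rw [Nat.dist_comm]
    rw [h1, h2, Nat.dist_self]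
    have h3 : ∑ d ∈ Ico 1 (Q+1), (((Q+1 : ℕ) : ℝ) - d) * c d
        = ∑ d ∈ Ico 1 Q, ((Q : ℝ) - d) * c d + ∑ d ∈ Ico 1 (Q+1), c d := by
      rcases Nat.eq_zero_or_pos Q with h | h
      · subst h; simp
      · rw [Finset.sum_Ico_succ_top (by omega), Finset.sum_Ico_succ_top (by omega)]
        rw [← add_assoc, ← Finset.sum_add_distrib]
        congr 1
        · apply Finset.sum_congr rfl; intro d _; push_cast; ring
        · push_cast; ring
    rw [h3]; push_cast; ring

lemma weyl_vdc (z : ℕ → ℂ) (a b Q : ℕ) (hab : a ≤ b) :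
    (Q : ℝ)^2 * ‖∑ n ∈ Ico a b, z n‖^2 ≤ ((b:ℝ) - a + Q) *
      (Q * ‖corr z a b 0‖ + 2 * ∑ d ∈ Ico 1 Q, ((Q : ℝ) - d) * ‖corr z a b d‖) := by
  set u : ℕ → ℂ := fun k => ∑ q ∈ range Q, ∑ n ∈ Ico a b, if n + q = k then z n else 0 with hu
  have h1 : ∑ k ∈ Ico a (b + Q), u k = Q * ∑ n ∈ Ico a b, z n := by
    simp only [hu]
    rw [Finset.sum_comm]
    have : ∀ q ∈ range Q, (∑ k ∈ Ico a (b+Q), ∑ n ∈ Ico a b, if n + q = k then z n else 0) = ∑ n ∈ Ico a b, z n := by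
      intro q hq
      rw [mem_range] at hq
      rw [Finset.sum_comm]
      apply Finset.sum_congr rfl; intro n hn
      rw [mem_Ico] at hn
      rw [Finset.sum_ite_eq, if_pos]
      rw [mem_Ico]; omega
    rw [Finset.sum_congr rfl this]; simp
  have h2 : ‖∑ k ∈ Ico a (b+Q), u k‖^2 ≤ ((b:ℝ) - a + Q) * ∑ k ∈ Ico a (b+Q), ‖u k‖^2 := by
    have := sq_sum_le_card_mul_sum_sq (s := Ico a (b+Q)) (f := fun k => ‖u k‖)
    rw [Nat.card_Ico, Nat.cast_sub (by omega)] at this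
    push_cast at this
    calc _ ≤ (∑ k ∈ Ico a (b+Q), ‖u k‖)^2 := by gcongr; exact norm_sum_le _ _
      _ ≤ _ := by refine this.trans (le_of_eq ?_); ring
  have h3 : ((∑ k ∈ Ico a (b+Q), ‖u k‖^2 : ℝ) : ℂ) = ∑ q ∈ range Q, ∑ q' ∈ range Q,
      ∑ n ∈ Ico a b, ∑ n' ∈ Ico a b, (if n + q = n' + q' then z n * (starRingEnd ℂ) (z n') else 0) := by
    push_cast
    have e1 : ∀ k, ((‖u k‖ : ℂ))^2 = ∑ q ∈ range Q, ∑ q' ∈ range Q, ∑ n ∈ Ico a b, ∑ n' ∈ Ico a b,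
        (if n + q = k then z n else 0) * (starRingEnd ℂ) (if n' + q' = k then z n' else 0) := by
      intro k
      rw [← Complex.mul_conj']
      simp only [hu]
      rw [map_sum, Finset.sum_mul_sum]
      apply Finset.sum_congr rfl; intro q _
      apply Finset.sum_congr rfl; intro q' _
      rw [map_sum, Finset.sum_mul_sum]
    simp_rw [e1]
    rw [Finset.sum_comm]
    apply Finset.sum_congr rfl; intro q hq
    rw [Finset.sum_comm]
    apply Finset.sum_congr rfl; intro q' _
    rw [Finset.sum_comm]
    apply Finset.sum_congr rfl; intro n hn
    rw [Finset.sum_comm]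
    apply Finset.sum_congr rfl; intro n' _
    rw [mem_range] at hq
    rw [mem_Ico] at hn
    rw [Finset.sum_eq_single (n + q)]
    · by_cases hh : n + q = n' + q'
      · simp [hh]
      · have : ¬ (n' + q' = n + q) := fun h => hh h.symm
        simp [hh, this]
    · intro k _ hk
      rw [if_neg (fun h => hk h.symm)]; simp
    · intro hk; exfalso; apply hk; rw [mem_Ico]; omega
  have h4 : ∑ k ∈ Ico a (b+Q), ‖u k‖^2 ≤ ∑ q ∈ range Q, ∑ q' ∈ range Q, ‖corr z a b (Nat.dist q q')‖ := by
    have : ∑ k ∈ Ico a (b+Q), ‖u k‖^2 = ‖((∑ k ∈ Ico a (b+Q), ‖u k‖^2 : ℝ) : ℂ)‖ := by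
      rw [Complex.norm_real, Real.norm_of_nonneg]
      exact Finset.sum_nonneg (fun _ _ => by positivity)
    rw [this, h3]
    refine (norm_sum_le _ _).trans (Finset.sum_le_sum fun q _ => ?_)
    refine (norm_sum_le _ _).trans (Finset.sum_le_sum fun q' _ => ?_)
    rw [corr_pair_norm]
  rw [dist_sum (fun d => ‖corr z a b d‖)] at h4
  have h5 : (Q : ℝ)^2 * ‖∑ n ∈ Ico a b, z n‖^2 = ‖∑ k ∈ Ico a (b+Q), u k‖^2 := by
    rw [h1, norm_mul]; simp; ring
  rw [h5]
  refine h2.trans ?_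
  have : (0:ℝ) ≤ (b:ℝ) - a + Q := by
    have : (a:ℝ) ≤ b := by exact_mod_cast hab
    have : (0:ℝ) ≤ Q := by positivity
    linarith
  gcongr

/-- version for exponential sums -/
lemma weyl_ee (x : ℕ → ℝ) (a b Q : ℕ) (hab : a ≤ b) :
    (Q : ℝ)^2 * ‖∑ n ∈ Ico a b, ee (x n)‖^2 ≤ ((b:ℝ) - a + Q) *
      (Q * ((b:ℝ) - a) + 2 * ∑ d ∈ Ico 1 Q, ((Q : ℝ) - d) *
        ‖∑ n ∈ Ico a (b - d), ee (x (n + d) - x n)‖) := by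
  have h := weyl_vdc (fun n => ee (x n)) a b Q hab
  have hc : ∀ d, corr (fun n => ee (x n)) a b d = ∑ n ∈ Ico a (b - d), ee (x (n + d) - x n) := by
    intro d
    unfold corr
    apply Finset.sum_congr rfl; intro n _
    rw [← ee_neg, ← ee_add]; rfl
  simp_rw [hc] at h
  have h0 : ‖∑ n ∈ Ico a (b - 0), ee (x (n + 0) - x n)‖ = (b:ℝ) - a := by
    have : ee 0 = 1 := by have := ee_int 0; simpa using this
    simp [this]
    rw [Nat.cast_sub hab]
  rw [h0] at h
  exact h

end

section
open Finset

lemma dstep (f f' : ℝ → ℝ) (A B h m M : ℝ) (hh : 0 ≤ h)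
    (hf : ∀ y, A ≤ y → y ≤ B → HasDerivAt f (f' y) y)
    (hb : ∀ y, A ≤ y → y ≤ B → m ≤ f' y ∧ f' y ≤ M) :
    ∀ y, A ≤ y → y + h ≤ B → h * m ≤ f (y + h) - f y ∧ f (y + h) - f y ≤ h * M := by
  intro y hy1 hy2
  rcases hh.eq_or_lt with rfl | hpos
  · simp
  obtain ⟨c, hc, hc2⟩ := exists_hasDerivAt_eq_slope f f' (show y < y + h by linarith)
    (fun z hz => (hf z (by linarith [hz.1]) (by linarith [hz.2])).continuousAt.continuousWithinAt)
    (fun z hz => hf z (by linarith [hz.1]) (by linarith [hz.2]))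
  have := hb c (by linarith [hc.1]) (by linarith [hc.2])
  have e : f (y + h) - f y = h * f' c := by
    rw [hc2, add_sub_cancel_left]; field_simp
  rw [e]
  constructor
  · exact mul_le_mul_of_nonneg_left this.1 hh
  · exact mul_le_mul_of_nonneg_left this.2 hh

lemma dshift (f f' : ℝ → ℝ) (A B h : ℝ) (hh : 0 ≤ h)
    (hf : ∀ y, A ≤ y → y ≤ B → HasDerivAt f (f' y) y) :
    ∀ y, A ≤ y → y ≤ B - h → HasDerivAt (fun y => f (y + h) - f y) (f' (y+h) - f' y) y := by
  intro y h1 h2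
  exact (HasDerivAt.comp_add_const y h (hf (y+h) (by linarith) (by linarith))).sub (hf y h1 (by linarith))

lemma d0 (T y : ℝ) (hy : 0 < y) : HasDerivAt (fun y => T * Real.log y) (T / y) y :=
  (Real.hasDerivAt_log hy.ne').const_mul T

lemma d1 (T y : ℝ) (hy : 0 < y) : HasDerivAt (fun y => T / y) (-T / y^2) y := by
  have h : HasDerivAt (fun y => T / y) (T * (-(y^2)⁻¹)) y := (hasDerivAt_inv hy.ne').const_mul T
  exact h.congr_deriv (by field_simp)

lemma d2 (T y : ℝ) (hy : 0 < y) : HasDerivAt (fun y => -T / y^2) (2 * T / y^3) y := by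
  have h : HasDerivAt (fun y => -T / y^2) (-T * (-((2:ℕ) * y^(2-1)) / (y^2)^2)) y :=
    ((hasDerivAt_pow 2 y).inv (by positivity)).const_mul (-T)
  exact h.congr_deriv (by norm_num; field_simp)

lemma d3 (T y : ℝ) (hy : 0 < y) : HasDerivAt (fun y => 2 * T / y^3) (-6 * T / y^4) y := by
  have h : HasDerivAt (fun y => 2 * T / y^3) (2 * T * (-((3:ℕ) * y^(3-1)) / (y^3)^2)) y :=
    ((hasDerivAt_pow 3 y).inv (by positivity)).const_mul (2*T)
  exact h.congr_deriv (by norm_num; field_simp; ring)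

lemma ee_sum_neg (x : ℕ → ℝ) (s : Finset ℕ) : ‖∑ n ∈ s, ee (-(x n))‖ = ‖∑ n ∈ s, ee (x n)‖ := by
  rw [← Complex.norm_conj, map_sum]
  congr 1
  apply Finset.sum_congr rfl; intro n _
  rw [ee_neg, Complex.conj_conj]

lemma S2_bound (T N : ℝ) (hT : 0 < T) (hN : 0 < N) (a b : ℕ) (ha : N ≤ a) (hb : (b:ℝ) ≤ 2 * N) :
    ‖∑ n ∈ Ico a b, ee (T * Real.log n)‖ ≤ (T / (2 * N) + 2) * (2.26 / √(T / (4 * N^2)) + 2) := by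
  rw [← ee_sum_neg]
  have f0 := fun y (hy : N ≤ y) (_ : y ≤ 2 * N) => d0 (-T) y (by linarith)
  have f1 := fun y (hy : N ≤ y) (_ : y ≤ 2 * N) => d1 (-T) y (by linarith)
  have g0 := dstep _ _ N (2*N) 1 (-T/N) (-T/(2*N)) (by norm_num) f0 (fun y h1 h2 => by
    have : 0 < y := by linarith
    constructor
    · rw [neg_div, neg_div]; apply neg_le_neg; gcongr
    · rw [neg_div, neg_div]; apply neg_le_neg; gcongr)
  have g1 := dstep _ _ N (2*N) 1 (T/(4*N^2)) (T/N^2) (by norm_num) f1 (fun y h1 h2 => by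
    have : 0 < y := by linarith
    rw [neg_neg]
    constructor
    · rw [show 4 * N^2 = (2*N)^2 by ring]; gcongr
    · gcongr)
  have e0 := dshift _ _ N (2*N) 1 (by norm_num) f0
  have g2 := dstep _ _ N (2*N-1) 1 (1 * (T/(4*N^2))) (1 * (T/N^2)) (by norm_num) e0 (fun y h1 h2 => g1 y h1 (by linarith))
  refine second_diff _ a b _ _ (by positivity) (by positivity) ?_ ?_
  · intro n h1 h2
    have h1' : (a:ℝ) ≤ n := by exact_mod_cast h1
    have h2' : (n:ℝ) + 2 ≤ b := by exact_mod_cast h2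
    have := (g2 n (by linarith) (by linarith)).1
    push_cast
    rw [show (n:ℝ) + 1 + 1 = n + 2 by ring] at this
    linarith
  · intro n h1 h2
    have h1' : (a:ℝ) ≤ n := by exact_mod_cast h1
    have h2' : (n:ℝ) + 1 ≤ b := by exact_mod_cast h2
    have A1 := g0 n (by linarith) (by linarith)
    have A2 := g0 a (by linarith) (by linarith)
    push_cast
    have : T / N = T / (2*N) + T / (2*N) := by field_simp; norm_num
    rw [neg_div, this, neg_div] at A2
    rw [neg_div, neg_div] at A1
    linarith

lemma S3_bound (T N : ℝ) (hT : 0 < T) (hN : 0 < N) (q : ℕ) (hq : 1 ≤ q) (a b : ℕ) (ha : N ≤ a) (hb : (b:ℝ) ≤ 2 * N) :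
    ‖∑ n ∈ Ico a (b - q), ee (T * Real.log (n + q : ℕ) - T * Real.log n)‖ ≤
      (0.75 * q * T / N^2 + 2) * (2.26 / √(q * T / (4 * N^3)) + 2) := by
  have hq' : (1:ℝ) ≤ q := by exact_mod_cast hq
  have hq0 : (0:ℝ) < q := by linarith
  have f0 := fun y (hy : N ≤ y) (_ : y ≤ 2 * N) => d0 T y (by linarith)
  have f1 := fun y (hy : N ≤ y) (_ : y ≤ 2 * N) => d1 T y (by linarith)
  have f2 := fun y (hy : N ≤ y) (_ : y ≤ 2 * N) => d2 T y (by linarith)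
  -- D_q
  have b1 := dstep _ _ N (2*N) q (-T/N^2) (-T/(4*N^2)) hq0.le f1 (fun y h1 h2 => by
    have : 0 < y := by linarith
    constructor
    · rw [neg_div, neg_div]; apply neg_le_neg; gcongr
    · rw [neg_div, neg_div]; apply neg_le_neg; rw [show 4 * N^2 = (2*N)^2 by ring]; gcongr)
  have b2 := dstep _ _ N (2*N) q (2*T/(8*N^3)) (2*T/N^3) hq0.le f2 (fun y h1 h2 => by
    have : 0 < y := by linarith
    constructor
    · rw [show 8 * N^3 = (2*N)^3 by ring]; gcongr
    · gcongr)
  have e0 := dshift _ _ N (2*N) q hq0.le f0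
  have e1 := dshift _ _ N (2*N) q hq0.le f1
  have g0 := dstep _ _ N (2*N-q) 1 _ _ (by norm_num) e0 (fun y h1 h2 => b1 y h1 (by linarith))
  have g1 := dstep _ _ N (2*N-q) 1 _ _ (by norm_num) e1 (fun y h1 h2 => b2 y h1 (by linarith))
  have e00 := dshift _ _ N (2*N-q) 1 (by norm_num) e0
  have g2 := dstep _ _ N (2*N-q-1) 1 _ _ (by norm_num) e00 (fun y h1 h2 => g1 y h1 (by linarith))
  refine second_diff _ a (b-q) _ _ (by positivity) (by positivity) ?_ ?_
  · intro n h1 h2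
    have h1' : (a:ℝ) ≤ n := by exact_mod_cast h1
    have h2' : (n:ℝ) + 2 + q ≤ b := by
      have : n + 2 + q ≤ b := by omega
      exact_mod_cast this
    have := (g2 n (by linarith) (by linarith)).1
    push_cast
    rw [show (n:ℝ) + 1 + 1 = n + 2 by ring] at this
    have e : (q:ℝ) * T / (4 * N^3) = 1 * (1 * (q * (2 * T / (8 * N^3)))) := by field_simp; norm_num
    rw [e]
    linarith
  · intro n h1 h2
    have h1' : (a:ℝ) ≤ n := by exact_mod_cast h1
    have h2' : (n:ℝ) + 1 + q ≤ b := by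
      have : n + 1 + q ≤ b := by omega
      exact_mod_cast this
    have h3' : (a:ℝ) + 1 + q ≤ b := by linarith
    have A1 := (g0 n (by linarith) (by linarith)).2
    have A2 := (g0 a (by linarith) (by linarith)).1
    push_cast
    have e : 0.75 * (q:ℝ) * T / N^2 = 1 * (q * (-T/(4*N^2))) - 1 * (q * (-T/N^2)) := by field_simp; norm_num
    rw [e]
    linarith

lemma S4_bound (T N : ℝ) (hT : 0 < T) (hN : 0 < N) (q r : ℕ) (hq : 1 ≤ q) (hr : 1 ≤ r) (a b : ℕ) (ha : N ≤ a) (hb : (b:ℝ) ≤ 2 * N) :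
    ‖∑ n ∈ Ico a (b - q - r), ee ((T * Real.log (n + r + q : ℕ) - T * Real.log (n + r : ℕ)) -
      (T * Real.log (n + q : ℕ) - T * Real.log n))‖ ≤
      (1.75 * r * q * T / N^3 + 2) * (2.26 / √(0.375 * r * q * T / N^4) + 2) := by
  have hq' : (1:ℝ) ≤ q := by exact_mod_cast hq
  have hq0 : (0:ℝ) < q := by linarith
  have hr' : (1:ℝ) ≤ r := by exact_mod_cast hr
  have hr0 : (0:ℝ) < r := by linarith
  rw [← ee_sum_neg]
  have f0 := fun y (hy : N ≤ y) (_ : y ≤ 2 * N) => d0 T y (by linarith)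
  have f1 := fun y (hy : N ≤ y) (_ : y ≤ 2 * N) => d1 T y (by linarith)
  have f2 := fun y (hy : N ≤ y) (_ : y ≤ 2 * N) => d2 T y (by linarith)
  have f3 := fun y (hy : N ≤ y) (_ : y ≤ 2 * N) => d3 T y (by linarith)
  have b2 := dstep _ _ N (2*N) q (2*T/(8*N^3)) (2*T/N^3) hq0.le f2 (fun y h1 h2 => by
    have : 0 < y := by linarith
    constructor
    · rw [show 8 * N^3 = (2*N)^3 by ring]; gcongr
    · gcongr)
  have b3 := dstep _ _ N (2*N) q (-(6*T/N^4)) (-(6*T/(16*N^4))) hq0.le f3 (fun y h1 h2 => by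
    have : 0 < y := by linarith
    have e : -6 * T / y^4 = -(6 * T / y^4) := by ring
    rw [e]
    constructor
    · apply neg_le_neg; gcongr
    · apply neg_le_neg; rw [show 16 * N^4 = (2*N)^4 by ring]; gcongr)
  have e0 := dshift _ _ N (2*N) q hq0.le f0
  have e1 := dshift _ _ N (2*N) q hq0.le f1
  have e2 := dshift _ _ N (2*N) q hq0.le f2
  have c1 := dstep _ _ N (2*N-q) r _ _ hr0.le e1 (fun y h1 h2 => b2 y h1 (by linarith))
  have c2 := dstep _ _ N (2*N-q) r _ _ hr0.le e2 (fun y h1 h2 => b3 y h1 (by linarith))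
  have e00 := dshift _ _ N (2*N-q) r hr0.le e0
  have e11 := dshift _ _ N (2*N-q) r hr0.le e1
  have g0 := dstep _ _ N (2*N-q-r) 1 _ _ (by norm_num) e00 (fun y h1 h2 => c1 y h1 (by linarith))
  have g1 := dstep _ _ N (2*N-q-r) 1 _ _ (by norm_num) e11 (fun y h1 h2 => c2 y h1 (by linarith))
  have e000 := dshift _ _ N (2*N-q-r) 1 (by norm_num) e00
  have g2 := dstep _ _ N (2*N-q-r-1) 1 _ _ (by norm_num) e000 (fun y h1 h2 => g1 y h1 (by linarith))
  refine second_diff _ a (b-q-r) _ _ (by positivity) (by positivity) ?_ ?_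
  · intro n h1 h2
    have h1' : (a:ℝ) ≤ n := by exact_mod_cast h1
    have h2' : (n:ℝ) + 2 + q + r ≤ b := by
      have : n + 2 + q + r ≤ b := by omega
      exact_mod_cast this
    have := (g2 n (by linarith) (by linarith)).2
    push_cast
    rw [show (n:ℝ) + 1 + 1 = n + 2 by ring] at this
    have e : 0.375 * (r:ℝ) * q * T / N^4 = -(1 * (1 * (r * (q * (-(6 * T / (16 * N^4))))))) := by field_simp; norm_num
    rw [e]
    linarith
  · intro n h1 h2
    have h1' : (a:ℝ) ≤ n := by exact_mod_cast h1
    have h2' : (n:ℝ) + 1 + q + r ≤ b := by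
      have : n + 1 + q + r ≤ b := by omega
      exact_mod_cast this
    have h3' : (a:ℝ) + 1 + q + r ≤ b := by linarith
    have A1 := (g0 n (by linarith) (by linarith)).1
    have A2 := (g0 a (by linarith) (by linarith)).2
    push_cast
    have e : 1.75 * (r:ℝ) * q * T / N^3 = 1 * (r * (q * (2 * T/N^3))) - 1 * (r * (q * (2 * T/(8*N^3)))) := by field_simp; norm_num
    rw [e]
    linarith

end

section
open Finset

lemma sum_id_Ico (R : ℕ) (hR : 1 ≤ R) : ∑ d ∈ Ico 1 R, (d:ℝ) = R * (R - 1) / 2 := by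
  induction R, hR using Nat.le_induction with
  | base => simp
  | succ R hR ih => rw [Finset.sum_Ico_succ_top hR, ih]; push_cast; ring

lemma sum_sq_Ico (R : ℕ) (hR : 1 ≤ R) : ∑ d ∈ Ico 1 R, (d:ℝ)^2 = R * (R - 1) * (2 * R - 1) / 6 := by
  induction R, hR using Nat.le_induction with
  | base => simp
  | succ R hR ih => rw [Finset.sum_Ico_succ_top hR, ih]; push_cast; ring

lemma sumw0 (R : ℕ) (hR : 1 ≤ R) : ∑ d ∈ Ico 1 R, ((R:ℝ) - d) ≤ R^2 / 2 := by
  rw [Finset.sum_sub_distrib, sum_id_Ico R hR]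
  simp [Nat.cast_sub hR]
  have : (1:ℝ) ≤ R := by exact_mod_cast hR
  nlinarith

lemma sumw1 (R : ℕ) (hR : 1 ≤ R) : ∑ d ∈ Ico 1 R, ((R:ℝ) - d) * d ≤ R^3 / 6 := by
  have : ∀ d ∈ Ico 1 R, ((R:ℝ) - d) * d = R * d - d^2 := fun d _ => by ring
  rw [Finset.sum_congr rfl this, Finset.sum_sub_distrib, ← Finset.mul_sum, sum_id_Ico R hR, sum_sq_Ico R hR]
  have : (1:ℝ) ≤ R := by exact_mod_cast hR
  nlinarith

lemma sumw_sqrt (R : ℕ) (hR : 1 ≤ R) : ∑ d ∈ Ico 1 R, ((R:ℝ) - d) * √d ≤ 0.289 * R^2 * √R := by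
  have hR' : (1:ℝ) ≤ R := by exact_mod_cast hR
  set s := √(R:ℝ) with hs
  have hs0 : 0 < s := Real.sqrt_pos.2 (by linarith)
  have hs2 : s^2 = R := Real.sq_sqrt (by linarith)
  -- √d ≤ (d/m + m)/2 with m = 0.5775 s
  have h1 : ∀ d ∈ Ico 1 R, ((R:ℝ) - d) * √d ≤ (1 / (2 * 0.5775 * s)) * (((R:ℝ) - d) * d) + (0.5775 * s / 2) * ((R:ℝ) - d) := by
    intro d hd
    rw [mem_Ico] at hd
    have hd' : (0:ℝ) ≤ (R:ℝ) - d := by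
      have : (d:ℝ) ≤ R := by exact_mod_cast hd.2.le
      linarith
    have : √(d:ℝ) ≤ (1 / (2 * 0.5775 * s)) * d + 0.5775 * s / 2 := by
      have hd2 : √(d:ℝ)^2 = d := Real.sq_sqrt (by positivity)
      have : (1 / (2 * 0.5775 * s)) * d + 0.5775 * s / 2 - √(d:ℝ) = (√(d:ℝ) - 0.5775 * s)^2 / (2 * 0.5775 * s) := by
        nth_rewrite 1 [← hd2]
        field_simp; ring
      have h2 : 0 ≤ (√(d:ℝ) - 0.5775 * s)^2 / (2 * 0.5775 * s) := by positivity
      linarith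
    nlinarith [mul_le_mul_of_nonneg_left this hd']
  refine (Finset.sum_le_sum h1).trans ?_
  rw [Finset.sum_add_distrib, ← Finset.mul_sum, ← Finset.mul_sum]
  have a1 := sumw1 R hR
  have a0 := sumw0 R hR
  calc _ ≤ (1 / (2 * 0.5775 * s)) * (R^3/6) + (0.5775 * s / 2) * (R^2/2) := by gcongr
    _ ≤ 0.289 * R^2 * s := by
      rw [← hs2]
      have : (1 / (2 * 0.5775 * s)) * ((s^2)^3/6) + (0.5775 * s / 2) * ((s^2)^2/2) = (1 / (12 * 0.5775) + 0.5775/4) * s^5 := by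
        field_simp; ring
      rw [this]
      have : 0.289 * (s^2)^2 * s = 0.289 * s^5 := by ring
      rw [this]
      gcongr
      norm_num

lemma sum_inv_sqrt (R : ℕ) : ∑ d ∈ Ico 1 (R+1), 1 / √(d:ℝ) ≤ 2 * √(R:ℝ) := by
  induction R with
  | zero => simp
  | succ R ih =>
    rw [Finset.sum_Ico_succ_top (by omega)]
    have hp : 0 < √((R+1:ℕ):ℝ) := Real.sqrt_pos.2 (by positivity)
    have : 1 / √((R+1:ℕ):ℝ) ≤ 2 * (√((R+1:ℕ):ℝ) - √(R:ℝ)) := by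
      rw [div_le_iff₀ hp]
      have e1 : √((R+1:ℕ):ℝ)^2 = R + 1 := by rw [Real.sq_sqrt (by positivity)]; push_cast; ring
      have e2 : √(R:ℝ)^2 = R := Real.sq_sqrt (by positivity)
      nlinarith [sq_nonneg (√((R+1:ℕ):ℝ) - √(R:ℝ))]
    linarith

lemma sumw_inv (R : ℕ) (hR : 1 ≤ R) : ∑ d ∈ Ico 1 R, ((R:ℝ) - d) * (1 / √d) ≤ 2 * R * √R := by
  obtain ⟨k, rfl⟩ : ∃ k, R = k + 1 := ⟨R - 1, by omega⟩
  have h := sum_inv_sqrt k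
  calc _ ≤ ∑ d ∈ Ico 1 (k+1), ((k+1:ℕ):ℝ) * (1 / √(d:ℝ)) := by
        apply Finset.sum_le_sum; intro d _
        have : (0:ℝ) ≤ d := by positivity
        gcongr; linarith
    _ = ((k+1:ℕ):ℝ) * ∑ d ∈ Ico 1 (k+1), (1 / √(d:ℝ)) := by rw [Finset.mul_sum]
    _ ≤ ((k+1:ℕ):ℝ) * (2 * √(k:ℝ)) := by gcongr
    _ ≤ ((k+1:ℕ):ℝ) * (2 * √((k+1:ℕ):ℝ)) := by gcongr; omega
    _ = _ := by ring

lemma stepA (x : ℕ → ℝ) (a b R : ℕ) (hab : a ≤ b) (N α β γ : ℝ) (hN : 0 < N) (hbN : (b:ℝ) - a ≤ N)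
    (hR : 1 ≤ R) (hα : 0 ≤ α) (hβ : 0 ≤ β) (hγ : 0 ≤ γ)
    (h : ∀ r, 1 ≤ r → r < R → ‖∑ n ∈ Ico a (b - r), ee (x (n + r) - x n)‖ ≤ α * √r + β * r + γ * (1 / √r) + 4) :
    ‖∑ n ∈ Ico a b, ee (x n)‖^2 ≤ (1 + R / N) * (N^2 / R + N * (0.578 * α * √R + β * R / 3 + 4 * γ / √R + 4)) := by
  have hR' : (1:ℝ) ≤ R := by exact_mod_cast hR
  have hs : 0 < √(R:ℝ) := Real.sqrt_pos.2 (by linarith)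
  have hs2 : √(R:ℝ)^2 = R := Real.sq_sqrt (by linarith)
  have hab' : (a:ℝ) ≤ b := by exact_mod_cast hab
  have hw := weyl_ee x a b R hab
  have hsum : ∑ d ∈ Ico 1 R, ((R : ℝ) - d) * ‖∑ n ∈ Ico a (b - d), ee (x (n + d) - x n)‖ ≤
      0.289 * α * R^2 * √R + β * R^3 / 6 + 2 * γ * R * √R + 2 * R^2 := by
    calc _ ≤ ∑ d ∈ Ico 1 R, (α * (((R:ℝ) - d) * √d) + β * (((R:ℝ) - d) * d) + γ * (((R:ℝ) - d) * (1 / √d)) + 4 * ((R:ℝ) - d)) := by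
          apply Finset.sum_le_sum; intro d hd
          rw [mem_Ico] at hd
          have hd' : (0:ℝ) ≤ (R:ℝ) - d := by
            have : (d:ℝ) ≤ R := by exact_mod_cast hd.2.le
            linarith
          have := mul_le_mul_of_nonneg_left (h d hd.1 hd.2) hd'
          refine this.trans (le_of_eq ?_); ring
      _ = α * (∑ d ∈ Ico 1 R, ((R:ℝ) - d) * √d) + β * (∑ d ∈ Ico 1 R, ((R:ℝ) - d) * d)
          + γ * (∑ d ∈ Ico 1 R, ((R:ℝ) - d) * (1 / √d)) + 4 * (∑ d ∈ Ico 1 R, ((R:ℝ) - d)) := by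
          rw [Finset.sum_add_distrib, Finset.sum_add_distrib, Finset.sum_add_distrib, Finset.mul_sum, Finset.mul_sum, Finset.mul_sum, Finset.mul_sum]
      _ ≤ α * (0.289 * R^2 * √R) + β * (R^3/6) + γ * (2 * R * √R) + 4 * (R^2/2) := by
          have := sumw0 R hR
          have := sumw1 R hR
          have := sumw_sqrt R hR
          have := sumw_inv R hR
          gcongr
      _ = _ := by ring
  have h2 : (R : ℝ)^2 * ‖∑ n ∈ Ico a b, ee (x n)‖^2 ≤ (N + R) * (R * N + 2 * (0.289 * α * R^2 * √R + β * R^3 / 6 + 2 * γ * R * √R + 2 * R^2)) := by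
    refine hw.trans ?_
    have : (0:ℝ) ≤ ∑ d ∈ Ico 1 R, ((R : ℝ) - d) * ‖∑ n ∈ Ico a (b - d), ee (x (n + d) - x n)‖ := by
      apply Finset.sum_nonneg; intro d hd
      rw [mem_Ico] at hd
      have : (d:ℝ) ≤ R := by exact_mod_cast hd.2.le
      exact mul_nonneg (by linarith) (norm_nonneg _)
    gcongr
  have h3 : (R : ℝ)^2 * ((1 + R / N) * (N^2 / R + N * (0.578 * α * √R + β * R / 3 + 4 * γ / √R + 4)))
     = (N + R) * (R * N + 2 * (0.289 * α * R^2 * √R + β * R^3 / 6 + 2 * γ * R * √R + 2 * R^2)) := by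
    have : 4 * γ / √R = 4 * γ * √R / R := by
      rw [← hs2]; field_simp; rw [Real.sqrt_sq hs.le]
    rw [this]
    field_simp
    ring
  have h4 : (0:ℝ) < (R:ℝ)^2 := by positivity
  rw [← h3] at h2
  exact le_of_mul_le_mul_left h2 h4

lemma stepB (x : ℕ → ℝ) (a b : ℕ) (hab : a ≤ b) (N ψ c1 c2 : ℝ) (hN : 0 < N) (hbN : (b:ℝ) - a ≤ N)
    (hc1 : 0 ≤ c1) (hc2 : 0 ≤ c2) (hψ : 0 < ψ) (hψ2 : ψ ≤ 1/2) (hψN : 50 ≤ ψ * N)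
    (h : ∀ r, 1 ≤ r → ‖∑ n ∈ Ico a (b - r), ee (x (n + r) - x n)‖ ≤ (c1 * r * ψ^3 * N + 2) * (c2 / √(r * ψ^3) + 2)) :
    ‖∑ n ∈ Ico a b, ee (x n)‖^2 ≤ 1.02 * (N^2 * ψ * (2.08 + 0.578 * c1 * c2 + c1 / 3) + 11.32 * c2 * N / ψ) := by
  set R := ⌈1 / (2 * ψ)⌉₊ with hRdef
  have hr1 : 1 ≤ 1 / (2 * ψ) := by rw [le_div_iff₀ (by positivity)]; linarith
  have hRge : 1 / (2 * ψ) ≤ R := Nat.le_ceil _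
  have hRle : (R:ℝ) ≤ 1 / ψ := by
    have := Nat.ceil_lt_add_one (show 0 ≤ 1 / (2 * ψ) by positivity)
    have e : 1 / ψ = 1 / (2 * ψ) + 1 / (2 * ψ) := by field_simp; norm_num
    rw [e]; linarith
  have hR1 : (1:ℝ) ≤ R := hr1.trans hRge
  have hR : 1 ≤ R := by exact_mod_cast hR1
  set p := √ψ with hp
  have hp0 : 0 < p := Real.sqrt_pos.2 hψ
  have hp2 : p^2 = ψ := Real.sq_sqrt hψ.le
  have hψ3 : √(ψ^3) = p^3 := by
    rw [← hp2, show (p^2)^3 = (p^3)^2 by ring, Real.sqrt_sq (by positivity)]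
  have key := stepA x a b R hab N (c1 * c2 * N * p^3) (2 * c1 * ψ^3 * N) (2 * c2 / p^3) hN hbN hR
    (by positivity) (by positivity) (by positivity) (by
      intro r hr _
      refine (h r hr).trans (le_of_eq ?_)
      have hr' : (1:ℝ) ≤ r := by exact_mod_cast hr
      have hsr : 0 < √(r:ℝ) := Real.sqrt_pos.2 (by linarith)
      have hsr2 : √(r:ℝ)^2 = r := Real.sq_sqrt (by linarith)
      rw [Real.sqrt_mul (by linarith), hψ3]
      have e1 : c1 * r * ψ^3 * N * (c2 / (√r * p^3)) = c1 * c2 * N * p^3 * √r := by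
        rw [← hp2]; nth_rewrite 1 [← hsr2]; field_simp
      have e2 : 2 * (c2 / (√r * p^3)) = 2 * c2 / p^3 * (1 / √r) := by field_simp
      linear_combination e1 + e2)
  have hsR : 0 < √(R:ℝ) := Real.sqrt_pos.2 (by linarith)
  have b0 : 1 + (R:ℝ) / N ≤ 1.02 := by
    have : (R:ℝ) / N ≤ 0.02 := by
      rw [div_le_iff₀ hN]
      have : 1 / ψ ≤ 0.02 * N := by rw [div_le_iff₀ hψ]; linarith
      linarith
    linarith
  have b1 : N^2 / R ≤ 2 * ψ * N^2 := by
    rw [div_le_iff₀ (by linarith)]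
    have : 1 ≤ 2 * ψ * R := by
      rw [div_le_iff₀ (by positivity)] at hRge; linarith
    nlinarith [sq_nonneg N]
  have s1 : √(R:ℝ) ≤ 1 / p := by
    rw [Real.sqrt_le_iff]
    refine ⟨by positivity, hRle.trans (le_of_eq ?_)⟩
    rw [← hp2]; field_simp
  have s2 : 1 / √(R:ℝ) ≤ 1.415 * p := by
    rw [div_le_iff₀ hsR]
    have : 1 / (1.415 * p) ≤ √(R:ℝ) := by
      apply Real.le_sqrt_of_sq_le
      refine le_trans ?_ hRge
      rw [← hp2, div_pow, mul_pow, one_pow]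
      gcongr
      norm_num
    rw [div_le_iff₀ (by positivity)] at this
    linarith
  have b2 : 0.578 * (c1 * c2 * N * p^3) * √R ≤ 0.578 * c1 * c2 * N * ψ := by
    calc _ ≤ 0.578 * (c1 * c2 * N * p^3) * (1/p) := by gcongr
      _ = _ := by rw [← hp2]; field_simp
  have b3 : 2 * c1 * ψ^3 * N * R / 3 ≤ c1 / 3 * ψ * N := by
    calc _ ≤ 2 * c1 * ψ^3 * N * (1/ψ) / 3 := by gcongr
      _ = (2 * c1 * ψ * N / 3) * ψ := by field_simp
      _ ≤ (2 * c1 * ψ * N / 3) * (1/2) := by gcongr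
      _ = _ := by ring
  have b4 : 4 * (2 * c2 / p^3) / √R ≤ 11.32 * c2 / ψ := by
    calc _ = 4 * (2 * c2 / p^3) * (1 / √R) := by ring
      _ ≤ 4 * (2 * c2 / p^3) * (1.415 * p) := by gcongr
      _ = _ := by rw [← hp2]; field_simp; ring
  have b5 : 4 ≤ 0.08 * ψ * N := by linarith
  calc _ ≤ _ := key
    _ ≤ 1.02 * (2 * ψ * N^2 + N * (0.578 * c1 * c2 * N * ψ + c1 / 3 * ψ * N + 11.32 * c2 / ψ + 0.08 * ψ * N)) := by gcongr
    _ = _ := by ring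

end

section
open Finset

lemma K3 (T N ψ : ℝ) (hT : 0 < T) (hN : 0 < N) (hψ : 0 < ψ) (hψ3 : ψ^3 = T / N^3) (hψ2 : ψ ≤ 1/2)
    (hψN : 50 ≤ ψ * N) (a b : ℕ) (hab : a ≤ b) (ha : N ≤ a) (hb : (b:ℝ) ≤ 2 * N) :
    ‖∑ n ∈ Ico a b, ee (T * Real.log n)‖^2 ≤ 4.376 * N^2 * ψ + 52.2 * N / ψ := by
  have key := stepB (fun n => T * Real.log n) a b hab N ψ 0.75 4.52 hN (by linarith) (by norm_num) (by norm_num) hψ hψ2 hψN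
    (by
      intro r hr
      have hr' : (1:ℝ) ≤ r := by exact_mod_cast hr
      have := S3_bound T N hT hN r hr a b ha hb
      refine this.trans (le_of_eq ?_)
      have e1 : 0.75 * (r:ℝ) * T / N^2 = 0.75 * r * ψ^3 * N := by rw [hψ3]; field_simp
      have e2 : √(r * T / (4 * N^3)) = √(r * ψ^3) / 2 := by
        have : r * T / (4 * N^3) = (r * ψ^3) / 2^2 := by rw [hψ3]; field_simp; norm_num
        rw [this, Real.sqrt_div (by positivity), Real.sqrt_sq (by norm_num)]
      rw [e1, e2]
      congr 2
      have : 0 < √(r * ψ^3) := Real.sqrt_pos.2 (by positivity)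
      field_simp; norm_num)
  refine key.trans ?_
  have h1 : 0 < N^2 * ψ := by positivity
  have h2 : 0 < N / ψ := by positivity
  have e : 11.32 * 4.52 * N / ψ = 11.32 * 4.52 * (N / ψ) := by ring
  have e' : 52.2 * N / ψ = 52.2 * (N / ψ) := by ring
  rw [e, e']
  nlinarith

lemma sqrt_bd {S A B x y : ℝ} (hx : 0 ≤ x) (hy : 0 ≤ y) (h : S^2 ≤ A + B) (hA : A ≤ x^2) (hB : B ≤ y^2) : S ≤ x + y := by
  apply le_of_sq_le_sq _ (by positivity)
  nlinarith [mul_nonneg hx hy]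
  where le_of_sq_le_sq {a b : ℝ} (h : a^2 ≤ b^2) (hb : 0 ≤ b) : a ≤ b := abs_le_of_sq_le_sq' h hb |>.2

lemma K4inner (T N ψ : ℝ) (hT : 0 < T) (hN : 0 < N) (hψ : 0 < ψ) (q : ℕ) (hq : 1 ≤ q)
    (hψ3 : ψ^3 = q * T / N^4) (hψ2 : ψ ≤ 1/2)
    (hψN : 50 ≤ ψ * N) (a b : ℕ) (ha : N ≤ a) (hb : (b:ℝ) ≤ 2 * N) :
    ‖∑ n ∈ Ico a (b - q), ee (T * Real.log (n + q : ℕ) - T * Real.log n)‖ ≤ 2.556 * N * √ψ + 6.535 * √N / √ψ := by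
  have hq' : (1:ℝ) ≤ q := by exact_mod_cast hq
  have hp0 : 0 < √ψ := Real.sqrt_pos.2 hψ
  rcases lt_or_ge (b - q) a with hlt | hab
  · rw [Finset.Ico_eq_empty (by omega)]; simp; positivity
  have hb' : ((b - q : ℕ):ℝ) ≤ 2 * N := by
    have : ((b - q : ℕ):ℝ) ≤ b := by exact_mod_cast Nat.sub_le b q
    linarith
  have key := stepB (fun n => T * Real.log (n + q : ℕ) - T * Real.log n) a (b-q) hab N ψ 1.75 3.691 hN (by linarith) (by norm_num) (by norm_num) hψ hψ2 hψN
    (by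
      intro r hr
      have hr' : (1:ℝ) ≤ r := by exact_mod_cast hr
      have := S4_bound T N hT hN q r hq hr a b ha hb
      refine this.trans ?_
      have e1 : 1.75 * (r:ℝ) * q * T / N^3 = 1.75 * r * ψ^3 * N := by rw [hψ3]; field_simp
      have e2 : √(0.375 * r * q * T / N^4) = √0.375 * √(r * ψ^3) := by
        rw [← Real.sqrt_mul (by norm_num)]; congr 1; rw [hψ3]; field_simp
      rw [e1, e2]
      have h1 : 0 < √(r * ψ^3) := Real.sqrt_pos.2 (by positivity)
      have h2 : 0.61236 ≤ √0.375 := by apply Real.le_sqrt_of_sq_le; norm_num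
      refine mul_le_mul_of_nonneg_left ?_ (by positivity)
      refine add_le_add_left ?_ 2
      rw [div_le_div_iff₀ (by positivity) h1]
      nlinarith)
  refine sqrt_bd (by positivity) (by positivity) (key.trans (le_of_eq (by rw [mul_add]))) ?_ ?_
  · rw [mul_pow, Real.sq_sqrt hψ.le]
    have : 0 < N^2 * ψ := by positivity
    nlinarith
  · rw [div_pow, mul_pow, Real.sq_sqrt hψ.le, Real.sq_sqrt hN.le]
    have h2 : 0 < N / ψ := by positivity
    have e : 11.32 * 3.691 * N / ψ = 11.32 * 3.691 * (N / ψ) := by ring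
    have e' : 6.535^2 * N / ψ = 6.535^2 * (N / ψ) := by ring
    rw [e, e']
    nlinarith

lemma exists_root (n : ℕ) (hn : n ≠ 0) (y : ℝ) (hy : 0 < y) : ∃ x : ℝ, 0 < x ∧ x^n = y :=
  ⟨y ^ ((1:ℝ)/n), Real.rpow_pos_of_pos hy _, by
    rw [← Real.rpow_natCast, ← Real.rpow_mul hy.le]; field_simp; simp⟩

set_option maxHeartbeats 1600000 in
lemma K4 (T N φ : ℝ) (hT : 0 < T) (hN : 0 < N) (hφ : 0 < φ) (hφ7 : φ^7 = T / N^4) (hφ2 : φ ≤ 1/2)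
    (hφN : 125 ≤ φ * N) (hTN : 125000 * N ≤ T) (a b : ℕ) (hab : a ≤ b) (ha : N ≤ a) (hb : (b:ℝ) ≤ 2 * N) :
    ‖∑ n ∈ Ico a b, ee (T * Real.log n)‖^2 ≤ 3.22 * N^2 * φ + 11.95 * (N * √N) / φ := by
  set Q := ⌈2 / φ⌉₊ with hQdef
  have hρ : 4 ≤ 2 / φ := by rw [le_div_iff₀ hφ]; linarith
  have hQge : 2 / φ ≤ Q := Nat.le_ceil _
  have hQle : (Q:ℝ) ≤ 2.5 / φ := by
    have := Nat.ceil_lt_add_one (show 0 ≤ 2 / φ by positivity)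
    have e : 2.5 / φ = 2 / φ + (1/4) * (2/φ) := by ring
    rw [e]; linarith
  have hQ4 : (4:ℝ) ≤ Q := hρ.trans hQge
  have hQ : 1 ≤ Q := by
    have : (1:ℝ) ≤ Q := by linarith
    exact_mod_cast this
  have hQ0 : (0:ℝ) < Q := by linarith
  have hQφ : 2 ≤ Q * φ := by rwa [div_le_iff₀ hφ] at hQge
  have hQφ' : Q * φ ≤ 2.5 := by rwa [le_div_iff₀ hφ] at hQle
  have hsN : 0 < √N := Real.sqrt_pos.2 hN
  obtain ⟨w, hw, hw6⟩ := exists_root 6 (by norm_num) (Q * φ^7) (by positivity)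
  -- bounds on w
  have hw1 : w ≤ 1.166 * φ := by
    apply le_of_pow_le_pow_left₀ (n := 6) (by norm_num) (by positivity)
    rw [hw6, mul_pow]
    have : Q * φ^7 = (Q * φ) * φ^6 := by ring
    rw [this]
    gcongr
    linarith [show (2.5:ℝ) ≤ 1.166^6 by norm_num]
  have hw2 : 1.12 * φ ≤ w := by
    apply le_of_pow_le_pow_left₀ (n := 6) (by norm_num) hw.le
    rw [hw6, mul_pow]
    have : Q * φ^7 = (Q * φ) * φ^6 := by ring
    rw [this]
    gcongr
    linarith [show (1.12:ℝ)^6 ≤ 2 by norm_num]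
  have hsQ : 0 < √(Q:ℝ) := Real.sqrt_pos.2 hQ0
  have hinner : ∀ q ∈ Ico 1 Q, ((Q:ℝ) - q) * ‖∑ n ∈ Ico a (b - q), ee (T * Real.log (n + q : ℕ) - T * Real.log n)‖ ≤
      (2.556 * N * w * (5/6) + 6.535 * √N / w * (2/3)) * ((Q:ℝ) - q) + 2.556 * N * w / (6 * Q) * (((Q:ℝ) - q) * q)
        + 6.535 * √N / w / 3 * √Q * (((Q:ℝ) - q) * (1 / √q)) := by
    intro q hq
    rw [mem_Ico] at hq
    have hq' : (1:ℝ) ≤ q := by exact_mod_cast hq.1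
    have hqQ : (q:ℝ) ≤ Q := by exact_mod_cast hq.2.le
    have hq0 : (0:ℝ) < q := by linarith
    obtain ⟨v, hv, hv6⟩ := exists_root 6 (by norm_num) (q * φ^7) (by positivity)
    have hv23 : (v^2)^3 = q * T / N^4 := by rw [← pow_mul, hv6, hφ7]; ring
    have hv2 : v^2 ≤ 1/2 := by
      apply le_of_pow_le_pow_left₀ (n := 3) (by norm_num) (by positivity)
      rw [← pow_mul, hv6]
      calc (q:ℝ) * φ^7 ≤ Q * φ^7 := by gcongr
        _ = (Q * φ) * φ^6 := by ring
        _ ≤ 2.5 * (1/2)^6 := by gcongr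
        _ ≤ _ := by norm_num
    have hv2N : 50 ≤ v^2 * N := by
      apply le_of_pow_le_pow_left₀ (n := 3) (by norm_num) (by positivity)
      rw [mul_pow, hv23]
      have : q * T / N^4 * N^3 = q * (T / N) := by field_simp
      rw [this]
      have h1 : 125000 ≤ T / N := by rw [le_div_iff₀ hN]; exact hTN
      nlinarith
    have h := K4inner T N (v^2) hT hN (by positivity) q hq.1 hv23 hv2 hv2N a b ha hb
    rw [Real.sqrt_sq hv.le] at h
    -- Bernoulli
    have hs0 : 0 < v / w := by positivity
    have hs6 : (v/w)^6 = q / Q := by rw [div_pow, hv6, hw6]; field_simp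
    have hb1 : v ≤ w * (5/6 + q / (6 * Q)) := by
      have := one_add_mul_le_pow (show (-2:ℝ) ≤ v/w - 1 by linarith) 6
      rw [add_sub_cancel, hs6] at this
      have h2 : v / w ≤ 5/6 + q / (6 * Q) := by
        have : (q:ℝ) / (6 * Q) = q / Q / 6 := by field_simp
        rw [this]; push_cast at *; linarith
      rwa [div_le_iff₀ hw, mul_comm] at h2
    have hb2 : 1 / v ≤ (1 / w) * (2/3 + (1/3) * (√Q * (1 / √q))) := by
      have hs0' : 0 < w / v := by positivity
      have := one_add_mul_le_pow (show (-2:ℝ) ≤ w/v - 1 by linarith) 3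
      have hsq : (w/v)^3 = √Q * (1 / √q) := by
        have hsq0 : 0 < √(q:ℝ) := Real.sqrt_pos.2 hq0
        rw [← pow_left_inj₀ (by positivity) (by positivity) (two_ne_zero), ← pow_mul, div_pow, hv6, hw6, mul_pow, div_pow,
          Real.sq_sqrt hQ0.le, Real.sq_sqrt hq0.le]
        field_simp
      rw [add_sub_cancel, hsq] at this
      have h2 : w / v ≤ 2/3 + (1/3) * (√Q * (1 / √q)) := by push_cast at this; linarith
      calc 1 / v = (1 / w) * (w / v) := by field_simp
        _ ≤ _ := by gcongr
    have hd' : (0:ℝ) ≤ (Q:ℝ) - q := by linarith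
    calc _ ≤ ((Q:ℝ) - q) * (2.556 * N * v + 6.535 * √N * (1 / v)) := by
          gcongr; refine h.trans (le_of_eq (by ring))
      _ ≤ ((Q:ℝ) - q) * (2.556 * N * (w * (5/6 + q / (6 * Q))) + 6.535 * √N * ((1 / w) * (2/3 + (1/3) * (√Q * (1 / √q))))) := by
          gcongr
      _ = _ := by field_simp; ring
  have hsum : ∑ q ∈ Ico 1 Q, ((Q:ℝ) - q) * ‖∑ n ∈ Ico a (b - q), ee (T * Real.log (n + q : ℕ) - T * Real.log n)‖ ≤
      Q^2 * (1.136 * N * w + 6.535 * √N / w) := by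
    refine (Finset.sum_le_sum hinner).trans ?_
    rw [Finset.sum_add_distrib, Finset.sum_add_distrib, ← Finset.mul_sum, ← Finset.mul_sum, ← Finset.mul_sum]
    have t0 := sumw0 Q hQ
    have t1 := sumw1 Q hQ
    have t2 := sumw_inv Q hQ
    calc _ ≤ (2.556 * N * w * (5/6) + 6.535 * √N / w * (2/3)) * (Q^2/2) + 2.556 * N * w / (6 * Q) * (Q^3/6)
        + 6.535 * √N / w / 3 * √Q * (2 * Q * √Q) := by gcongr
      _ = Q^2 * (1.136 * N * w + 6.535 * √N / w) := by
        have : √(Q:ℝ) * √(Q:ℝ) = Q := Real.mul_self_sqrt hQ0.le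
        have e : 6.535 * √N / w / 3 * √Q * (2 * Q * √Q) = 6.535 * √N / w / 3 * (2 * Q) * (√(Q:ℝ) * √(Q:ℝ)) := by ring
        rw [e, this]
        field_simp; ring
  have hwy := weyl_ee (fun n => T * Real.log n) a b Q hab
  have hab' : (a:ℝ) ≤ b := by exact_mod_cast hab
  have h2 : (Q:ℝ)^2 * ‖∑ n ∈ Ico a b, ee (T * Real.log n)‖^2 ≤ (Q:ℝ)^2 * (1.02 * (N^2 / Q + 2 * N * (1.136 * N * w + 6.535 * √N / w))) := by
    have hQN : (Q:ℝ) ≤ 0.02 * N := by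
      have : 2.5 / φ ≤ 0.02 * N := by rw [div_le_iff₀ hφ]; linarith
      linarith
    have hnn : (0:ℝ) ≤ Q * N + 2 * (Q^2 * (1.136 * N * w + 6.535 * √N / w)) := by positivity
    calc _ ≤ _ := hwy
      _ ≤ ((b:ℝ) - a + Q) * (Q * N + 2 * (Q^2 * (1.136 * N * w + 6.535 * √N / w))) := by
        have : 0 ≤ (b:ℝ) - a + Q := by linarith
        gcongr
        linarith
      _ ≤ (1.02 * N) * (Q * N + 2 * (Q^2 * (1.136 * N * w + 6.535 * √N / w))) := by
        gcongr; linarith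
      _ = _ := by field_simp
  have h3 := le_of_mul_le_mul_left h2 (by positivity)
  refine h3.trans ?_
  have u1 : N^2 / Q ≤ 0.5 * φ * N^2 := by
    rw [div_le_iff₀ hQ0]
    nlinarith [sq_nonneg N]
  have u2 : 6.535 * √N / w ≤ 5.835 * √N / φ := by
    rw [div_le_div_iff₀ hw hφ]
    nlinarith
  have hN2 : 0 < N^2 * φ := by positivity
  calc _ ≤ 1.02 * (0.5 * φ * N^2 + 2 * N * (1.136 * N * (1.166 * φ) + 5.835 * √N / φ)) := by gcongr
    _ = 1.02 * (0.5 + 2 * 1.136 * 1.166) * (N^2 * φ) + 1.02 * 2 * 5.835 * ((N * √N) / φ) := by ring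
    _ ≤ 3.22 * (N^2 * φ) + 11.95 * ((N * √N) / φ) := by gcongr <;> norm_num
    _ = _ := by ring

end

section
open Finset

/-- Euler-Maclaurin partial sums times (s-1) -/
noncomputable def EM (N : ℕ) (s : ℂ) : ℂ :=
  (s - 1) * (∑ n ∈ Ico 1 N, (n:ℂ) ^ (-s) + 1/2 * (N:ℂ)^(-s) + s/12 * (N:ℂ)^(-s-1)) + (N:ℂ)^(1-s)

lemma EM_step (N : ℕ) (hN : 1 ≤ N) (s : ℂ) (hs : -1 < s.re) :
    ‖EM (N+1) s - EM N s‖ ≤ ‖s-1‖ * (‖s‖ * ‖s+1‖) / (12 * (s.re + 1)) * ((N:ℝ)^(-s.re-1) - ((N:ℝ)+1)^(-s.re-1)) := by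
  have hN' : (1:ℝ) ≤ N := by exact_mod_cast hN
  let B : ℝ → ℂ := fun x => (((x - N)^2 - (x-N) + 1/6) / 2 : ℝ)
  let V : ℝ → ℂ := fun x => (s-1) * (((((x - N)^2 - (x-N) + 1/6) / 2 : ℝ):ℂ) * (-s * (x:ℂ)^(-s-1)) - (((x - N) - 1/2 : ℝ):ℂ) * (x:ℂ)^(-s)) - (x:ℂ)^(1-s)
  have hV1 : V (N+1) = (s-1) * (-(s/12) * ((N+1:ℕ):ℂ)^(-s-1) - 1/2 * ((N+1:ℕ):ℂ)^(-s)) - ((N+1:ℕ):ℂ)^(1-s) := by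
    simp only [V]; push_cast; ring_nf
  have hV0 : V N = (s-1) * (-(s/12) * (N:ℂ)^(-s-1) + 1/2 * (N:ℂ)^(-s)) - (N:ℂ)^(1-s) := by
    simp only [V]; push_cast; ring_nf
  have hE : EM (N+1) s - EM N s = -(V (N+1) - V N) := by
    rw [hV1, hV0, EM, EM, Finset.sum_Ico_succ_top hN]; ring
  rw [hE, norm_neg]
  have hder : ∀ x : ℝ, 0 < x → HasDerivAt V ((s-1) * ((((x - N)^2 - (x-N) + 1/6) / 2 : ℝ) * (s * (s+1) * (x:ℂ)^(-s-2)))) x := by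
    intro x hx
    have hxc : (x:ℂ) ≠ 0 := by exact_mod_cast hx.ne'
    have hp : ∀ r : ℂ, HasDerivAt (fun y : ℝ => (y:ℂ)^r) (r * (x:ℂ)^(r-1)) x := by
      intro r
      have h1 : HasDerivAt (fun z : ℂ => z ^ r) (r * (x:ℂ)^(r-1)) (x:ℂ) := by
        have := (hasDerivAt_id (x:ℂ)).cpow_const (c := r) (Or.inl (by simpa using hx))
        simpa using this
      exact h1.comp_ofReal
    have hB : HasDerivAt (fun y : ℝ => (((((y - N)^2 - (y-N) + 1/6) / 2 : ℝ):ℂ))) (((x - N) - 1/2 : ℝ):ℂ) x := by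
      have : HasDerivAt (fun y : ℝ => ((y - N)^2 - (y-N) + 1/6) / 2) ((x-N) - 1/2) x := by
        have h := (((((hasDerivAt_id x).sub_const (N:ℝ)).pow 2).sub ((hasDerivAt_id x).sub_const (N:ℝ))).add_const (1/6)).div_const 2
        refine h.congr_deriv ?_
        simp only [id]; push_cast; ring
      exact this.ofReal_comp
    have hB' : HasDerivAt (fun y : ℝ => ((((y - N) - 1/2 : ℝ):ℂ))) (1:ℂ) x := by
      have : HasDerivAt (fun y : ℝ => (y - N) - 1/2) 1 x := ((hasDerivAt_id x).sub_const (N:ℝ)).sub_const (1/2)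
      exact_mod_cast this.ofReal_comp
    have := (((hB.mul ((hp (-s-1)).const_mul (-s))).sub (hB'.mul (hp (-s)))).const_mul (s-1)).sub (hp (1-s))
    refine this.congr_deriv ?_
    have e1 : (x:ℂ)^(-s-1-1) = (x:ℂ)^(-s-2) := by congr 1; ring
    have e2 : (x:ℂ)^(1-s-1) = (x:ℂ)^(-s) := by congr 1; ring
    rw [e1, e2]; ring
  set C := ‖s-1‖ * (‖s‖ * ‖s+1‖) / (12 * (s.re + 1)) with hC
  have hder2 : ∀ x : ℝ, 0 < x → HasDerivAt (fun x : ℝ => C * ((N:ℝ)^(-s.re-1) - x^(-s.re-1))) (C * ((s.re+1) * x^(-s.re-2))) x := by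
    intro x hx
    have h1 := ((Real.hasDerivAt_rpow_const (p := -s.re-1) (Or.inl hx.ne')).const_sub ((N:ℝ)^(-s.re-1))).const_mul C
    refine h1.congr_deriv ?_
    have : -s.re-1-1 = -s.re-2 := by ring
    rw [this]; ring
  have key := image_norm_le_of_norm_deriv_right_le_deriv_boundary' (f := fun x => V x - V N)
    (f' := fun x => (s-1) * ((((x - N)^2 - (x-N) + 1/6) / 2 : ℝ) * (s * (s+1) * (x:ℂ)^(-s-2))))
    (a := (N:ℝ)) (b := (N:ℝ)+1) (B := fun x : ℝ => C * ((N:ℝ)^(-s.re-1) - x^(-s.re-1))) (B' := fun x => C * ((s.re+1) * x^(-s.re-2)))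
    (fun x hx => ((hder x (by linarith [hx.1])).sub_const _).continuousAt.continuousWithinAt)
    (fun x hx => ((hder x (by linarith [hx.1])).sub_const _).hasDerivWithinAt)
    (by simp)
    (fun x hx => (hder2 x (by linarith [hx.1])).continuousAt.continuousWithinAt)
    (fun x hx => (hder2 x (by linarith [hx.1])).hasDerivWithinAt)
    (by
      intro x hx
      have hx0 : 0 < x := by linarith [hx.1]
      rw [norm_mul, norm_mul, norm_mul, norm_mul, Complex.norm_real, Complex.norm_cpow_eq_rpow_re_of_pos hx0]
      have hb : ‖((x - N)^2 - (x-N) + 1/6) / 2‖ ≤ 1/12 := by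
        rw [Real.norm_eq_abs, abs_le]
        constructor <;> nlinarith [hx.1, hx.2, sq_nonneg (x - N - 1/2), mul_nonneg (sub_nonneg.2 hx.1) (sub_nonneg.2 hx.2.le)]
      have e : (-s-2).re = -s.re-2 := by simp
      rw [e]
      have hs1 : 0 < s.re + 1 := by linarith
      calc _ ≤ ‖s-1‖ * (1/12 * (‖s‖ * ‖s+1‖ * x^(-s.re-2))) := by gcongr
        _ = _ := by rw [hC]; field_simp)
    (x := (N:ℝ)+1) (by simp)
  simpa using key

lemma EM_diff (N M : ℕ) (hN : 1 ≤ N) (hM : N ≤ M) (s : ℂ) (hs : -1 < s.re) :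
    ‖EM M s - EM N s‖ ≤ ‖s-1‖ * (‖s‖ * ‖s+1‖) / (12 * (s.re + 1)) * ((N:ℝ)^(-s.re-1) - (M:ℝ)^(-s.re-1)) := by
  induction M, hM using Nat.le_induction with
  | base => simp
  | succ M hM ih =>
    have h := EM_step M (hN.trans hM) s hs
    calc ‖EM (M+1) s - EM N s‖ = ‖(EM (M+1) s - EM M s) + (EM M s - EM N s)‖ := by congr 1; ring
      _ ≤ _ := norm_add_le _ _
      _ ≤ _ := add_le_add h ih
      _ = _ := by push_cast; ring

lemma EM_tendsto_big (s : ℂ) (hs : 1 < s.re) : Filter.Tendsto (fun N : ℕ => EM N s) Filter.atTop (nhds (riemannZeta₁ s)) := by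
  have hs1 : s ≠ 1 := by rintro rfl; simp at hs
  have hz : ∀ r : ℂ, r.re < 0 → Filter.Tendsto (fun N : ℕ => (N:ℂ)^r) Filter.atTop (nhds 0) := by
    intro r hr
    rw [tendsto_zero_iff_norm_tendsto_zero]
    have : Filter.Tendsto (fun N : ℕ => (N:ℝ)^(-(-r.re))) Filter.atTop (nhds 0) :=
      (tendsto_rpow_neg_atTop (by linarith)).comp tendsto_natCast_atTop_atTop
    refine this.congr' ?_
    filter_upwards [Filter.eventually_gt_atTop 0] with N hN
    rw [Complex.norm_natCast_cpow_of_pos hN]; simp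
  have hsum : HasSum (fun n : ℕ => (n:ℂ)^(-s)) (riemannZeta s) := by
    rw [zeta_eq_tsum_one_div_nat_cpow hs]
    have h := (Complex.summable_one_div_nat_cpow (p := s)).2 hs
    have := h.hasSum
    convert this using 2 with n
    rw [Complex.cpow_neg, one_div]
  have hsum' : Filter.Tendsto (fun N : ℕ => ∑ n ∈ Ico 1 N, (n:ℂ)^(-s)) Filter.atTop (nhds (riemannZeta s)) := by
    refine (hsum.tendsto_sum_nat).congr' ?_
    filter_upwards [Filter.eventually_gt_atTop 0] with N hN
    rw [Finset.range_eq_Ico, Finset.sum_eq_sum_Ico_succ_bot hN]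
    have : ((0:ℕ):ℂ)^(-s) = 0 := by
      rw [Nat.cast_zero, Complex.zero_cpow]; intro h; rw [neg_eq_zero] at h; rw [h] at hs; simp at hs; linarith
    rw [this]; simp
  have := (((hsum'.add ((hz (-s) (by simp; linarith)).const_mul (1/2))).add ((hz (-s-1) (by simp; linarith)).const_mul (s/12))).const_mul (s-1)).add (hz (1-s) (by simp; linarith))
  have e : riemannZeta₁ s = (s-1) * (riemannZeta s + 1/2 * 0 + s/12 * 0) + 0 := by
    rw [riemannZeta_eq_inv_sub_mul hs1]
    have : s - 1 ≠ 0 := sub_ne_zero.2 hs1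
    field_simp; ring
  rw [e]
  exact this

lemma EM_differentiable (N : ℕ) (hN : 1 ≤ N) : Differentiable ℂ (EM N) := by
  have h : ∀ n : ℕ, 1 ≤ n → (n:ℂ) ≠ 0 := fun n hn => by exact_mod_cast (by omega : n ≠ 0)
  have hp : ∀ n : ℕ, 1 ≤ n → Differentiable ℂ (fun s : ℂ => (n:ℂ)^(-s)) := fun n hn =>
    Differentiable.const_cpow (by fun_prop) (Or.inl (h n hn))
  have h1 : Differentiable ℂ (fun s : ℂ => (N:ℂ)^(-s-1)) := Differentiable.const_cpow (by fun_prop) (Or.inl (h N hN))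
  have h2 : Differentiable ℂ (fun s : ℂ => (N:ℂ)^(1-s)) := Differentiable.const_cpow (by fun_prop) (Or.inl (h N hN))
  have h3 : Differentiable ℂ (fun s : ℂ => ∑ n ∈ Ico 1 N, (n:ℂ)^(-s)) :=
    Differentiable.fun_sum fun n hn => hp n (mem_Ico.1 hn).1
  have h4 := hp N hN
  unfold EM
  fun_prop

lemma EM_tendsto (s : ℂ) (hs : 0 < s.re) : Filter.Tendsto (fun N : ℕ => EM N s) Filter.atTop (nhds (riemannZeta₁ s)) := by
  set b : ℝ := ‖s‖ + 3 with hb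
  let U : Set ℂ := {z | 0 < z.re} ∩ Metric.ball 0 b
  have hUo : IsOpen U := (isOpen_lt continuous_const Complex.continuous_re).inter Metric.isOpen_ball
  have hUc : IsPreconnected U := ((convex_halfSpace_re_gt 0).inter (convex_ball 0 b)).isPreconnected
  have hb0 : 0 < b := by positivity
  have hbd : ∀ (i : ℕ) (w : ℂ), w ∈ U → ‖EM (i+1+1) w - EM (i+1) w‖ ≤ (b+1)^3 * (1 / ((i:ℝ)+1)^2) := by
    intro i w hw
    have hw1 : 0 < w.re := hw.1
    have hw2 : ‖w‖ < b := by simpa using hw.2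
    have h := EM_step (i+1) (by omega) w (by linarith)
    have hi : (0:ℝ) < (i:ℝ)+1 := by positivity
    have hmv : ((i:ℝ)+1)^(-w.re-1) - ((i:ℝ)+1+1)^(-w.re-1) ≤ (w.re+1) * (1/((i:ℝ)+1)^2) := by
      set n : ℝ := (i:ℝ)+1
      have hn1 : 1 ≤ n := by simp [n]
      have e1 : (n+1)^(-w.re-1) = n^(-w.re-1) * (1+1/n)^(-w.re-1) := by
        rw [← Real.mul_rpow hi.le (by positivity)]; congr 1; field_simp
      have e2 : 1 - (w.re+1) * (1/n) ≤ (1+1/n)^(-w.re-1) := by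
        have hp : 0 < 1 + 1/n := by positivity
        rw [Real.rpow_def_of_pos hp]
        have h1 := Real.add_one_le_exp (Real.log (1+1/n) * (-w.re-1))
        have h2 := Real.log_le_sub_one_of_pos hp
        nlinarith
      have e3 : n^(-w.re-1) ≤ 1/n := by
        rw [one_div, ← Real.rpow_neg_one]
        exact Real.rpow_le_rpow_of_exponent_le hn1 (by linarith)
      have h0 : 0 ≤ n^(-w.re-1) := by positivity
      rw [e1]
      calc n^(-w.re-1) - n^(-w.re-1) * (1+1/n)^(-w.re-1) ≤ n^(-w.re-1) - n^(-w.re-1) * (1 - (w.re+1) * (1/n)) := by gcongr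
        _ = n^(-w.re-1) * ((w.re+1) * (1/n)) := by ring
        _ ≤ (1/n) * ((w.re+1) * (1/n)) := by gcongr
        _ = _ := by ring
    push_cast at h
    refine h.trans ?_
    have hs1 : 0 < w.re + 1 := by linarith
    have n1 : ‖w-1‖ ≤ b+1 := (norm_sub_le _ _).trans (by simp; linarith)
    have n2 : ‖w+1‖ ≤ b+1 := (norm_add_le _ _).trans (by simp; linarith)
    calc _ ≤ ‖w - 1‖ * (‖w‖ * ‖w + 1‖) / (12 * (w.re + 1)) * ((w.re+1) * (1/((i:ℝ)+1)^2)) := by gcongr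
      _ = ‖w - 1‖ * (‖w‖ * ‖w + 1‖) * (1/12) * (1/((i:ℝ)+1)^2) := by field_simp
      _ ≤ (b+1) * ((b+1) * (b+1)) * 1 * (1/((i:ℝ)+1)^2) := by gcongr <;> first | linarith | norm_num
      _ = _ := by ring
  have hsum : Summable (fun i : ℕ => (b+1)^3 * (1 / ((i:ℝ)+1)^2)) := by
    apply Summable.mul_left
    have := (summable_nat_add_iff 1).2 (Real.summable_one_div_nat_pow.2 (by norm_num : 1 < 2))
    simpa using this
  let F : ℂ → ℂ := fun w => EM 1 w + ∑' i : ℕ, (EM (i+1+1) w - EM (i+1) w)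
  have hF : DifferentiableOn ℂ F U := by
    apply DifferentiableOn.add (EM_differentiable 1 le_rfl).differentiableOn
    exact Complex.differentiableOn_tsum_of_summable_norm hsum (fun i => ((EM_differentiable _ (by omega)).sub (EM_differentiable _ (by omega))).differentiableOn) hUo hbd
  have htend : ∀ w ∈ U, Filter.Tendsto (fun N : ℕ => EM N w) Filter.atTop (nhds (F w)) := by
    intro w hw
    have h1 : Summable (fun i : ℕ => EM (i+1+1) w - EM (i+1) w) := Summable.of_norm_bounded hsum (fun i => hbd i w hw)
    have h2 := (h1.hasSum.tendsto_sum_nat).const_add (EM 1 w)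
    rw [← Filter.tendsto_add_atTop_iff_nat 1]
    refine h2.congr ?_
    intro N
    rw [Finset.sum_range_sub (fun i => EM (i+1) w)]; simp
  have heq : Set.EqOn F riemannZeta₁ U := by
    have hs2 : (2:ℂ) ∈ U := by
      refine ⟨by simp, ?_⟩
      simp [hb]; linarith [norm_nonneg s]
    refine (hF.analyticOnNhd hUo).eqOn_of_preconnected_of_eventuallyEq (differentiable_riemannZeta₁.differentiableOn.analyticOnNhd hUo) hUc hs2 ?_
    have hO : {z : ℂ | 1 < z.re} ∩ U ∈ nhds (2:ℂ) :=
      ((isOpen_lt continuous_const Complex.continuous_re).inter hUo).mem_nhds ⟨by simp, hs2⟩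
    filter_upwards [hO] with w hw
    exact tendsto_nhds_unique (htend w hw.2) (EM_tendsto_big w hw.1)
  have hsU : s ∈ U := ⟨hs, by simp [hb]⟩
  rw [← heq hsU]
  exact htend s hsU

lemma EM_approx (N : ℕ) (hN : 1 ≤ N) (s : ℂ) (hs : 0 < s.re) :
    ‖riemannZeta₁ s - EM N s‖ ≤ ‖s-1‖ * (‖s‖ * ‖s+1‖) / (12 * (s.re + 1)) * (N:ℝ)^(-s.re-1) := by
  refine le_of_tendsto ((EM_tendsto s hs).sub_const (EM N s)).norm ?_
  filter_upwards [Filter.eventually_ge_atTop N] with M hM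
  refine (EM_diff N M hN hM s (by linarith)).trans ?_
  have : 0 ≤ (M:ℝ)^(-s.re-1) := by positivity
  have hs1 : 0 < s.re + 1 := by linarith
  gcongr; linarith

lemma zeta_approx (N : ℕ) (hN : 1 ≤ N) (s : ℂ) (hs : 0 < s.re) (hs1 : s ≠ 1) :
    ‖riemannZeta s - (∑ n ∈ Ico 1 N, (n:ℂ) ^ (-s) + 1/2 * (N:ℂ)^(-s) + s/12 * (N:ℂ)^(-s-1) + (N:ℂ)^(1-s)/(s-1))‖
      ≤ ‖s‖ * ‖s+1‖ / (12 * (s.re + 1)) * (N:ℝ)^(-s.re-1) := by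
  have h := EM_approx N hN s hs
  have h0 : s - 1 ≠ 0 := sub_ne_zero.2 hs1
  have hp : 0 < ‖s-1‖ := norm_pos_iff.2 h0
  have e : riemannZeta s - (∑ n ∈ Ico 1 N, (n:ℂ) ^ (-s) + 1/2 * (N:ℂ)^(-s) + s/12 * (N:ℂ)^(-s-1) + (N:ℂ)^(1-s)/(s-1))
     = (riemannZeta₁ s - EM N s) / (s-1) := by
    rw [riemannZeta_eq_inv_sub_mul hs1, EM]; field_simp
  rw [e, norm_div, div_le_iff₀ hp]
  refine h.trans (le_of_eq ?_)
  ring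

end

section
open Finset

lemma abel_bd (w : ℕ → ℝ) (z : ℕ → ℂ) (B : ℝ) (a b : ℕ) (hab : a ≤ b) (hw : ∀ n ≥ a, 0 ≤ w n) (hm : ∀ n ≥ a, w (n+1) ≤ w n)
    (hB : ∀ m, a ≤ m → m ≤ b → ‖∑ n ∈ Ico a m, z n‖ ≤ B) : ‖∑ n ∈ Ico a b, (w n : ℂ) * z n‖ ≤ w a * B := by
  have key : ∀ m, a ≤ m → m ≤ b → ‖∑ n ∈ Ico a m, (w n : ℂ) * z n - (w m : ℂ) * ∑ n ∈ Ico a m, z n‖ ≤ (w a - w m) * B := by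
    intro m hm1
    induction m, hm1 using Nat.le_induction with
    | base => intro _; simp
    | succ m hm1 ih =>
      intro hmb
      have h1 := ih (by omega)
      have h2 := hB (m+1) (by omega) hmb
      have e : ∑ n ∈ Ico a (m+1), (w n : ℂ) * z n - (w (m+1) : ℂ) * ∑ n ∈ Ico a (m+1), z n
          = (∑ n ∈ Ico a m, (w n : ℂ) * z n - (w m : ℂ) * ∑ n ∈ Ico a m, z n) + ((w m - w (m+1) : ℝ):ℂ) * ∑ n ∈ Ico a (m+1), z n := by
        rw [Finset.sum_Ico_succ_top hm1, Finset.sum_Ico_succ_top hm1]; push_cast; ring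
      rw [e]
      refine (norm_add_le _ _).trans ?_
      rw [norm_mul, Complex.norm_real, Real.norm_of_nonneg (by linarith [hm m hm1])]
      have := mul_le_mul_of_nonneg_left h2 (by linarith [hm m hm1] : 0 ≤ w m - w (m+1))
      linarith
  have h := key b hab le_rfl
  have h2 := hB b hab le_rfl
  have e : ∑ n ∈ Ico a b, (w n : ℂ) * z n = (∑ n ∈ Ico a b, (w n : ℂ) * z n - (w b : ℂ) * ∑ n ∈ Ico a b, z n) + (w b : ℂ) * ∑ n ∈ Ico a b, z n := by ring
  rw [e]
  refine (norm_add_le _ _).trans ?_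
  rw [norm_mul, Complex.norm_real, Real.norm_of_nonneg (hw b hab)]
  have := mul_le_mul_of_nonneg_left h2 (hw b hab)
  linarith

lemma npow_eq (n : ℕ) (hn : 1 ≤ n) (σ t : ℝ) : (n:ℂ)^(-((σ:ℂ) + t * Complex.I)) = (((n:ℝ)^(-σ) : ℝ):ℂ) * (starRingEnd ℂ) (ee (t / (2 * Real.pi) * Real.log n)) := by
  have hn0 : (n:ℂ) ≠ 0 := by exact_mod_cast (by omega : n ≠ 0)
  have hnr : (0:ℝ) < n := by exact_mod_cast hn
  rw [← ee_neg, Complex.ofReal_cpow hnr.le, neg_add, Complex.cpow_add _ _ hn0]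
  congr 1
  · push_cast; rfl
  · rw [Complex.cpow_def_of_ne_zero hn0, ee]
    congr 1
    have : Complex.log (n:ℂ) = ((Real.log n : ℝ):ℂ) := by rw [← Complex.natCast_log]
    rw [this]
    push_cast
    have hpi : (Real.pi:ℂ) ≠ 0 := by exact_mod_cast Real.pi_ne_zero
    field_simp

/-- block bound -/
lemma block_bd (σ t : ℝ) (hσ : 0.65 ≤ σ) (j : ℕ) (B : ℝ)
    (hB : ∀ m : ℕ, 2^j ≤ m → m ≤ 2^(j+1) → ‖∑ n ∈ Ico ((2:ℕ)^j) m, ee (t / (2 * Real.pi) * Real.log n)‖ ≤ B) :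
    ‖∑ n ∈ Ico ((2:ℕ)^j) (2^(j+1)), (n:ℂ)^(-((σ:ℂ) + t * Complex.I))‖ ≤ Real.exp (-0.65 * (j * Real.log 2)) * B := by
  have h1 : (1:ℕ) ≤ 2^j := Nat.one_le_two_pow
  have hB0 : 0 ≤ B := (norm_nonneg _).trans (hB (2^j) le_rfl (Nat.pow_le_pow_right (by norm_num) (by omega)))
  have e : ∑ n ∈ Ico ((2:ℕ)^j) (2^(j+1)), (n:ℂ)^(-((σ:ℂ) + t * Complex.I)) =
      ∑ n ∈ Ico ((2:ℕ)^j) (2^(j+1)), (((n:ℝ)^(-σ) : ℝ):ℂ) * (starRingEnd ℂ) (ee (t / (2 * Real.pi) * Real.log n)) := by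
    refine Finset.sum_congr rfl fun n hn => npow_eq n (h1.trans (mem_Ico.1 hn).1) σ t
  rw [e]
  refine (abel_bd (fun n => (n:ℝ)^(-σ)) _ B _ _ (Nat.pow_le_pow_right (by norm_num) (by omega)) (fun n _ => by positivity) ?_ ?_).trans ?_
  · intro n hn
    have : (0:ℝ) < n := by exact_mod_cast (lt_of_lt_of_le (by omega) hn)
    apply Real.rpow_le_rpow_of_nonpos this _ (by linarith)
    push_cast; linarith
  · intro m hm1 hm2
    rw [← map_sum, RCLike.norm_conj]
    exact hB m hm1 hm2
  · gcongr
    push_cast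
    rw [Real.rpow_def_of_pos (by positivity), Real.log_pow, Real.exp_le_exp]
    have : 0 ≤ (j:ℝ) * Real.log 2 := by positivity
    nlinarith

lemma exp_lb (a : ℝ) (p q : ℕ) (hq : q ≠ 0) {y : ℝ} (hy : y = (p:ℝ)/q) (h : a^q ≤ 2.7182^p) : a ≤ Real.exp y := by
  have h1 : a^q ≤ (Real.exp y)^q := by
    rw [← Real.exp_nat_mul, hy]
    have e : (q:ℝ) * ((p:ℝ)/q) = p * 1 := by field_simp
    rw [e, Real.exp_nat_mul]
    refine h.trans ?_
    gcongr
    linarith [Real.exp_one_gt_d9]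
  exact le_of_pow_le_pow_left₀ hq (Real.exp_pos _).le h1

lemma two_pow_exp (j : ℕ) : ((2^j : ℕ):ℝ) = Real.exp (j * Real.log 2) := by
  push_cast
  rw [← Real.log_pow, Real.exp_log (by positivity)]

lemma exp_half (y : ℝ) : Real.exp y = Real.exp (y/2)^2 := by
  rw [← Real.exp_nat_mul]; congr 1; push_cast; ring

lemma sqrt_exp (y : ℝ) : √(Real.exp y) = Real.exp (y/2) := by
  rw [exp_half, Real.sqrt_sq (Real.exp_pos _).le]

lemma blk1 (σ t : ℝ) (hσ : 0.65 ≤ σ) (j : ℕ) :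
    ‖∑ n ∈ Ico ((2:ℕ)^j) (2^(j+1)), (n:ℂ)^(-((σ:ℂ) + t * Complex.I))‖ ≤ Real.exp (0.35 * (j * Real.log 2)) := by
  have := block_bd σ t hσ j (2^j) (by
    intro m hm1 hm2
    refine (norm_sum_le _ _).trans ?_
    simp only [ee_norm, Finset.sum_const, Nat.card_Ico, nsmul_eq_mul, mul_one]
    have : m - 2^j ≤ 2^j := by rw [pow_succ] at hm2; omega
    exact_mod_cast this)
  refine this.trans (le_of_eq ?_)
  have := two_pow_exp j
  push_cast at this
  rw [this, ← Real.exp_add]; congr 1; ring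

lemma blk4 (σ t x u : ℝ) (hσ : 0.65 ≤ σ) (ht : t = 2 * Real.pi * Real.exp x) (j : ℕ) (hu : u = j * Real.log 2) (h1 : x ≤ 4 * u - 4.86)
    (h2 : 34.3 ≤ x + 3 * u) (h3 : u + 11.75 ≤ x) :
    ‖∑ n ∈ Ico ((2:ℕ)^j) (2^(j+1)), (n:ℂ)^(-((σ:ℂ) + t * Complex.I))‖ ≤
      1.7945 * Real.exp (9/140 * u + x/14) + 3.457 * Real.exp (27/70 * u - x/14) := by
  have hT : t / (2 * Real.pi) = Real.exp x := by rw [ht]; have := Real.pi_pos; field_simp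
  have hN := two_pow_exp j
  rw [← hu] at hN
  have := block_bd σ t hσ j (1.7945 * Real.exp (u + (x-4*u)/14) + 3.457 * Real.exp (0.75 * u - (x-4*u)/14)) (by
    intro m hm1 hm2
    rw [hT]
    have hlog2 := Real.log_two_gt_d9
    have hlog2' := Real.log_two_lt_d9
    have k := K4 (Real.exp x) (Real.exp u) (Real.exp ((x-4*u)/7)) (Real.exp_pos _) (Real.exp_pos _) (Real.exp_pos _)
      (by rw [← Real.exp_nat_mul, ← Real.exp_nat_mul, ← Real.exp_sub]; congr 1; push_cast; ring)
      (by
        have : (1:ℝ)/2 = Real.exp (-Real.log 2) := by rw [Real.exp_neg, Real.exp_log (by norm_num)]; norm_num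
        rw [this, Real.exp_le_exp]; linarith)
      (by
        rw [← Real.exp_add]
        have : (125:ℝ) ≤ Real.exp 4.9 := exp_lb 125 49 10 (by norm_num) (by norm_num) (by norm_num)
        refine this.trans (Real.exp_le_exp.2 ?_); linarith)
      (by
        have : (125000:ℝ) ≤ Real.exp 11.75 := exp_lb 125000 47 4 (by norm_num) (by norm_num) (by norm_num)
        calc _ ≤ Real.exp 11.75 * Real.exp u := by gcongr
          _ = Real.exp (11.75 + u) := by rw [Real.exp_add]
          _ ≤ _ := Real.exp_le_exp.2 (by linarith))
      (2^j) m hm1 (by rw [hN]) (by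
        have : (m:ℝ) ≤ ((2^(j+1):ℕ):ℝ) := by exact_mod_cast hm2
        rw [pow_succ] at this; push_cast at this hN; rw [hN] at this; linarith)
    refine sqrt_bd (by positivity) (by positivity) k ?_ ?_
    · rw [mul_pow, ← Real.exp_nat_mul, ← Real.exp_nat_mul, mul_assoc, ← Real.exp_add]
      have : (2:ℕ) * u + (x-4*u)/7 = (2:ℕ) * (u + (x-4*u)/14) := by push_cast; ring
      rw [this]; gcongr; norm_num
    · rw [mul_pow, ← Real.exp_nat_mul, sqrt_exp, ← Real.exp_add, mul_div_assoc, ← Real.exp_sub]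
      have : u + u/2 - (x-4*u)/7 = (2:ℕ) * (0.75 * u - (x-4*u)/14) := by push_cast; ring
      rw [this]; gcongr; norm_num)
  refine this.trans (le_of_eq ?_)
  rw [← hu, mul_add, mul_left_comm, ← Real.exp_add, mul_left_comm, ← Real.exp_add]
  congr 3 <;> ring

lemma blk3 (σ t x u : ℝ) (hσ : 0.65 ≤ σ) (ht : t = 2 * Real.pi * Real.exp x) (j : ℕ) (hu : u = j * Real.log 2) (h1 : x ≤ 3 * u - 2.1)
    (h2 : 12 ≤ x) :
    ‖∑ n ∈ Ico ((2:ℕ)^j) (2^(j+1)), (n:ℂ)^(-((σ:ℂ) + t * Complex.I))‖ ≤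
      2.092 * Real.exp (-0.15 * u + x/6) + 7.225 * Real.exp (0.35 * u - x/6) := by
  have hT : t / (2 * Real.pi) = Real.exp x := by rw [ht]; have := Real.pi_pos; field_simp
  have hN := two_pow_exp j
  rw [← hu] at hN
  have := block_bd σ t hσ j (2.092 * Real.exp (u + (x-3*u)/6) + 7.225 * Real.exp (u/2 - (x-3*u)/6)) (by
    intro m hm1 hm2
    rw [hT]
    have hlog2 := Real.log_two_gt_d9
    have hlog2' := Real.log_two_lt_d9
    have k := K3 (Real.exp x) (Real.exp u) (Real.exp ((x-3*u)/3)) (Real.exp_pos _) (Real.exp_pos _) (Real.exp_pos _)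
      (by rw [← Real.exp_nat_mul, ← Real.exp_nat_mul, ← Real.exp_sub]; congr 1; push_cast; ring)
      (by
        have : (1:ℝ)/2 = Real.exp (-Real.log 2) := by rw [Real.exp_neg, Real.exp_log (by norm_num)]; norm_num
        rw [this, Real.exp_le_exp]; linarith)
      (by
        rw [← Real.exp_add]
        have : (50:ℝ) ≤ Real.exp 4 := by
          have := Real.exp_one_gt_d9
          have e : Real.exp 4 = Real.exp 1 ^ 4 := by rw [← Real.exp_nat_mul]; norm_num
          rw [e]
          calc (50:ℝ) ≤ 2.71^4 := by norm_num
            _ ≤ _ := by gcongr; linarith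
        refine this.trans (Real.exp_le_exp.2 ?_); linarith)
      (2^j) m hm1 (by rw [hN]) (by
        have : (m:ℝ) ≤ ((2^(j+1):ℕ):ℝ) := by exact_mod_cast hm2
        rw [pow_succ] at this; push_cast at this hN; rw [hN] at this; linarith)
    refine sqrt_bd (by positivity) (by positivity) k ?_ ?_
    · rw [mul_pow, ← Real.exp_nat_mul, ← Real.exp_nat_mul, mul_assoc, ← Real.exp_add]
      have : (2:ℕ) * u + (x-3*u)/3 = (2:ℕ) * (u + (x-3*u)/6) := by push_cast; ring
      rw [this]; gcongr; norm_num
    · rw [mul_pow, ← Real.exp_nat_mul, mul_div_assoc, ← Real.exp_sub]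
      have : u - (x-3*u)/3 = (2:ℕ) * (u/2 - (x-3*u)/6) := by push_cast; ring
      rw [this]; gcongr; norm_num)
  refine this.trans (le_of_eq ?_)
  rw [← hu, mul_add, mul_left_comm, ← Real.exp_add, mul_left_comm, ← Real.exp_add]
  congr 3 <;> ring

lemma blk2 (σ t x u : ℝ) (hσ : 0.65 ≤ σ) (ht : t = 2 * Real.pi * Real.exp x) (j : ℕ) (hu : u = j * Real.log 2) :
    ‖∑ n ∈ Ico ((2:ℕ)^j) (2^(j+1)), (n:ℂ)^(-((σ:ℂ) + t * Complex.I))‖ ≤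
      2.26 * Real.exp (-0.65 * u + x/2) + Real.exp (-1.65 * u + x) + 9.04 * Real.exp (0.35 * u - x/2) + 4 * Real.exp (-0.65 * u) := by
  have hT : t / (2 * Real.pi) = Real.exp x := by rw [ht]; have := Real.pi_pos; field_simp
  have hN := two_pow_exp j
  rw [← hu] at hN
  have := block_bd σ t hσ j (2.26 * Real.exp (x/2) + Real.exp (x-u) + 9.04 * Real.exp (u-x/2) + 4) (by
    intro m hm1 hm2
    rw [hT]
    have k := S2_bound (Real.exp x) (Real.exp u) (Real.exp_pos _) (Real.exp_pos _) 
      (2^j) m (by rw [hN]) (by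
        have : (m:ℝ) ≤ ((2^(j+1):ℕ):ℝ) := by exact_mod_cast hm2
        rw [pow_succ] at this; push_cast at this hN; rw [hN] at this; linarith)
    refine k.trans (le_of_eq ?_)
    have e : √(Real.exp x / (4 * Real.exp u ^2)) = Real.exp (x/2 - u) / 2 := by
      have : Real.exp x / (4 * Real.exp u ^2) = (Real.exp (x/2 - u) / 2)^2 := by
        rw [div_pow, ← Real.exp_nat_mul, ← Real.exp_nat_mul, mul_comm (4:ℝ), ← div_div, ← Real.exp_sub]
        norm_num; ring_nf
      rw [this, Real.sqrt_sq (by positivity)]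
    have e1 : Real.exp (x/2) = Real.exp (x/2 - u) * Real.exp u := by rw [← Real.exp_add]; ring_nf
    have e2 : Real.exp x = (Real.exp (x/2-u) * Real.exp u)^2 := by rw [← e1, ← exp_half]
    have e3 : Real.exp (x-u) = Real.exp (x/2-u)^2 * Real.exp u := by rw [Real.exp_sub, e2]; field_simp
    have e4 : Real.exp (u - x/2) = 1 / Real.exp (x/2-u) := by rw [one_div, ← Real.exp_neg]; ring_nf
    rw [e, e1, e3, e4, e2]
    field_simp
    ring)
  refine this.trans (le_of_eq ?_)
  rw [← hu, mul_add, mul_add, mul_add, mul_left_comm, ← Real.exp_add, ← Real.exp_add, mul_left_comm _ (9.04:ℝ), ← Real.exp_add, mul_comm _ (4:ℝ)]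
  congr 4 <;> ring_nf

end

section
open Finset

lemma geom_up (α c : ℝ) (hc : 0 < c) (h : 1 + c ≤ Real.exp (α * Real.log 2)) (a b : ℕ) (hab : a ≤ b) :
    ∑ j ∈ Ico a b, Real.exp (α * (j * Real.log 2)) ≤ Real.exp (α * (b * Real.log 2)) / c := by
  rw [le_div_iff₀ hc]
  induction b, hab using Nat.le_induction with
  | base => simp; positivity
  | succ b hab ih =>
    rw [Finset.sum_Ico_succ_top hab, add_mul]
    have e : Real.exp (α * ((b+1:ℕ) * Real.log 2)) = Real.exp (α * (b * Real.log 2)) * Real.exp (α * Real.log 2) := by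
      rw [← Real.exp_add]; congr 1; push_cast; ring
    rw [e]
    have := mul_le_mul_of_nonneg_left h (Real.exp_pos (α * (b * Real.log 2))).le
    linarith

lemma geom_down (α c : ℝ) (hc : 0 < c) (h : Real.exp (-α * Real.log 2) ≤ 1 - c) (a b : ℕ) (hab : a ≤ b) :
    ∑ j ∈ Ico a b, Real.exp (-α * (j * Real.log 2)) ≤ Real.exp (-α * (a * Real.log 2)) / c := by
  suffices h2 : ∑ j ∈ Ico a b, Real.exp (-α * (j * Real.log 2)) ≤ (Real.exp (-α * (a * Real.log 2)) - Real.exp (-α * (b * Real.log 2))) / c by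
    refine h2.trans ?_
    gcongr
    linarith [Real.exp_pos (-α * (b * Real.log 2))]
  rw [le_div_iff₀ hc]
  induction b, hab using Nat.le_induction with
  | base => simp
  | succ b hab ih =>
    rw [Finset.sum_Ico_succ_top hab, add_mul]
    have e : Real.exp (-α * ((b+1:ℕ) * Real.log 2)) = Real.exp (-α * (b * Real.log 2)) * Real.exp (-α * Real.log 2) := by
      rw [← Real.exp_add]; congr 1; push_cast; ring
    rw [e]
    have := mul_le_mul_of_nonneg_left h (Real.exp_pos (-α * (b * Real.log 2))).le
    linarith

/-- lower bounds for powers of two -/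
lemma two_lb (a : ℝ) (p q : ℕ) (hq : q ≠ 0) {y : ℝ} (hy : y = (p:ℝ)/q) (h : a^q ≤ 2^p) : a ≤ Real.exp (y * Real.log 2) := by
  refine le_of_pow_le_pow_left₀ hq (Real.exp_pos _).le (h.trans (le_of_eq ?_))
  rw [← Real.exp_nat_mul, hy, ← mul_assoc, mul_div_cancel₀ _ (by exact_mod_cast hq), ← Real.log_pow, Real.exp_log (by positivity)]

lemma two_ub (a : ℝ) (p q : ℕ) (hq : q ≠ 0) {y : ℝ} (hy : y = (p:ℝ)/q) (ha : 0 < a) (h : 1 ≤ 2^p * a^q) : Real.exp (-y * Real.log 2) ≤ a := by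
  have h1 := two_lb (1/a) p q hq hy (by rw [div_pow, one_pow, div_le_iff₀ (by positivity)]; exact h)
  rw [neg_mul, Real.exp_neg, inv_le_comm₀ (Real.exp_pos _) ha]
  simpa using h1

lemma two_ub' (a : ℝ) (p q : ℕ) (hq : q ≠ 0) {y : ℝ} (hy : y = (p:ℝ)/q) (ha : 0 < a) (h : 2^p ≤ a^q) : Real.exp (y * Real.log 2) ≤ a := by
  refine le_of_pow_le_pow_left₀ hq ha.le (le_trans (le_of_eq ?_) h)
  rw [← Real.exp_nat_mul, hy, ← mul_assoc, mul_div_cancel₀ _ (by exact_mod_cast hq), ← Real.log_pow, Real.exp_log (by positivity)]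

/-- upper bounds for exp -/
lemma exp_ub (a : ℝ) (p q : ℕ) (hq : q ≠ 0) {y : ℝ} (hy : y ≤ (p:ℝ)/q) (ha : 0 < a) (h : 2.7183^p ≤ a^q) : Real.exp y ≤ a := by
  refine (Real.exp_le_exp.2 hy).trans (le_of_pow_le_pow_left₀ hq ha.le (le_trans ?_ h))
  rw [← Real.exp_nat_mul, mul_div_cancel₀ _ (by exact_mod_cast hq), ← mul_one (p:ℝ), Real.exp_nat_mul]
  gcongr
  linarith [Real.exp_one_lt_d9]

lemma exp_ubn (a : ℝ) (p q : ℕ) (hq : q ≠ 0) {y : ℝ} (hy : y ≤ -((p:ℝ)/q)) (ha : 0 < a) (h : 1 ≤ 2.7182^p * a^q) : Real.exp y ≤ a := by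
  have h1 := exp_lb (1/a) p q hq (y := -y - (-y - (p:ℝ)/q)) (by ring) (by rw [div_pow, one_pow, div_le_iff₀ (by positivity)]; exact h)
  have h2 : 1/a ≤ Real.exp (-y) := h1.trans (Real.exp_le_exp.2 (by linarith))
  rw [Real.exp_neg, ← one_div, one_div_le_one_div ha (Real.exp_pos _)] at h2
  exact h2

lemma dyadic_split (f : ℕ → ℂ) (J : ℕ) : ∑ n ∈ Ico 1 (2^J), f n = ∑ j ∈ range J, ∑ n ∈ Ico ((2:ℕ)^j) (2^(j+1)), f n := by
  induction J with
  | zero => simp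
  | succ J ih =>
    rw [Finset.sum_range_succ, ← ih, Finset.sum_Ico_consecutive _ Nat.one_le_two_pow (Nat.pow_le_pow_right (by norm_num) (by omega))]

lemma floor_log (Y : ℝ) (hY : 0 ≤ Y) : ∃ J : ℕ, (J:ℝ) * Real.log 2 ≤ Y ∧ Y - Real.log 2 ≤ J * Real.log 2 := by
  have hl : 0 < Real.log 2 := Real.log_pos (by norm_num)
  refine ⟨⌊Y / Real.log 2⌋₊, ?_, ?_⟩
  · have := Nat.floor_le (show 0 ≤ Y / Real.log 2 by positivity)
    rwa [le_div_iff₀ hl] at this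
  · have := (Nat.lt_floor_add_one (Y / Real.log 2)).le
    rw [div_le_iff₀ hl] at this
    linarith

lemma piece1 (σ t x : ℝ) (hσ : 0.65 ≤ σ) (hx : 24 ≤ x) (J1 : ℕ) (hJ1 : (J1:ℝ) * Real.log 2 ≤ x/4 + 1.909) :
    ∑ j ∈ Ico 0 J1, ‖∑ n ∈ Ico ((2:ℕ)^j) (2^(j+1)), (n:ℂ)^(-((σ:ℂ) + t * Complex.I))‖ ≤ 5.3 * Real.exp (0.1 * x) := by
  calc _ ≤ ∑ j ∈ Ico 0 J1, Real.exp (0.35 * (j * Real.log 2)) := Finset.sum_le_sum fun j _ => blk1 σ t hσ j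
    _ ≤ Real.exp (0.35 * (J1 * Real.log 2)) / 0.2745 := geom_up _ _ (by norm_num) (by norm_num; exact two_lb (2549/2000) 7 20 (by norm_num) (by norm_num) (by norm_num)) _ _ (by omega)
    _ ≤ (1.447 * Real.exp (0.1 * x)) / 0.2745 := by
      gcongr
      have h1 : Real.exp (0.36815:ℝ) ≤ 1.447 := exp_ub _ 7 19 (by norm_num) (by norm_num) (by norm_num) (by norm_num)
      calc _ ≤ Real.exp (0.36815 + 0.1 * x) := Real.exp_le_exp.2 (by linarith)
        _ = _ := Real.exp_add _ _
        _ ≤ _ := by gcongr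
    _ ≤ _ := by
      have := Real.exp_pos (0.1 * x)
      rw [div_le_iff₀ (by norm_num)]; nlinarith

lemma piece2 (σ t x : ℝ) (hσ : 0.65 ≤ σ) (ht : t = 2 * Real.pi * Real.exp x) (hx : 24 ≤ x) (J1 J2 : ℕ) (h12 : J1 ≤ J2)
    (hJ1 : x/4 + 1.909 - Real.log 2 ≤ J1 * Real.log 2) (hJ2 : (J2:ℝ) * Real.log 2 ≤ 4*x/9) :
    ∑ j ∈ Ico J1 J2, ‖∑ n ∈ Ico ((2:ℕ)^j) (2^(j+1)), (n:ℂ)^(-((σ:ℂ) + t * Complex.I))‖ ≤ 50.75 * Real.exp (0.1 * x) := by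
  have hl1 := Real.log_two_gt_d9
  have hl2 := Real.log_two_lt_d9
  calc _ ≤ ∑ j ∈ Ico J1 J2, (1.7945 * Real.exp (x/14) * Real.exp (9/140 * (j * Real.log 2)) + 3.457 * Real.exp (-x/14) * Real.exp (27/70 * (j * Real.log 2))) := by
        refine Finset.sum_le_sum fun j hj => ?_
        rw [mem_Ico] at hj
        have a1 : (J1:ℝ) ≤ j := by exact_mod_cast hj.1
        have a2 : (j:ℝ) ≤ J2 := by exact_mod_cast hj.2.le
        have b1 : (J1:ℝ) * Real.log 2 ≤ j * Real.log 2 := by gcongr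
        have b2 : (j:ℝ) * Real.log 2 ≤ J2 * Real.log 2 := by gcongr
        refine (blk4 σ t x _ hσ ht j rfl (by linarith) (by linarith) (by linarith)).trans (le_of_eq ?_)
        rw [mul_assoc, ← Real.exp_add, mul_assoc, ← Real.exp_add]
        congr 3 <;> ring
    _ ≤ 1.7945 * Real.exp (x/14) * (Real.exp (9/140 * (J2 * Real.log 2)) / 0.0455) + 3.457 * Real.exp (-x/14) * (Real.exp (27/70 * (J2 * Real.log 2)) / 0.3064) := by
      rw [Finset.sum_add_distrib, ← Finset.mul_sum, ← Finset.mul_sum]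
      have g1 := geom_up (9/140) 0.0455 (by norm_num) (by norm_num; exact two_lb (2091/2000) 9 140 (by norm_num) (by norm_num) (by norm_num)) J1 J2 h12
      have g2 := geom_up (27/70) 0.3064 (by norm_num) (by norm_num; exact two_lb (1633/1250) 27 70 (by norm_num) (by norm_num) (by norm_num)) J1 J2 h12
      gcongr
    _ ≤ 1.7945 * Real.exp (x/14) * (Real.exp (9/140 * (4*x/9)) / 0.0455) + 3.457 * Real.exp (-x/14) * (Real.exp (27/70 * (4*x/9)) / 0.3064) := by
      gcongr
    _ = 1.7945 / 0.0455 * (Real.exp (x/14) * Real.exp (9/140 * (4*x/9))) + 3.457 / 0.3064 * (Real.exp (-x/14) * Real.exp (27/70 * (4*x/9))) := by ring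
    _ ≤ _ := by
      rw [← Real.exp_add, ← Real.exp_add]
      have e1 : x/14 + 9/140 * (4*x/9) = 0.1 * x := by ring
      have e2 : -x/14 + 27/70 * (4*x/9) = 0.1 * x := by ring
      rw [e1, e2]
      have := Real.exp_pos (0.1 * x)
      nlinarith

lemma piece3 (σ t x : ℝ) (hσ : 0.65 ≤ σ) (ht : t = 2 * Real.pi * Real.exp x) (hx : 24 ≤ x) (J1 J2 : ℕ) (h12 : J1 ≤ J2)
    (hJ1 : 4*x/9 - Real.log 2 ≤ J1 * Real.log 2) (hJ2 : (J2:ℝ) * Real.log 2 ≤ 8*x/13) :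
    ∑ j ∈ Ico J1 J2, ‖∑ n ∈ Ico ((2:ℕ)^j) (2^(j+1)), (n:ℂ)^(-((σ:ℂ) + t * Complex.I))‖ ≤ 31.3 * Real.exp (0.1 * x) := by
  have hl1 := Real.log_two_gt_d9
  have hl2 := Real.log_two_lt_d9
  calc _ ≤ ∑ j ∈ Ico J1 J2, (2.092 * Real.exp (x/6) * Real.exp (-0.15 * (j * Real.log 2)) + 7.225 * Real.exp (-x/6) * Real.exp (0.35 * (j * Real.log 2))) := by
        refine Finset.sum_le_sum fun j hj => ?_
        rw [mem_Ico] at hj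
        have a1 : (J1:ℝ) ≤ j := by exact_mod_cast hj.1
        have b1 : (J1:ℝ) * Real.log 2 ≤ j * Real.log 2 := by gcongr
        refine (blk3 σ t x _ hσ ht j rfl (by linarith) (by linarith)).trans (le_of_eq ?_)
        rw [mul_assoc, ← Real.exp_add, mul_assoc, ← Real.exp_add]
        congr 3 <;> ring
    _ ≤ 2.092 * Real.exp (x/6) * (Real.exp (-0.15 * (J1 * Real.log 2)) / 0.0987) + 7.225 * Real.exp (-x/6) * (Real.exp (0.35 * (J2 * Real.log 2)) / 0.2745) := by
      rw [Finset.sum_add_distrib, ← Finset.mul_sum, ← Finset.mul_sum]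
      have g1 := geom_down 0.15 0.0987 (by norm_num) (by have h := two_ub (9013/10000) 3 20 (y := 0.15) (by norm_num) (by norm_num) (by norm_num) (by norm_num); linarith) J1 J2 h12
      have g2 := geom_up 0.35 0.2745 (by norm_num) (by norm_num; exact two_lb (2549/2000) 7 20 (by norm_num) (by norm_num) (by norm_num)) J1 J2 h12
      gcongr
    _ ≤ 2.092 * Real.exp (x/6) * (Real.exp (-0.15 * (4*x/9 - Real.log 2)) / 0.0987) + 7.225 * Real.exp (-x/6) * (Real.exp (0.35 * (8*x/13)) / 0.2745) := by
      gcongr _ * _ * (?_ / _) + _ * _ * (?_ / _)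
      · rw [Real.exp_le_exp]; linarith
      · rw [Real.exp_le_exp]; linarith
    _ = 2.092 / 0.0987 * (Real.exp (x/6) * Real.exp (-0.15 * (4*x/9 - Real.log 2))) + 7.225 / 0.2745 * (Real.exp (-x/6) * Real.exp (0.35 * (8*x/13))) := by ring
    _ ≤ 2.092 / 0.0987 * (1.1097 * Real.exp (0.1 * x)) + 7.225 / 0.2745 * (0.2922 * Real.exp (0.1 * x)) := by
      have hu1 : Real.exp (0.15 * Real.log 2) ≤ 1.1097 := two_ub' _ 3 20 (by norm_num) (by norm_num) (by norm_num) (by norm_num)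
      have hu2 : Real.exp (-(16/13):ℝ) ≤ 0.2922 := exp_ubn _ 16 13 (by norm_num) (by norm_num) (by norm_num) (by norm_num)
      gcongr ?_ * ?_ + ?_ * ?_
      · calc _ = Real.exp (0.15 * Real.log 2) * Real.exp (0.1 * x) := by rw [← Real.exp_add, ← Real.exp_add]; congr 1; ring
          _ ≤ _ := by gcongr
      · calc _ ≤ Real.exp (-(16/13)) * Real.exp (0.1 * x) := by rw [← Real.exp_add, ← Real.exp_add, Real.exp_le_exp]; linarith
          _ ≤ _ := by gcongr
    _ ≤ _ := by
      have := Real.exp_pos (0.1 * x)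
      nlinarith

lemma piece4 (σ t x : ℝ) (hσ : 0.65 ≤ σ) (ht : t = 2 * Real.pi * Real.exp x) (hx : 24 ≤ x) (J1 J2 : ℕ) (h12 : J1 ≤ J2)
    (hJ1 : 8*x/13 - Real.log 2 ≤ J1 * Real.log 2) (hJ2 : (J2:ℝ) * Real.log 2 ≤ 1.25 * x) :
    ∑ j ∈ Ico J1 J2, ‖∑ n ∈ Ico ((2:ℕ)^j) (2^(j+1)), (n:ℂ)^(-((σ:ℂ) + t * Complex.I))‖ ≤ 10.9 * Real.exp (0.1 * x) := by
  have hl1 := Real.log_two_gt_d9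
  have hl2 := Real.log_two_lt_d9
  calc _ ≤ ∑ j ∈ Ico J1 J2, ((2.26 * Real.exp (x/2) + 4) * Real.exp (-0.65 * (j * Real.log 2)) + Real.exp x * Real.exp (-1.65 * (j * Real.log 2))
          + 9.04 * Real.exp (-x/2) * Real.exp (0.35 * (j * Real.log 2))) := by
        refine Finset.sum_le_sum fun j hj => ?_
        refine (blk2 σ t x _ hσ ht j rfl).trans (le_of_eq ?_)
        rw [show 0.35 * ((j:ℝ) * Real.log 2) - x/2 = -x/2 + 0.35 * ((j:ℝ) * Real.log 2) by ring, Real.exp_add, Real.exp_add, Real.exp_add]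
        ring
    _ ≤ (2.26 * Real.exp (x/2) + 4) * (Real.exp (-0.65 * (J1 * Real.log 2)) / 0.362) + Real.exp x * (Real.exp (-1.65 * (J1 * Real.log 2)) / 0.68)
          + 9.04 * Real.exp (-x/2) * (Real.exp (0.35 * (J2 * Real.log 2)) / 0.2745) := by
      rw [Finset.sum_add_distrib, Finset.sum_add_distrib, ← Finset.mul_sum, ← Finset.mul_sum, ← Finset.mul_sum]
      have g1 := geom_down 0.65 0.362 (by norm_num) (by have h := two_ub (319/500) 13 20 (y := 0.65) (by norm_num) (by norm_num) (by norm_num) (by norm_num); linarith) J1 J2 h12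
      have g3 := geom_down 1.65 0.68 (by norm_num) (by have h := two_ub (8/25) 33 20 (y := 1.65) (by norm_num) (by norm_num) (by norm_num) (by norm_num); linarith) J1 J2 h12
      have g2 := geom_up 0.35 0.2745 (by norm_num) (by norm_num; exact two_lb (2549/2000) 7 20 (by norm_num) (by norm_num) (by norm_num)) J1 J2 h12
      gcongr
    _ ≤ (2.26 * Real.exp (x/2) + 4) * (Real.exp (-0.65 * (8*x/13 - Real.log 2)) / 0.362) + Real.exp x * (Real.exp (-1.65 * (8*x/13 - Real.log 2)) / 0.68)
          + 9.04 * Real.exp (-x/2) * (Real.exp (0.35 * (1.25 * x)) / 0.2745) := by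
      gcongr _ * (?_ / _) + _ * (?_ / _) + _ * _ * (?_ / _)
      · rw [Real.exp_le_exp]; linarith
      · rw [Real.exp_le_exp]; linarith
      · rw [Real.exp_le_exp]; linarith
    _ = 2.26 / 0.362 * (Real.exp (x/2) * Real.exp (-0.65 * (8*x/13 - Real.log 2))) + 4 / 0.362 * Real.exp (-0.65 * (8*x/13 - Real.log 2)) + 1 / 0.68 * (Real.exp x * Real.exp (-1.65 * (8*x/13 - Real.log 2)))
          + 9.04 / 0.2745 * (Real.exp (-x/2) * Real.exp (0.35 * (1.25 * x))) := by ring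
    _ ≤ 2.26 / 0.362 * (1.5693 * Real.exp (0.1 * x)) + 4 / 0.362 * (0.001 * Real.exp (0.1 * x)) + 1 / 0.68 * (0.2 * Real.exp (0.1 * x))
          + 9.04 / 0.2745 * (0.0203 * Real.exp (0.1 * x)) := by
      have hu1 : Real.exp (0.65 * Real.log 2) ≤ 1.5693 := two_ub' _ 13 20 (by norm_num) (by norm_num) (by norm_num) (by norm_num)
      have hu2 : Real.exp (-7:ℝ) ≤ 0.001 := exp_ubn _ 7 1 (by norm_num) (by norm_num) (by norm_num) (by norm_num)
      have hu3 : Real.exp (-1.62:ℝ) ≤ 0.2 := exp_ubn _ 162 100 (by norm_num) (by norm_num) (by norm_num) (by norm_num)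
      have hu4 : Real.exp (-3.9:ℝ) ≤ 0.0203 := exp_ubn _ 39 10 (by norm_num) (by norm_num) (by norm_num) (by norm_num)
      gcongr ?_ * ?_ + ?_ * ?_ + ?_ * ?_ + ?_ * ?_
      · calc _ = Real.exp (0.65 * Real.log 2) * Real.exp (0.1 * x) := by rw [← Real.exp_add, ← Real.exp_add]; congr 1; ring
          _ ≤ _ := by gcongr
      · calc _ ≤ Real.exp (-7) * Real.exp (0.1 * x) := by rw [← Real.exp_add, Real.exp_le_exp]; linarith
          _ ≤ _ := by gcongr
      · calc _ ≤ Real.exp (-1.62) * Real.exp (0.1 * x) := by rw [← Real.exp_add, ← Real.exp_add, Real.exp_le_exp]; linarith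
          _ ≤ _ := by gcongr
      · calc _ ≤ Real.exp (-3.9) * Real.exp (0.1 * x) := by rw [← Real.exp_add, ← Real.exp_add, Real.exp_le_exp]; linarith
          _ ≤ _ := by gcongr
    _ ≤ _ := by
      have := Real.exp_pos (0.1 * x)
      nlinarith

end

section
open Finset

set_option maxHeartbeats 1600000 in
theorem zeta_growth (σ t x : ℝ) (hσ : 0.65 ≤ σ) (hσ2 : σ ≤ 2) (ht : t = 2 * Real.pi * Real.exp x) (hx : 24 ≤ x) :
    ‖riemannZeta ((σ:ℂ) + t * Complex.I)‖ ≤ 98.5 * Real.exp (0.1 * x) := by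
  have hl1 := Real.log_two_gt_d9
  have hl2 := Real.log_two_lt_d9
  have hl0 : 0 < Real.log 2 := by linarith
  obtain ⟨J1, a1, b1⟩ := floor_log (x/4 + 1.909) (by linarith)
  obtain ⟨J2, a2, b2⟩ := floor_log (4*x/9) (by linarith)
  obtain ⟨J3, a3, b3⟩ := floor_log (8*x/13) (by linarith)
  obtain ⟨J4, a4, b4⟩ := floor_log (1.25*x) (by linarith)
  have cmp : ∀ {a b : ℕ}, (a:ℝ) * Real.log 2 ≤ b * Real.log 2 → a ≤ b := by
    intro a b h
    exact_mod_cast le_of_mul_le_mul_right h hl0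
  have h12 : J1 ≤ J2 := cmp (by linarith)
  have h23 : J2 ≤ J3 := cmp (by linarith)
  have h34 : J3 ≤ J4 := cmp (by linarith)
  set s : ℂ := (σ:ℂ) + t * Complex.I with hs
  have hre : s.re = σ := by simp [hs]
  have him : s.im = t := by simp [hs]
  have hpi := Real.pi_gt_d2
  have hpi2 := Real.pi_lt_d4
  have hex : 1000 ≤ Real.exp x := by
    have : (1000:ℝ) ≤ Real.exp 7 := exp_lb _ 7 1 (by norm_num) (by norm_num) (by norm_num)
    exact this.trans (Real.exp_le_exp.2 (by linarith))
  have ht0 : 6.28 * Real.exp x ≤ t := by rw [ht]; nlinarith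
  have ht1 : t ≤ 6.3 * Real.exp x - 10 := by rw [ht]; nlinarith
  have htp : 0 < t := by linarith
  have hs1 : s ≠ 1 := by
    intro h
    rw [h] at him
    simp at him
    linarith
  set N : ℕ := 2^J4 with hN
  have hN1 : 1 ≤ N := Nat.one_le_two_pow
  have hNr : (1:ℝ) ≤ N := by exact_mod_cast hN1
  have hN0 : (0:ℝ) < N := by linarith
  have hlogN : Real.log N = J4 * Real.log 2 := by rw [hN]; push_cast; rw [Real.log_pow]
  have hmain := zeta_approx N hN1 s (by rw [hre]; linarith) hs1
  have hsum : ‖∑ n ∈ Ico 1 N, (n:ℂ)^(-s)‖ ≤ 98.25 * Real.exp (0.1 * x) := by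
    rw [hN, dyadic_split]
    refine (norm_sum_le _ _).trans ?_
    rw [Finset.range_eq_Ico, ← Finset.sum_Ico_consecutive _ (Nat.zero_le J3) h34, ← Finset.sum_Ico_consecutive _ (Nat.zero_le J2) h23,
      ← Finset.sum_Ico_consecutive _ (Nat.zero_le J1) h12]
    have p1 := piece1 σ t x hσ hx J1 a1
    have p2 := piece2 σ t x hσ ht hx J1 J2 h12 b1 a2
    have p3 := piece3 σ t x hσ ht hx J2 J3 h23 b2 a3
    have p4 := piece4 σ t x hσ ht hx J3 J4 h34 b3 a4
    linarith
  have hnorm : ∀ z : ℂ, ‖(N:ℂ)^z‖ = (N:ℝ)^z.re := fun z => by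
    rw [show (N:ℂ) = ((N:ℝ):ℂ) by simp, Complex.norm_cpow_eq_rpow_re_of_pos hN0]
  have hs_le : ‖s‖ ≤ 6.3 * Real.exp x := by
    have := Complex.norm_le_abs_re_add_abs_im s
    rw [hre, him, abs_of_pos htp, abs_of_pos (by linarith)] at this
    linarith
  have hs1_le : ‖s+1‖ ≤ 6.3 * Real.exp x := by
    have := Complex.norm_le_abs_re_add_abs_im (s+1)
    simp only [Complex.add_re, Complex.add_im, Complex.one_re, Complex.one_im, hre, him] at this
    rw [add_zero, abs_of_pos htp, abs_of_pos (by linarith)] at this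
    linarith
  have hs1_ge : 6.28 * Real.exp x ≤ ‖s-1‖ := by
    have := Complex.abs_im_le_norm (s-1)
    simp only [Complex.sub_im, Complex.one_im, him, sub_zero] at this
    rw [abs_of_pos htp] at this
    linarith
  -- powers of N
  have hp1 : (N:ℝ)^(-σ-1) ≤ 3.14 * Real.exp (-2.0625*x) := by
    have h2 : Real.exp (1.65 * Real.log 2) ≤ 3.14 := two_ub' _ 33 20 (by norm_num) (by norm_num) (by norm_num) (by norm_num)
    rw [Real.rpow_def_of_pos hN0, hlogN]
    calc _ ≤ Real.exp (1.65 * Real.log 2 + -2.0625*x) := by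
          rw [Real.exp_le_exp]
          nlinarith
      _ = _ := Real.exp_add _ _
      _ ≤ _ := by gcongr
  have hp2 : (N:ℝ)^(-σ) ≤ 1 := Real.rpow_le_one_of_one_le_of_nonpos hNr (by linarith)
  have hp3 : (N:ℝ)^(1-σ) ≤ Real.exp (0.4375*x) := by
    rw [Real.rpow_def_of_pos hN0, hlogN, Real.exp_le_exp]
    have : (0:ℝ) ≤ J4 * Real.log 2 := by positivity
    nlinarith
  have e1 : Real.exp (-0.0625*x) ≤ 0.2232 := (Real.exp_le_exp.2 (by linarith)).trans (exp_ubn (y := -1.5) _ 3 2 (by norm_num) (by norm_num) (by norm_num) (by norm_num))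
  have e2 : Real.exp (-0.5625*x) ≤ 0.01 := (Real.exp_le_exp.2 (by linarith)).trans (exp_ubn (y := -5) _ 5 1 (by norm_num) (by norm_num) (by norm_num) (by norm_num))
  have t1 : ‖s‖*‖s+1‖/(12*(s.re+1))*(N:ℝ)^(-s.re-1) ≤ 1.41 := by
    rw [hre]
    calc _ ≤ (6.3 * Real.exp x) * (6.3 * Real.exp x) / (12 * 1.65) * (3.14 * Real.exp (-2.0625*x)) := by
          gcongr; linarith
      _ = 6.3*6.3*3.14/(12*1.65) * Real.exp (-0.0625*x) := by
          rw [show -0.0625*x = x + x + -2.0625*x by ring, Real.exp_add, Real.exp_add]; ring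
      _ ≤ _ := by nlinarith
  have t2 : ‖s/12*(N:ℂ)^(-s-1)‖ ≤ 0.04 := by
    rw [norm_mul, norm_div, hnorm]
    simp only [Complex.sub_re, Complex.neg_re, Complex.one_re, hre]
    calc _ ≤ (6.3 * Real.exp x) / 12 * (3.14 * Real.exp (-2.0625*x)) := by
          gcongr; simp
      _ = 6.3*3.14/12 * Real.exp (-1.0625*x) := by
          rw [show -1.0625*x = x + -2.0625*x by ring, Real.exp_add]; ring
      _ ≤ 6.3*3.14/12 * Real.exp (-0.5625*x) := by
          gcongr _ * ?_
          rw [Real.exp_le_exp]; linarith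
      _ ≤ _ := by nlinarith
  have t3 : ‖(N:ℂ)^(1-s)/(s-1)‖ ≤ 0.04 := by
    rw [norm_div, hnorm]
    simp only [Complex.sub_re, Complex.one_re, hre]
    calc _ ≤ Real.exp (0.4375*x) / (6.28 * Real.exp x) := by gcongr
      _ = 1/6.28 * Real.exp (-0.5625*x) := by
          rw [show 0.4375*x = x + -0.5625*x by ring, Real.exp_add]
          have := (Real.exp_pos x).ne'
          field_simp
      _ ≤ _ := by nlinarith
  have t4 : ‖(1/2:ℂ)*(N:ℂ)^(-s)‖ ≤ 0.5 := by
    rw [norm_mul, hnorm]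
    simp only [Complex.neg_re, hre]
    norm_num
    linarith
  have hE : 8 ≤ Real.exp (0.1*x) := (exp_lb (y := 2.4) (8:ℝ) 12 5 (by norm_num) (by norm_num) (by norm_num)).trans (Real.exp_le_exp.2 (by linarith))
  have tri : ‖riemannZeta s‖ ≤ ‖∑ n ∈ Ico 1 N, (n:ℂ)^(-s)‖ + ‖(1/2:ℂ)*(N:ℂ)^(-s)‖ + ‖s/12*(N:ℂ)^(-s-1)‖ + ‖(N:ℂ)^(1-s)/(s-1)‖ + 1.41 := by
    have h := norm_add_le (riemannZeta s - (∑ n ∈ Ico 1 N, (n:ℂ)^(-s) + 1/2*(N:ℂ)^(-s) + s/12*(N:ℂ)^(-s-1) + (N:ℂ)^(1-s)/(s-1)))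
      (∑ n ∈ Ico 1 N, (n:ℂ)^(-s) + 1/2*(N:ℂ)^(-s) + s/12*(N:ℂ)^(-s-1) + (N:ℂ)^(1-s)/(s-1))
    rw [sub_add_cancel] at h
    have h2 := norm_add_le (∑ n ∈ Ico 1 N, (n:ℂ)^(-s) + 1/2*(N:ℂ)^(-s) + s/12*(N:ℂ)^(-s-1)) ((N:ℂ)^(1-s)/(s-1))
    have h3 := norm_add_le (∑ n ∈ Ico 1 N, (n:ℂ)^(-s) + 1/2*(N:ℂ)^(-s)) (s/12*(N:ℂ)^(-s-1))
    have h4 := norm_add_le (∑ n ∈ Ico 1 N, (n:ℂ)^(-s)) (1/2*(N:ℂ)^(-s))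
    linarith
  linarith

end

section
open Finset

open Metric in
theorem PJ (R : ℝ) (hR : 0 < R) (n : ℕ) : ∀ (S : Finset ℂ) (F : ℂ → ℂ), S.card = n → AnalyticOnNhd ℂ F (closedBall 0 R) →
    (∀ z ∈ closedBall (0:ℂ) R, F z = 0 ↔ z ∈ S) → (∀ v ∈ S, v ∈ ball (0:ℂ) R) →
    ∃ m : ℂ → ℕ, (∀ v ∈ S, 1 ≤ m v) ∧ ∀ w ∈ ball (0:ℂ) R, w ∉ S →
      Real.log ‖F w‖ = ∑ v ∈ S, m v * Real.log ‖(w - v) / (R - (starRingEnd ℂ) v * w / R)‖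
        + Real.circleAverage (fun z => poissonKernel 0 w z * Real.log ‖F z‖) 0 R := by
  induction n with
  | zero =>
    intro S F hS hF h0 _
    rw [Finset.card_eq_zero] at hS
    subst hS
    refine ⟨fun _ => 1, by simp, fun w hw _ => ?_⟩
    have hh : InnerProductSpace.HarmonicOnNhd (fun z => Real.log ‖F z‖) (closedBall 0 R) := by
      intro z hz
      exact (hF z hz).harmonicAt_log_norm (by simpa using h0 z hz)
    simp only [Finset.sum_empty, zero_add]
    exact (hh.circleAverage_poissonKernel_smul hw).symm
  | succ n ih =>
    intro S F hS hF h0 hb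
    obtain ⟨v, hv⟩ : S.Nonempty := by rw [← Finset.card_pos]; omega
    have hvb := hb v hv
    have hvc := ball_subset_closedBall hvb
    have hvn : ‖v‖ < R := by simpa using hvb
    have hord : analyticOrderAt F v ≠ ⊤ := by
      intro h
      rw [analyticOrderAt_eq_top] at h
      have h2 : ∀ᶠ z in nhds v, z ∈ (S:Set ℂ) := by
        filter_upwards [h, isOpen_ball.mem_nhds hvb] with z hz hzb
        exact (h0 z (ball_subset_closedBall hzb)).1 hz
      exact (infinite_of_mem_nhds v h2) S.finite_toSet
    obtain ⟨g, hg, hg0, hge⟩ := (hF v hvc).analyticOrderAt_ne_top.1 hord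
    set k := analyticOrderNatAt F v with hk
    have hk1 : 1 ≤ k := by
      by_contra hk0
      have hk0 : k = 0 := by omega
      have := hge.self_of_nhds
      rw [hk0] at this
      simp at this
      rw [(h0 v hvc).2 hv] at this
      exact hg0 this.symm
    set B : ℂ → ℂ := fun z => R - (starRingEnd ℂ) v * z / R with hB
    have hRc : (R:ℂ) ≠ 0 := by exact_mod_cast hR.ne'
    have hB0 : ∀ z ∈ closedBall (0:ℂ) R, B z ≠ 0 := by
      intro z hz h
      have hz' : ‖z‖ ≤ R := by simpa using hz
      have e : (R:ℂ) * R = (starRingEnd ℂ) v * z := by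
        simp only [hB] at h
        field_simp at h
        linear_combination h
      have e2 := congrArg norm e
      simp at e2
      nlinarith [norm_nonneg v, norm_nonneg z]
    set G : ℂ → ℂ := Function.update (fun z => F z / (z - v)^k * (B z)^k) v (g v * (B v)^k) with hG
    have hBan : ∀ z, AnalyticAt ℂ B z := fun z => by simp only [hB]; fun_prop
    have hGv : G v = g v * (B v)^k := by simp [hG]
    have hGne : ∀ z, z ≠ v → G z = F z / (z - v)^k * (B z)^k := fun z hz => by simp [hG, hz]
    have hGan : AnalyticOnNhd ℂ G (closedBall 0 R) := by
      intro z hz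
      by_cases hzv : z = v
      · subst hzv
        refine (hg.mul ((hBan z).pow k)).congr ?_
        filter_upwards [hge] with y hy
        by_cases hyz : y = z
        · subst hyz; simp [hGv]
        · rw [hGne y hyz, hy]
          have : y - z ≠ 0 := sub_ne_zero.2 hyz
          simp [this]
      · have hz' : z - v ≠ 0 := sub_ne_zero.2 hzv
        have : AnalyticAt ℂ (fun z => F z / (z - v)^k * (B z)^k) z := by
          refine AnalyticAt.mul ((hF z hz).div (by fun_prop) (pow_ne_zero _ hz')) ((hBan z).pow k)
        refine this.congr ?_
        filter_upwards [isOpen_ne.mem_nhds hzv] with y hy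
        rw [hGne y hy]
    obtain ⟨m, hm1, hm⟩ := ih (S.erase v) G (by rw [Finset.card_erase_of_mem hv]; omega) hGan (by
      intro z hz
      by_cases hzv : z = v
      · subst hzv
        simp [hGv, hg0, hB0 z hz]
      · have hz' : z - v ≠ 0 := sub_ne_zero.2 hzv
        rw [hGne z hzv, Finset.mem_erase]
        simp [hz', hB0 z hz, hzv, h0 z hz]) (fun u hu => hb u (Finset.mem_of_mem_erase hu))
    refine ⟨Function.update m v k, ?_, ?_⟩
    · intro u hu
      by_cases huv : u = v
      · subst huv; simpa using hk1
      · simpa [huv] using hm1 u (Finset.mem_erase.2 ⟨huv, hu⟩)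
    · intro w hw hwS
      have hwv : w ≠ v := fun h => hwS (h ▸ hv)
      have hwc := ball_subset_closedBall hw
      have h1 := hm w hw (fun h => hwS (Finset.mem_of_mem_erase h))
      have hsum : ∑ u ∈ S.erase v, (Function.update m v k u : ℝ) * Real.log ‖(w - u) / (R - (starRingEnd ℂ) u * w / R)‖
          = ∑ u ∈ S.erase v, (m u : ℝ) * Real.log ‖(w - u) / (R - (starRingEnd ℂ) u * w / R)‖ := by
        refine Finset.sum_congr rfl fun u hu => ?_
        rw [Function.update_of_ne (Finset.ne_of_mem_erase hu)]
      rw [← Finset.add_sum_erase S _ hv, hsum]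
      have hav : Real.circleAverage (fun z => poissonKernel 0 w z * Real.log ‖F z‖) 0 R
          = Real.circleAverage (fun z => poissonKernel 0 w z * Real.log ‖G z‖) 0 R := by
        apply Real.circleAverage_congr_sphere
        intro z hz
        rw [abs_of_pos hR] at hz
        have hzn : ‖z‖ = R := by simpa using hz
        have hzv : z ≠ v := by rintro rfl; linarith
        have hn : ‖z - v‖ = ‖B z‖ := by
          have e : (starRingEnd ℂ) z * z = (R:ℂ) * R := by
            rw [Complex.conj_mul', hzn]; ring
          have e2 : B z = (starRingEnd ℂ) (z - v) * z / R := by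
            simp only [hB, map_sub, sub_mul, e]
            field_simp
          rw [e2, norm_div, norm_mul, hzn, RCLike.norm_conj]
          simp [abs_of_pos hR, hR.ne']
        have : ‖G z‖ = ‖F z‖ := by
          rw [hGne z hzv, norm_mul, norm_div, norm_pow, norm_pow, hn, div_mul_cancel₀]
          exact pow_ne_zero _ (norm_ne_zero_iff.2 (hB0 z (sphere_subset_closedBall hz)))
        simp only [this]
      rw [hav, add_assoc, ← h1, Function.update_self, hGne w hwv]
      have hwv' : w - v ≠ 0 := sub_ne_zero.2 hwv
      have hFw : F w ≠ 0 := fun h => hwS ((h0 w hwc).1 h)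
      have hBw := hB0 w hwc
      have hb1 : ‖B w‖ ≠ 0 := norm_ne_zero_iff.2 hBw
      have hb2 : ‖w - v‖ ≠ 0 := norm_ne_zero_iff.2 hwv'
      have hb3 : ‖F w‖ ≠ 0 := norm_ne_zero_iff.2 hFw
      have ea : Real.log ‖F w / (w - v)^k * (B w)^k‖ = Real.log ‖F w‖ - k * Real.log ‖w - v‖ + k * Real.log ‖B w‖ := by
        rw [norm_mul, norm_div, norm_pow, norm_pow, Real.log_mul (by positivity) (by positivity), Real.log_div hb3 (by positivity), Real.log_pow, Real.log_pow]
      have eb : Real.log ‖(w - v) / (R - (starRingEnd ℂ) v * w / R)‖ = Real.log ‖w - v‖ - Real.log ‖B w‖ := by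
        rw [norm_div]; exact Real.log_div hb2 hb1
      rw [ea, eb]
      ring

end

section
open Finset

lemma log_norm_zeta (s : ℂ) (hs : 1 < s.re) :
    HasSum (fun n : ℕ => (ArithmeticFunction.vonMangoldt n / Real.log n) * (Complex.exp (-(Real.log n : ℂ) * s)).re) (Real.log ‖riemannZeta s‖) := by
  have h1 : LSeriesSummable (fun n : ℕ => ((ArithmeticFunction.vonMangoldt n : ℝ) : ℂ) / (Real.log n : ℂ)) s := by
    refine LSeriesSummable_of_bounded_of_one_lt_re (m := 1) ?_ hs
    intro n hn
    rw [← Complex.ofReal_div, Complex.norm_real, Real.norm_eq_abs, abs_of_nonneg]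
    · apply div_le_one_of_le₀ ArithmeticFunction.vonMangoldt_le_log
      exact Real.log_natCast_nonneg n
    · exact div_nonneg ArithmeticFunction.vonMangoldt_nonneg (Real.log_natCast_nonneg n)
  have h2 := (Complex.hasSum_re h1.hasSum)
  rw [← riemannZeta_eq_exp_LSeries hs, Complex.norm_exp, Real.log_exp]
  refine h2.congr_fun ?_ |> fun h => h
  intro n
  rcases Nat.eq_zero_or_pos n with h | h
  · subst h; simp
  · rw [LSeries.term_of_ne_zero h.ne']
    have hn : (n:ℂ) ≠ 0 := by exact_mod_cast h.ne'
    rw [div_eq_mul_inv _ ((n:ℂ)^s), ← Complex.cpow_neg, Complex.cpow_def_of_ne_zero hn, ← Complex.ofReal_div,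
      Complex.re_ofReal_mul, Complex.natCast_log]
    congr 3; ring

lemma euler_pos (ι : Type*) (J : Finset ι) (c : ι → ℝ) (z : ι → ℂ) (hz : ∀ j ∈ J, 0 < (z j).re)
    (hc : ∀ X : ℝ, 0 ≤ X → ∃ r : ℝ, 0 ≤ r ∧ ∑ j ∈ J, (c j : ℂ) * Complex.exp (-(X:ℂ) * z j) = r)
    (b : ℕ → ℝ) (K : ℕ) (hb : ∀ θ : ℝ, 0 ≤ ∑ k ∈ range K, b k * Real.cos (k * θ)) (t : ℝ) :
    0 ≤ ∑ k ∈ range K, b k * ∑ j ∈ J, c j * Real.log ‖riemannZeta (1 + z j + (k * t : ℝ) * Complex.I)‖ := by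
  have h : HasSum (fun n : ℕ => ∑ k ∈ range K, b k * ∑ j ∈ J, c j * ((ArithmeticFunction.vonMangoldt n / Real.log n) *
      (Complex.exp (-(Real.log n : ℂ) * (1 + z j + (k * t : ℝ) * Complex.I))).re))
      (∑ k ∈ range K, b k * ∑ j ∈ J, c j * Real.log ‖riemannZeta (1 + z j + (k * t : ℝ) * Complex.I)‖) := by
    refine hasSum_sum fun k _ => (hasSum_sum fun j hj => (log_norm_zeta _ ?_).mul_left _).mul_left _
    have := hz j hj
    simp; exact this
  refine h.nonneg fun n => ?_
  obtain ⟨r, hr, hr2⟩ := hc (Real.log n) (Real.log_natCast_nonneg n)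
  have e : ∀ k ∈ range K, b k * ∑ j ∈ J, c j * ((ArithmeticFunction.vonMangoldt n / Real.log n) *
      (Complex.exp (-(Real.log n : ℂ) * (1 + z j + (k * t : ℝ) * Complex.I))).re) =
      (ArithmeticFunction.vonMangoldt n / Real.log n) * Real.exp (-Real.log n) * r * (b k * Real.cos (k * (t * Real.log n))) := by
    intro k _
    have e1 : ∑ j ∈ J, c j * (Complex.exp (-(Real.log n : ℂ) * (1 + z j + (k * t : ℝ) * Complex.I))).re
        = Real.exp (-Real.log n) * r * Real.cos (k * (t * Real.log n)) := by
      have e2 : ∑ j ∈ J, (c j : ℂ) * (Complex.exp (-(Real.log n : ℂ) * (1 + z j + (k * t : ℝ) * Complex.I)))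
          = (∑ j ∈ J, (c j : ℂ) * Complex.exp (-(Real.log n : ℂ) * z j)) * (Complex.exp ((-Real.log n : ℝ) + (-(k * (t * Real.log n)) : ℝ) * Complex.I)) := by
        rw [Finset.sum_mul]
        refine Finset.sum_congr rfl fun j _ => ?_
        rw [mul_assoc, ← Complex.exp_add]
        congr 2
        push_cast; ring
      have e3 := congrArg Complex.re e2
      rw [hr2, Complex.re_sum, Complex.re_ofReal_mul, Complex.exp_re] at e3
      simp only [Complex.re_ofReal_mul] at e3
      rw [e3]
      generalize Real.log n = y
      simp
      ring
    have e4 : ∑ j ∈ J, c j * ((ArithmeticFunction.vonMangoldt n / Real.log n) *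
      (Complex.exp (-(Real.log n : ℂ) * (1 + z j + (k * t : ℝ) * Complex.I))).re) = (ArithmeticFunction.vonMangoldt n / Real.log n) * ∑ j ∈ J, c j * 
      (Complex.exp (-(Real.log n : ℂ) * (1 + z j + (k * t : ℝ) * Complex.I))).re := by
      rw [Finset.mul_sum]
      exact Finset.sum_congr rfl fun j _ => by ring
    rw [e4, e1]; ring
  rw [Finset.sum_congr rfl e, ← Finset.mul_sum]
  refine mul_nonneg (mul_nonneg (mul_nonneg ?_ (Real.exp_pos _).le) hr) (hb _)
  exact div_nonneg ArithmeticFunction.vonMangoldt_nonneg (Real.log_natCast_nonneg n)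

lemma zeta_real_bd (x : ℝ) (hx : 0 < x) (hx2 : x ≤ 0.35) : ‖riemannZeta (1 + x)‖ ≤ 1 + 1/x := by
  have h := zeta_approx 1 le_rfl (1 + x) (by simp; linarith) (by simpa using hx.ne')
  simp only [Nat.cast_one, Complex.one_cpow, Ico_self, sum_empty, zero_add, mul_one, Real.one_rpow] at h
  have e1 : (1 / 2 + (1 + (x:ℂ)) / 12 + 1 / (1 + (x:ℂ) - 1)) = ((1/2 + (1+x)/12 + 1/x : ℝ) : ℂ) := by
    push_cast
    congr 2
    ring
  rw [e1] at h
  have e2 : ‖(1 + (x:ℂ))‖ = 1 + x := by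
    rw [show (1 + (x:ℂ)) = ((1 + x : ℝ):ℂ) by push_cast; ring, Complex.norm_real, Real.norm_eq_abs, abs_of_pos (by linarith)]
  have e3 : ‖(1 + (x:ℂ) + 1)‖ = 2 + x := by
    rw [show (1 + (x:ℂ) + 1) = ((2 + x : ℝ):ℂ) by push_cast; ring, Complex.norm_real, Real.norm_eq_abs, abs_of_pos (by linarith)]
  have e4 : (1 + (x:ℂ)).re = 1 + x := by simp
  rw [e2, e3, e4] at h
  have h2 := norm_le_norm_add_norm_sub' (riemannZeta (1 + x)) ((1/2 + (1+x)/12 + 1/x : ℝ) : ℂ)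
  rw [Complex.norm_real, Real.norm_eq_abs, abs_of_pos (by positivity)] at h2
  have e5 : (1 + x) * (2 + x) / (12 * (1 + x + 1)) = (1 + x)/12 := by
    field_simp; ring
  rw [e5] at h
  linarith

lemma zeta_lower (σ t : ℝ) (hσ : 1 < σ) : -Real.log ‖riemannZeta (σ + t * Complex.I)‖ ≤ Real.log ‖riemannZeta σ‖ := by
  have h1 := (log_norm_zeta (σ + t * Complex.I) (by simpa using hσ)).neg
  have h2 := log_norm_zeta σ (by simpa using hσ)
  refine hasSum_le (fun n => ?_) h1 h2
  rw [← mul_neg]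
  refine mul_le_mul_of_nonneg_left ?_ (div_nonneg ArithmeticFunction.vonMangoldt_nonneg (Real.log_natCast_nonneg n))
  have h3 := (abs_le.1 (Complex.abs_re_le_norm (Complex.exp (-(Real.log n : ℂ) * (σ + t * Complex.I))))).1
  rw [Complex.norm_exp] at h3
  have e2 : (Complex.exp (-(Real.log n : ℂ) * σ)).re = Real.exp (-Real.log n * σ) := by
    rw [← Complex.ofReal_neg, ← Complex.ofReal_mul, Complex.exp_ofReal_re]
  rw [e2]
  have e : (-(Real.log n : ℂ) * (σ + t * Complex.I)).re = -Real.log n * σ := by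
    generalize Real.log n = y
    simp
  rw [e] at h3
  linarith

lemma zeta_lower' (x t : ℝ) (hx : 0 < x) (hx2 : x ≤ 0.35) : -Real.log ‖riemannZeta (1 + x + t * Complex.I)‖ ≤ Real.log (1 + 1/x) := by
  have h := zeta_lower (1 + x) t (by linarith)
  push_cast at h
  refine h.trans ?_
  refine Real.log_le_log ?_ (zeta_real_bd x hx hx2)
  rw [norm_pos_iff]
  apply riemannZeta_ne_zero_of_one_le_re
  simp; exact hx.le

end

section
open Finset

lemma T_k4 (A x l σ τ E q : ℝ) (hl : 0 ≤ l) (hl2 : l ≤ 0.000069) (hx0 : 0 ≤ x) (hx : 0.969 * (1 - σ) ≤ x) (hσ0 : 0 ≤ σ) (hs : σ < 1)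
    (hσA : σ ≤ l * A) (hc : 500 ≤ A) (hτ1 : 0.9995 ≤ τ) (hq : q = l * A) (hE0 : E ≤ 105 * (1 + σ) + 8.4 * x) (hE1 : 0 ≤ E) :
    4595 * (1 + q) + q * 42.1 * E ≤ A * (14.2 * x * τ + 1.71 * (1 + σ + 5 * l * x)) := by
  have hA : 0 ≤ A := by linarith
  have b2 : 0 ≤ l * x := mul_nonneg hl hx0
  have b3 : l * E ≤ 0.000069 * (105 * (1 + σ) + 8.4 * x) := mul_le_mul hl2 hE0 hE1 (by norm_num)
  have b8 : x * 0.9995 ≤ x * τ := mul_le_mul_of_nonneg_left hτ1 hx0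
  have b9 : 4595 ≤ A * (14.16 * x + 1.4 * (1+σ) - 0.32) := by
    rcases le_or_gt σ 0.3 with h3 | h3
    · have : 9.4 ≤ 14.16 * x + 1.4 * (1+σ) - 0.32 := by linarith
      calc (4595:ℝ) ≤ 500 * 9.4 := by norm_num
        _ ≤ _ := mul_le_mul hc this (by norm_num) hA
    · have h4 : 4300 ≤ A := by
        have : l * A ≤ 0.000069 * A := mul_le_mul_of_nonneg_right hl2 hA
        linarith
      have : 1.5 ≤ 14.16 * x + 1.4 * (1+σ) - 0.32 := by linarith
      calc (4595:ℝ) ≤ 4300 * 1.5 := by norm_num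
        _ ≤ _ := mul_le_mul h4 this (by norm_num) hA
  have b10 : A * (14.16 * x + 1.4 * (1+σ) - 0.32 + 4595 * l + 42.1 * (l * E)) ≤ A * (14.2 * x * τ + 1.71 * (1 + σ + 5 * l * x)) := by
    refine mul_le_mul_of_nonneg_left ?_ hA
    linarith
  rw [hq]
  linarith

lemma T_k3 (x m h n2 : ℝ) (hx : 0.935 ≤ x) (hh : h = 14.2 * (x + 2.5) + 50.41) (hm : m = 42.1^2 + 168.4 * (x + 2.5)^2)
    (hn2 : n2 = 84.2 * h - m) : n2^2 ≤ 4 * (14.19 * x + 1.67) * (0.965 * (m * h)) := by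
  obtain ⟨y, hy⟩ : ∃ y, x = 0.935 + y := ⟨x - 0.935, by ring⟩
  have hy0 : 0 ≤ y := by linarith
  have : 4 * (14.19 * x + 1.67) * (0.965 * (m * h)) - n2^2 = 
    4 * (14.19 * (0.935 + y) + 1.67) * (0.965 * ((42.1^2 + 168.4 * (0.935 + y + 2.5)^2) * (14.2 * (0.935 + y + 2.5) + 50.41))) - (84.2 * (14.2 * (0.935 + y + 2.5) + 50.41) - (42.1^2 + 168.4 * (0.935 + y + 2.5)^2))^2 := by
    rw [hn2, hm, hh, hy]
  have : 0 ≤ 4 * (14.19 * x + 1.67) * (0.965 * (m * h)) - n2^2 := by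
    rw [this]
    ring_nf
    positivity
  linarith

lemma T_quad (P n2 a Z g τ : ℝ) (hP : 0 < P) (h0 : 0 ≤ τ) (h1 : τ ≤ 1) (d : n2^2 ≤ 4 * P * g) :
    0 ≤ P * a^2 - n2 * (τ * a * Z) + g * τ * Z^2 := by
  have : 0 ≤ 4 * P * (P * a^2 - n2 * (τ * a * Z) + g * τ * Z^2) := by
    have c1 : 4 * P * (P * a^2 - n2 * (τ * a * Z) + g * τ * Z^2)
      = τ * (2 * P * a - n2 * Z)^2 + (1 - τ) * (2 * P * a)^2 + τ * Z^2 * (4 * P * g - n2^2) := by ring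
    rw [c1]
    have : 0 ≤ 4 * P * g - n2^2 := by linarith
    have : 0 ≤ 1 - τ := by linarith
    positivity
  exact nonneg_of_mul_nonneg_right this (by positivity)

lemma T_key (A N x l σ τ E q m h n2 : ℝ) (hl : 0 ≤ l) (hl2 : l ≤ 0.000069) (hx0 : 0 ≤ x) (hx : 0.969 * (1 - σ) ≤ x) (hσ0 : 0 ≤ σ) (hs : σ < 1)
    (hσA : σ ≤ l * A) (hτ1 : 0.9995 ≤ τ) (hτ2 : τ ≤ 1) (hq : q = l * A) (hE0 : E ≤ 105 * (1 + σ) + 8.4 * x) (hE1 : 0 ≤ E)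
    (hA0 : 0 ≤ A) (hN1 : 1 ≤ N) (hqN : q ≤ N)
    (hh : h = 14.2 * (x + 2.5) + 50.41) (hm : m = 42.1^2 + 168.4 * (x + 2.5)^2) (hn2 : n2 = 84.2 * h - m) :
    0 ≤ A^2 * N^2 * (14.2 * x * τ + 1.71 * (1 + σ + 5 * l * x)) - A * N * (n2 * τ * (N + q) + q^2 * 42.1 * E)
      + m * h * τ * (N^2 + N * q + q^2) := by
  have hq0 : 0 ≤ q := by rw [hq]; positivity
  have hN0 : 0 ≤ N := by linarith
  have hτ0 : 0 ≤ τ := by linarith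
  have hm0 : 0 ≤ m := by rw [hm]; positivity
  have hh0 : 0 ≤ h := by rw [hh]; positivity
  rcases le_or_gt 500 A with hc | hc
  · have k0 : 0 ≤ m * h * τ * (N^2 + N * q + q^2) := by positivity
    have hn2' : n2 ≤ 4595 := by rw [hn2, hh, hm]; nlinarith only [sq_nonneg (x - 1.05)]
    have k1 : n2 * τ * (N + q) ≤ 4595 * (N * (1 + q)) := by
      rw [mul_assoc]
      have a2 : τ * (N + q) ≤ 1 * (N * (1 + q)) := mul_le_mul hτ2 (by nlinarith only [hN1, hq0]) (by positivity) (by norm_num)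
      rw [one_mul] at a2
      refine mul_le_mul hn2' a2 (by positivity) (by norm_num)
    have k2 : q^2 * 42.1 * E ≤ N * (q * 42.1 * E) := by
      have : q * (q * 42.1 * E) ≤ N * (q * 42.1 * E) := mul_le_mul_of_nonneg_right hqN (by positivity)
      linarith
    have k4 := T_k4 A x l σ τ E q hl hl2 hx0 hx hσ0 hs hσA hc hτ1 hq hE0 hE1
    have k5 : A * N * (n2 * τ * (N + q) + q^2 * 42.1 * E) ≤ A * N * (N * (A * (14.2 * x * τ + 1.71 * (1 + σ + 5 * l * x)))) := by
      refine mul_le_mul_of_nonneg_left ?_ (by positivity)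
      have := mul_le_mul_of_nonneg_left k4 hN0
      linarith
    have k6 : A * N * (N * (A * (14.2 * x * τ + 1.71 * (1 + σ + 5 * l * x)))) = A^2 * N^2 * (14.2 * x * τ + 1.71 * (1 + σ + 5 * l * x)) := by ring
    linarith
  · have hqs : q ≤ 0.0345 := by 
      rw [hq]
      calc l * A ≤ 0.000069 * 500 := mul_le_mul hl2 hc.le hA0 (by norm_num)
        _ ≤ _ := by norm_num
    have hσs : σ ≤ 0.0345 := by linarith
    have hxx : 0.935 ≤ x := by linarith
    have k1 : 0.965 * (N + q)^2 ≤ N^2 + N * q + q^2 := by nlinarith only [hN1, hq0, hqs]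
    have k2 : q^2 * 42.1 * E ≤ A * N * (0.03 + 0.002 * x) := by
      have : l * E ≤ 0.000069 * (105 * (1 + σ) + 8.4 * x) := mul_le_mul hl2 hE0 hE1 (by norm_num)
      have b1 : q * 42.1 * (l * E) ≤ 0.0345 * 42.1 * (0.000069 * (105 * (1 + 0.0345) + 8.4 * x)) := by
        refine mul_le_mul (by linarith) (by linarith) (by positivity) (by norm_num)
      have b2 : q^2 * 42.1 * E = A * (q * 42.1 * (l * E)) := by rw [hq]; ring
      rw [b2, mul_assoc A N]
      refine mul_le_mul_of_nonneg_left ?_ hA0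
      have : 1 * (0.03 + 0.002 * x) ≤ N * (0.03 + 0.002 * x) := mul_le_mul_of_nonneg_right hN1 (by positivity)
      linarith
    have k3 := T_quad (14.19 * x + 1.67) n2 (A * N) (N + q) (0.965 * (m * h)) τ (by linarith) hτ0 hτ2 (T_k3 x m h n2 hxx hh hm hn2)
    have k4 : 0.965 * (m * h) * τ * (N + q)^2 ≤ m * h * τ * (N^2 + N * q + q^2) := by
      have : m * h * τ * (0.965 * (N + q)^2) ≤ m * h * τ * (N^2 + N * q + q^2) := mul_le_mul_of_nonneg_left k1 (by positivity)
      linarith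
    have k5 : A * N * (q^2 * 42.1 * E) ≤ A * N * (A * N * (0.03 + 0.002 * x)) := mul_le_mul_of_nonneg_left k2 (by positivity)
    have k6 : (A * N)^2 * (14.19 * x + 1.67 + 0.03 + 0.002 * x) ≤ (A * N)^2 * (14.2 * x * τ + 1.71 * (1 + σ + 5 * l * x)) := by
      refine mul_le_mul_of_nonneg_left ?_ (by positivity)
      have : 0 ≤ l * x := by positivity
      have b8 : x * 0.9995 ≤ x * τ := mul_le_mul_of_nonneg_left hτ1 hx0
      linarith
    linarith

lemma T_core (x s l σ : ℝ) (hσ : σ = l * s) (hl : 0 ≤ l) (hl2 : l ≤ 0.000069) (hx : 0.969 * (1 - σ) ≤ x) (hxs : x^2 ≤ s) (hs : σ < 1)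
    (A C B N NC NB : ℝ)
    (hA : A = s + 5 * x + 6.25) (hC : C = s + 19.2 * x + 92.16)
    (hB : B = (A - 42.1)^2 + 168.4 * (x + 2.5)^2)
    (hN : N = 1 + 5 * l * x + l * σ * 6.25) (hNC : NC = 1 + 19.2 * l * x + l * σ * 92.16)
    (hNB : NB = (N - l * σ * 42.1)^2 + 168.4 * l^2 * (x + 2.5 * σ)^2) :
    A^3 * NB * NC ≤ B * C * N^3 := by
  have hs0 : 0 ≤ s := (sq_nonneg x).trans hxs
  have hσ0 : 0 ≤ σ := by rw [hσ]; positivity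
  have hx0 : 0 ≤ x := by linarith
  obtain ⟨q, hq⟩ : ∃ q, q = l * A := ⟨_, rfl⟩
  have hA0 : 6.25 ≤ A := by rw [hA]; linarith
  have hN1 : 1 ≤ N := by rw [hN]; linarith [mul_nonneg hl hx0, mul_nonneg hl hσ0]
  have hq0 : 0 ≤ q := by rw [hq]; positivity
  obtain ⟨τ, hτ⟩ : ∃ τ, τ = 1 - l * 6.25 := ⟨_, rfl⟩
  have hτ1 : 0.9995 ≤ τ := by rw [hτ]; linarith
  have hτ2 : τ ≤ 1 := by rw [hτ]; linarith
  have e1 : N - q = (1 - σ) * τ := by rw [hN, hq, hA, hτ, hσ]; ring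
  have e2 : N - σ * q = (1 - σ) * (1 + σ + 5 * l * x) := by rw [hN, hq, hA, hσ]; ring
  have hqN : q ≤ N := by
    have : 0 ≤ (1 - σ) * τ := mul_nonneg (by linarith) (by linarith)
    linarith
  -- polynomial data
  obtain ⟨h, hh⟩ : ∃ h, h = 14.2 * (x + 2.5) + 50.41 := ⟨_, rfl⟩
  obtain ⟨m, hm⟩ : ∃ m, m = 42.1^2 + 168.4 * (x + 2.5)^2 := ⟨_, rfl⟩
  obtain ⟨n2, hn2⟩ : ∃ n2, n2 = 84.2 * h - m := ⟨_, rfl⟩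
  obtain ⟨h', hh'⟩ : ∃ h', h' = 14.2 * (x + 2.5 * σ) + 50.41 * σ := ⟨_, rfl⟩
  obtain ⟨m', hm'⟩ : ∃ m', m' = 42.1^2 * σ^2 + 168.4 * (x + 2.5 * σ)^2 := ⟨_, rfl⟩
  obtain ⟨E, hE⟩ : ∃ E, E = 58.72 * (1 + σ) + 28.4 * (x + 2.5 * (1 + σ)) - 10 * (2 * x + 2.5 * (1 + σ)) := ⟨_, rfl⟩
  have p1 : B * C = A^3 + (14.2 * x + 1.71) * A^2 - n2 * A + m * h := by
    have : C = A + h := by rw [hC, hA, hh]; ring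
    have hB' : B = A^2 - 84.2 * A + m := by rw [hB, hm]; ring
    rw [this, hB', hn2]
    have : 14.2 * x + 1.71 = h - 84.2 := by rw [hh]; ring
    rw [this]; ring
  have p2 : NB * NC = N^3 + l * (14.2 * x + 1.71 * σ) * N^2 - l^2 * (84.2 * σ * h' - m') * N + l^3 * (m' * h') := by
    have : NC = N + l * h' := by rw [hNC, hN, hh']; ring
    have hB' : NB = N^2 - 84.2 * (l * σ) * N + l^2 * m' := by rw [hNB, hm']; ring
    rw [this, hB']
    have : 14.2 * x + 1.71 * σ = h' - 84.2 * σ := by rw [hh']; ring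
    rw [this]; ring
  have p3 : n2 - (84.2 * σ * h' - m') = 42.1 * ((1 - σ) * E) := by
    rw [hn2, hh, hm, hh', hm', hE]; ring
  have hh0 : 0 ≤ h := by rw [hh]; positivity
  have hm0 : 0 ≤ m := by rw [hm]; positivity
  have hhh : h' ≤ h := by rw [hh, hh']; linarith
  have hmm : m' ≤ m := by
    rw [hm, hm']
    have : (x + 2.5 * σ)^2 ≤ (x + 2.5)^2 := pow_le_pow_left₀ (by positivity) (by linarith) 2
    have : σ^2 ≤ 1 := pow_le_one₀ hσ0 hs.le
    linarith
  have hh'0 : 0 ≤ h' := by rw [hh']; positivity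
  have hprod : m' * h' ≤ m * h := mul_le_mul hmm hhh hh'0 hm0
  have key := T_key A N x l σ τ E q m h n2 hl hl2 hx0 hx hσ0 hs (by rw [hσ]; exact mul_le_mul_of_nonneg_left (by rw [hA]; linarith) hl)
    hτ1 hτ2 hq (by rw [hE]; linarith) (by rw [hE]; linarith) (by linarith) hN1 hqN hh hm hn2
  have tot := mul_nonneg (sub_nonneg.2 hs.le) key
  have hq3 : 0 ≤ q^3 * (m * h - m' * h') := mul_nonneg (by positivity) (by linarith)
  have fin : B * C * N^3 - A^3 * (NB * NC) = (1 - σ) * (A^2 * N^2 * (14.2 * x * τ + 1.71 * (1 + σ + 5 * l * x)) - A * N * (n2 * τ * (N + q) + q^2 * 42.1 * E)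
      + m * h * τ * (N^2 + N * q + q^2)) + q^3 * (m * h - m' * h') := by
    have r1 : (1 - σ) * (A^2 * N^2 * (14.2 * x * τ + 1.71 * (1 + σ + 5 * l * x)) - A * N * (n2 * τ * (N + q) + q^2 * 42.1 * E)
      + m * h * τ * (N^2 + N * q + q^2)) = A^2 * N^2 * (14.2 * x * ((1 - σ) * τ) + 1.71 * ((1 - σ) * (1 + σ + 5 * l * x))) - A * N * (n2 * ((1 - σ) * τ) * (N + q) + q^2 * (42.1 * ((1 - σ) * E)))
      + m * h * ((1 - σ) * τ) * (N^2 + N * q + q^2) := by ring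
    rw [r1, ← e1, ← e2, ← p3, p1, p2, hq]
    ring
  have : A^3 * NB * NC = A^3 * (NB * NC) := by ring
  linarith

end

section
open Finset

noncomputable def cc (q : ℝ) (j : ℕ) : ℝ := if j = 0 then 1 + 2 * q else if j = 3 then -1 else -q

noncomputable def uu (j : ℕ) : ℂ := if j = 0 then ⟨5/2, 0⟩ else if j = 1 then ⟨5/2, √42.1⟩ else if j = 2 then ⟨5/2, -√42.1⟩ else ⟨48/5, 0⟩

lemma cc_sum (q : ℝ) (g : ℕ → ℝ) : ∑ j ∈ range 4, cc q j * g j = (1 + 2 * q) * g 0 - q * g 1 - q * g 2 - g 3 := by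
  simp [sum_range_succ, cc]; ring

lemma sqW : (√42.1 : ℝ)^2 = 42.1 := Real.sq_sqrt (by norm_num)

lemma uu_re (j : ℕ) : 5/2 ≤ (uu j).re := by
  unfold uu; split_ifs <;> norm_num

lemma uu_normSq (j : ℕ) : Complex.normSq (uu j) ≤ 92.16 := by
  have := sqW
  unfold uu; split_ifs <;> simp only [Complex.normSq_mk] <;> nlinarith

lemma logB (ε R : ℝ) (hε : 0 < ε) (hR : 0 < R) (z u : ℂ) (l : ℝ) (hl : l = ε^2/R^2)
    (h1 : z + u ≠ 0) (h2 : 1 + l * (starRingEnd ℂ) z * u ≠ 0) :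
    Real.log ‖(ε * u - -(ε * z)) / (R - (starRingEnd ℂ) (-(ε * z)) * (ε * u) / R)‖ =
      Real.log (ε / R) + Real.log (Complex.normSq (z + u)) / 2 - Real.log (Complex.normSq (1 + l * (starRingEnd ℂ) z * u)) / 2 := by
  have hR' : (R:ℂ) ≠ 0 := by exact_mod_cast hR.ne'
  have e : (ε * u - -(ε * z)) / (R - (starRingEnd ℂ) (-(ε * z)) * (ε * u) / R) = ((ε / R : ℝ):ℂ) * ((z + u) / (1 + l * (starRingEnd ℂ) z * u)) := by
    have : (R - (starRingEnd ℂ) (-(ε * z)) * (ε * u) / R) = R * (1 + l * (starRingEnd ℂ) z * u) := by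
      rw [hl, map_neg, map_mul, Complex.conj_ofReal]
      push_cast
      field_simp
      ring
    rw [this]
    push_cast
    field_simp
    ring
  rw [e, norm_mul, norm_div, Complex.norm_real, Real.norm_eq_abs, abs_of_pos (by positivity),
    Real.log_mul (by positivity) (div_ne_zero (norm_ne_zero_iff.2 h1) (norm_ne_zero_iff.2 h2)), Real.log_div (norm_ne_zero_iff.2 h1) (norm_ne_zero_iff.2 h2), Complex.normSq_eq_norm_sq,
    Complex.normSq_eq_norm_sq, Real.log_pow, Real.log_pow]
  push_cast; ring

lemma one_add_ne (z u : ℂ) (l : ℝ) (hl : 0 ≤ l) (hs : l * Complex.normSq z < 1) (hu : l * Complex.normSq u < 1) :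
    1 + l * (starRingEnd ℂ) z * u ≠ 0 := by
  intro h
  have h1 : (l:ℂ) * (starRingEnd ℂ) z * u = -1 := by linear_combination h
  have h2 := congrArg Complex.normSq h1
  rw [map_mul, map_mul, Complex.normSq_conj, Complex.normSq_ofReal, Complex.normSq_neg, map_one] at h2
  have : (l * Complex.normSq z) * (l * Complex.normSq u) = 1 := by linarith
  have h0 : 0 ≤ l * Complex.normSq u := mul_nonneg hl (Complex.normSq_nonneg _)
  have h0' : 0 ≤ l * Complex.normSq z := mul_nonneg hl (Complex.normSq_nonneg _)
  nlinarith

/-- the sum of logs of Blaschke factors. -/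
noncomputable def TT (q ε R : ℝ) (v : ℂ) : ℝ :=
  ∑ j ∈ range 4, cc q j * Real.log ‖(ε * uu j - v) / (R - (starRingEnd ℂ) v * (ε * uu j) / R)‖

lemma TT_eq (q ε R : ℝ) (hε : 0 < ε) (hR : 0 < R) (z : ℂ) (l : ℝ) (hl : l = ε^2/R^2) (hl2 : l ≤ 0.000069)
    (hz : 0 ≤ z.re) (hs : l * Complex.normSq z < 1) :
    2 * TT q ε R (-(ε * z)) = ∑ j ∈ range 4, cc q j * (Real.log (Complex.normSq (z + uu j)) - Real.log (Complex.normSq (1 + l * (starRingEnd ℂ) z * uu j))) := by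
  have hl0 : 0 ≤ l := by rw [hl]; positivity
  unfold TT
  have e : ∀ j ∈ range 4, cc q j * Real.log ‖(ε * uu j - (-(ε * z))) / (R - (starRingEnd ℂ) (-(ε * z)) * (ε * uu j) / R)‖
     = cc q j * Real.log (ε / R) + cc q j * (Real.log (Complex.normSq (z + uu j)) - Real.log (Complex.normSq (1 + l * (starRingEnd ℂ) z * uu j))) / 2 := by
    intro j _
    rw [logB ε R hε hR z (uu j) l hl ?_ ?_]
    · ring
    · intro h
      have := congrArg Complex.re h
      have := uu_re j
      simp at *; linarith
    · apply one_add_ne z _ l hl0 hs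
      have := uu_normSq j
      have : l * Complex.normSq (uu j) ≤ 0.000069 * 92.16 := mul_le_mul hl2 this (Complex.normSq_nonneg _) (by norm_num)
      linarith
  rw [sum_congr rfl e, sum_add_distrib, ← sum_mul, ← Finset.sum_div]
  have : ∑ j ∈ range 4, cc q j = 0 := by simp [sum_range_succ, cc]; ring
  rw [this]; ring

lemma TT_data (z : ℂ) (l : ℝ) : 
    Complex.normSq (z + uu 0) = Complex.normSq z + 5 * z.re + 6.25 ∧
    Complex.normSq (z + uu 3) = Complex.normSq z + 19.2 * z.re + 92.16 ∧
    Complex.normSq (z + uu 1) * Complex.normSq (z + uu 2) = (Complex.normSq z + 5 * z.re + 6.25 - 42.1)^2 + 168.4 * (z.re + 2.5)^2 ∧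
    Complex.normSq (1 + l * (starRingEnd ℂ) z * uu 0) = 1 + 5 * l * z.re + l * (l * Complex.normSq z) * 6.25 ∧
    Complex.normSq (1 + l * (starRingEnd ℂ) z * uu 3) = 1 + 19.2 * l * z.re + l * (l * Complex.normSq z) * 92.16 ∧
    Complex.normSq (1 + l * (starRingEnd ℂ) z * uu 1) * Complex.normSq (1 + l * (starRingEnd ℂ) z * uu 2) = 
      (1 + 5 * l * z.re + l * (l * Complex.normSq z) * 6.25 - l * (l * Complex.normSq z) * 42.1)^2 + 168.4 * l^2 * (z.re + 2.5 * (l * Complex.normSq z))^2 := by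
  obtain ⟨x, y⟩ := z
  obtain ⟨w, hw⟩ : ∃ w, w = √(42.1:ℝ) := ⟨_, rfl⟩
  have h := sqW
  rw [← hw] at h
  simp only [uu, if_true, one_ne_zero, if_false, OfNat.ofNat_ne_zero, OfNat.ofNat_ne_one, Complex.normSq_apply, ← hw]
  have h4 : (168.4:ℝ) = 4 * w^2 := by rw [h]; norm_num
  simp
  refine ⟨?_, ?_, ?_, ?_, ?_, ?_⟩
  · ring
  · ring
  · rw [h4, show (42.1:ℝ) = w^2 from h.symm]; ring
  · ring
  · ring
  · rw [h4, show (42.1:ℝ) = w^2 from h.symm]; ring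

lemma logs_str (A B1 B2 C N N1 N2 NC r : ℝ) (hA : 0 < A) (hB1 : 0 < B1) (hB2 : 0 < B2) (hC : 0 < C) (hN : 0 < N) (hN1 : 0 < N1)
    (hN2 : 0 < N2) (hNC : 0 < NC) (hr : 0 < r) (h : r * (A^3 * (N1 * N2) * NC) ≤ B1 * B2 * C * N^3) :
    (1 + 2 * 1) * (Real.log A - Real.log N) - 1 * (Real.log B1 - Real.log N1) - 1 * (Real.log B2 - Real.log N2) - (Real.log C - Real.log NC) ≤ -Real.log r := by
  have := Real.log_le_log (by positivity) h
  rw [Real.log_mul (by positivity) (by positivity), Real.log_mul (by positivity) (by positivity), Real.log_mul (by positivity) (by positivity), Real.log_mul (by positivity) (by positivity),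
    Real.log_mul (by positivity) (by positivity), Real.log_mul (by positivity) (by positivity), Real.log_mul (by positivity) (by positivity), Real.log_pow, Real.log_pow] at this
  push_cast at this
  linarith

lemma logs_weak (A B1 B2 C N N1 N2 NC r : ℝ) (hA : 0 < A) (hC : 0 < C) (hN : 0 < N) 
    (hNC : 0 < NC) (hr : 0 < r) (h : r * (A * NC) ≤ C * N) :
    (1 + 2 * 0) * (Real.log A - Real.log N) - 0 * (Real.log B1 - Real.log N1) - 0 * (Real.log B2 - Real.log N2) - (Real.log C - Real.log NC) ≤ -Real.log r := by
  have := Real.log_le_log (by positivity) h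
  rw [Real.log_mul (by positivity) (by positivity), Real.log_mul (by positivity) (by positivity), Real.log_mul (by positivity) (by positivity)] at this
  linarith

lemma TT_pn (z : ℂ) (l : ℝ) (hl0 : 0 ≤ l) (hl2 : l ≤ 0.000069) (hz0 : 0 ≤ z.re) (hs : l * Complex.normSq z < 1) (j : ℕ) :
    0 < Complex.normSq (z + uu j) ∧ 0 < Complex.normSq (1 + l * (starRingEnd ℂ) z * uu j) := by
  constructor
  · rw [Complex.normSq_pos]
    intro h
    have := congrArg Complex.re h
    have := uu_re j
    simp at *; linarith
  · rw [Complex.normSq_pos]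
    apply one_add_ne z _ l hl0 hs
    have := uu_normSq j
    have : l * Complex.normSq (uu j) ≤ 0.000069 * 92.16 := mul_le_mul hl2 this (Complex.normSq_nonneg _) (by norm_num)
    linarith

/-- Strong version. -/
lemma TT_str (ε R : ℝ) (hε : 0 < ε) (hR : 0 < R) (z : ℂ) (l : ℝ) (hl : l = ε^2/R^2) (hl2 : l ≤ 0.000069)
    (hz : 0.969 * (1 - l * Complex.normSq z) ≤ z.re) (hs : l * Complex.normSq z < 1) : TT 1 ε R (-(ε * z)) ≤ 0 := by
  have hl0 : 0 ≤ l := by rw [hl]; positivity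
  have hz0 : 0 ≤ z.re := by linarith
  have h := TT_eq 1 ε R hε hR z l hl hl2 hz0 hs
  obtain ⟨d1, d2, d3, d4, d5, d6⟩ := TT_data z l
  have core := T_core z.re (Complex.normSq z) l _ rfl hl0 hl2 hz (by rw [Complex.normSq_apply]; nlinarith only [sq_nonneg z.im]) hs _ _ _ _ _ _ rfl rfl rfl rfl rfl rfl
  rw [← d3, ← d6, ← d1, ← d2, ← d4, ← d5] at core
  have pn := TT_pn z l hl0 hl2 hz0 hs
  rw [cc_sum] at h
  have := logs_str _ _ _ _ _ _ _ _ 1 (pn 0).1 (pn 1).1 (pn 2).1 (pn 3).1 (pn 0).2 (pn 1).2 (pn 2).2 (pn 3).2 one_pos (by rw [one_mul]; exact core)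
  rw [Real.log_one] at this
  linarith

lemma str1_num (l : ℝ) (hl0 : 0 ≤ l) (hl2 : l ≤ 0.000069) :
    180.3 * ((1 + 5 * 1 + 6.25) ^ 3 * ((1 + 5 * l * 1 + l * (l * 1) * 6.25 - l * (l * 1) * 42.1) ^ 2 + 168.4 * l ^ 2 * (1 + 2.5 * (l * 1)) ^ 2) *
      (1 + 19.2 * l * 1 + l * (l * 1) * 92.16)) ≤ ((1 + 5 * 1 + 6.25 - 42.1) ^ 2 + 168.4 * (1 + 2.5) ^ 2) * (1 + 19.2 * 1 + 92.16) * (1 + 5 * l * 1 + l * (l * 1) * 6.25) ^ 3 := by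
  have hl3 : l^2 ≤ 0.000069 * l := by nlinarith
  have b5 : 0 ≤ l^2 := sq_nonneg l
  have b2 : 0 ≤ 1 + 5 * l * 1 + l * (l * 1) * 6.25 - l * (l * 1) * 42.1 := by nlinarith
  have c1 : (1 + 5 * l * 1 + l * (l * 1) * 6.25 - l * (l * 1) * 42.1) ^ 2 + 168.4 * l ^ 2 * (1 + 2.5 * (l * 1)) ^ 2 ≤ 1 + 10.1 * l := by
    have b1 : 1 + 5 * l * 1 + l * (l * 1) * 6.25 - l * (l * 1) * 42.1 ≤ 1 + 5 * l := by nlinarith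
    have b3 := pow_le_pow_left₀ b2 b1 2
    have b4 : (1 + 2.5 * (l * 1)) ^ 2 ≤ 1.1 := by
      have := pow_le_pow_left₀ (a := 1 + 2.5 * (l * 1)) (b := 1.01) (by linarith) (by linarith) 2
      norm_num at this ⊢; linarith
    have b6 : l^2 * (1 + 2.5 * (l * 1)) ^ 2 ≤ l^2 * 1.1 := mul_le_mul_of_nonneg_left b4 b5
    nlinarith only [b3, b6, hl3, hl0]
  have c2 : 1 + 19.2 * l * 1 + l * (l * 1) * 92.16 ≤ 1 + 19.21 * l := by nlinarith only [hl3, hl0]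
  have c3 : 1 + 15 * l ≤ (1 + 5 * l * 1 + l * (l * 1) * 6.25) ^ 3 := by
    have := pow_le_pow_left₀ (a := 1 + 5 * l) (b := 1 + 5 * l * 1 + l * (l * 1) * 6.25) (by linarith) (by linarith) 3
    nlinarith only [this, hl0, b5, mul_nonneg hl0 b5]
  have c4 := mul_le_mul c1 c2 (by nlinarith) (by linarith)
  have c5 : (1 + 10.1 * l) * (1 + 19.21 * l) ≤ 1 + 29.33 * l := by nlinarith only [hl3, hl0]
  norm_num at c4 c3 c5 ⊢
  linarith

lemma TT_str1 (ε R : ℝ) (hε : 0 < ε) (hR : 0 < R) (l : ℝ) (hl : l = ε^2/R^2) (hl2 : l ≤ 0.000069) : TT 1 ε R (-ε) ≤ - (Real.log 180.3 / 2) := by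
  have hl0 : 0 ≤ l := by rw [hl]; positivity
  have h := TT_eq 1 ε R hε hR 1 l hl hl2 (by simp) (by simp; linarith)
  obtain ⟨d1, d2, d3, d4, d5, d6⟩ := TT_data 1 l
  have pn := TT_pn 1 l hl0 hl2 (by simp) (by simp; linarith)
  rw [cc_sum] at h
  rw [mul_one] at h
  have := logs_str _ _ _ _ _ _ _ _ 180.3 (pn 0).1 (pn 1).1 (pn 2).1 (pn 3).1 (pn 0).2 (pn 1).2 (pn 2).2 (pn 3).2 (by norm_num) ?_
  · linarith
  · rw [d3, d6, d1, d2, d4, d5]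
    simp only [map_one, Complex.one_re]
    exact str1_num l hl0 hl2

lemma TT_weak (ε R : ℝ) (hε : 0 < ε) (hR : 0 < R) (z : ℂ) (l : ℝ) (hl : l = ε^2/R^2) (hl2 : l ≤ 0.000069)
    (hz0 : 0 ≤ z.re) (hs : l * Complex.normSq z < 1) : TT 0 ε R (-(ε * z)) ≤ 0 := by
  have hl0 : 0 ≤ l := by rw [hl]; positivity
  have h := TT_eq 0 ε R hε hR z l hl hl2 hz0 hs
  obtain ⟨d1, d2, d3, d4, d5, d6⟩ := TT_data z l
  have pn := TT_pn z l hl0 hl2 hz0 hs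
  rw [cc_sum] at h
  have := logs_weak _ (Complex.normSq (z + uu 1)) (Complex.normSq (z + uu 2)) _ _ (Complex.normSq (1 + l * (starRingEnd ℂ) z * uu 1)) (Complex.normSq (1 + l * (starRingEnd ℂ) z * uu 2)) _ 1 (pn 0).1 (pn 3).1 (pn 0).2 (pn 3).2 one_pos ?_
  · rw [Real.log_one] at this
    linarith
  · rw [d1, d2, d4, d5]
    obtain ⟨s, hs'⟩ : ∃ s, s = Complex.normSq z := ⟨_, rfl⟩
    have hs0 : 0 ≤ s := by rw [hs']; exact Complex.normSq_nonneg _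
    rw [← hs'] at hs ⊢
    have e : (s + 19.2 * z.re + 92.16) * (1 + 5 * l * z.re + l * (l * s) * 6.25) - 1 * ((s + 5 * z.re + 6.25) * (1 + 19.2 * l * z.re + l * (l * s) * 92.16))
      = (1 - l * s) * ((14.2 * z.re + 85.91) * (1 - 6.25 * l) + l * (s + 5 * z.re + 6.25) * 85.91) := by
      ring
    have h1 : 0 ≤ 1 - l * s := by linarith
    have h2 : 0 ≤ 1 - 6.25 * l := by linarith
    have : 0 ≤ (1 - l * s) * ((14.2 * z.re + 85.91) * (1 - 6.25 * l) + l * (s + 5 * z.re + 6.25) * 85.91) := by positivity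
    linarith

lemma TT_weak1 (ε R : ℝ) (hε : 0 < ε) (hR : 0 < R) (l : ℝ) (hl : l = ε^2/R^2) (hl2 : l ≤ 0.000069) : TT 0 ε R (-ε) ≤ - (Real.log 9.16 / 2) := by
  have hl0 : 0 ≤ l := by rw [hl]; positivity
  have h := TT_eq 0 ε R hε hR 1 l hl hl2 (by simp) (by simp; linarith)
  obtain ⟨d1, d2, d3, d4, d5, d6⟩ := TT_data 1 l
  have pn := TT_pn 1 l hl0 hl2 (by simp) (by simp; linarith)
  rw [cc_sum] at h
  rw [mul_one] at h
  have := logs_weak _ (Complex.normSq (1 + uu 1)) (Complex.normSq (1 + uu 2)) _ _ (Complex.normSq (1 + l * (starRingEnd ℂ) 1 * uu 1)) (Complex.normSq (1 + l * (starRingEnd ℂ) 1 * uu 2)) _ 9.16 (pn 0).1 (pn 3).1 (pn 0).2 (pn 3).2 (by norm_num) ?_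
  · linarith
  · rw [d1, d2, d4, d5]
    simp only [map_one, Complex.one_re]
    have hl3 : l^2 ≤ 0.000069 * l := by nlinarith only [hl0, hl2]
    nlinarith only [hl3, hl0, hl2, sq_nonneg l]

end

section
open Finset

/-- the combined Poisson kernel. -/
noncomputable def KK (q ε : ℝ) (z : ℂ) : ℝ :=
  ∑ j ∈ range 4, cc q j * poissonKernel 0 (ε * uu j) z

lemma geo5 (W : ℂ) (hW : ‖W‖ ≤ 0.08) :
    |((1 + W) / (1 - W)).re - (1 + 2 * (W.re + (W^2).re + (W^3).re + (W^4).re))| ≤ 2 / 0.92 * ‖W‖^5 := by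
  have h1 : 0.92 ≤ ‖1 - W‖ := by
    have := norm_sub_norm_le (1:ℂ) W
    rw [norm_one] at this; linarith
  have h0 : 1 - W ≠ 0 := by
    intro h; rw [h, norm_zero] at h1; norm_num at h1
  have e : (1 + W) / (1 - W) = 1 + 2 * (W + W^2 + W^3 + W^4) + 2 * W^5 / (1 - W) := by
    field_simp; ring
  have e2 : ((1 + W) / (1 - W)).re - (1 + 2 * (W.re + (W^2).re + (W^3).re + (W^4).re)) = (2 * W^5 / (1 - W)).re := by
    rw [e]; simp only [Complex.add_re, Complex.one_re, Complex.re_ofNat, Complex.im_ofNat, Complex.mul_re, zero_mul, sub_zero]; ring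
  rw [e2]
  refine (Complex.abs_re_le_norm _).trans ?_
  rw [norm_div, norm_mul, norm_pow, Complex.norm_ofNat, div_mul_eq_mul_div]
  gcongr

lemma poisson_eq (ε : ℝ) (u z : ℂ) (hz : z ≠ 0) :
    poissonKernel 0 (ε * u) z = ((1 + ε * u / z) / (1 - ε * u / z)).re := by
  rw [poissonKernel_eq_re_herglotzRieszKernel, Function.comp_apply, herglotzRieszKernel_def, sub_zero, sub_zero]
  congr 1
  rw [← mul_div_mul_left (1 + ε * u / z) (1 - ε * u / z) hz, mul_add, mul_sub, mul_one, mul_div_cancel₀ _ hz]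

lemma uu0 : uu 0 = 5/2 := by
  unfold uu; rw [if_pos rfl]; apply Complex.ext <;> norm_num
lemma uu3 : uu 3 = 48/5 := by
  unfold uu; norm_num; apply Complex.ext <;> norm_num
lemma uu1 : uu 1 = 5/2 + (√42.1 : ℝ) * Complex.I := by
  unfold uu; norm_num; apply Complex.ext <;> norm_num
lemma uu2 : uu 2 = 5/2 - (√42.1 : ℝ) * Complex.I := by
  unfold uu; norm_num; apply Complex.ext <;> norm_num

lemma sqWI : ((√42.1 : ℝ) * Complex.I)^2 = -42.1 := by
  rw [mul_pow, Complex.I_sq, ← Complex.ofReal_pow, sqW]; norm_num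

lemma uu_n0 : ‖uu 0‖^5 ≤ 98 := by
  rw [uu0]; norm_num
lemma uu_n3 : ‖uu 3‖^5 ≤ 81538 := by
  rw [uu3]; norm_num
lemma nrm5 (x : ℝ) (h0 : 0 ≤ x) (h : x^2 ≤ 48.35) : x^5 ≤ 16260 := by
  have h1 : x ≤ 6.9535 := by nlinarith
  calc x^5 ≤ 6.9535^5 := by gcongr
    _ ≤ 16260 := by norm_num
lemma uu_n1 : ‖uu 1‖^5 ≤ 16260 := by
  apply nrm5 _ (norm_nonneg _)
  rw [← Complex.normSq_eq_norm_sq]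
  have := sqW
  unfold uu
  simp only [one_ne_zero, OfNat.ofNat_ne_zero, OfNat.ofNat_ne_one, if_true, if_false, Complex.normSq_mk]
  nlinarith only [this]
lemma uu_n2 : ‖uu 2‖^5 ≤ 16260 := by
  apply nrm5 _ (norm_nonneg _)
  rw [← Complex.normSq_eq_norm_sq]
  have := sqW
  unfold uu
  simp only [one_ne_zero, OfNat.ofNat_ne_zero, OfNat.ofNat_ne_one, if_true, if_false, Complex.normSq_mk]
  nlinarith only [this]

lemma uu_norm (j : ℕ) : ‖uu j‖ ≤ 9.6 := by
  have := uu_normSq j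
  rw [Complex.normSq_eq_norm_sq] at this
  nlinarith [norm_nonneg (uu j)]

lemma mom (q : ℝ) (y : ℂ) (k : ℕ) (M : ℝ) (hM : (1 + 2 * q) * (uu 0)^k - q * (uu 1)^k - q * (uu 2)^k - (uu 3)^k = M) :
    ∑ j ∈ range 4, cc q j * ((y * uu j)^k).re = M * (y^k).re := by
  rw [cc_sum, ← Complex.re_ofReal_mul M, ← hM]
  simp only [mul_pow]
  rw [← Complex.re_ofReal_mul (1+2*q), ← Complex.re_ofReal_mul q, ← Complex.re_ofReal_mul q, ← Complex.sub_re, ← Complex.sub_re, ← Complex.sub_re]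
  congr 1
  push_cast; ring

lemma mom1 (q : ℝ) : (1 + 2 * (q:ℂ)) * (uu 0)^1 - q * (uu 1)^1 - q * (uu 2)^1 - (uu 3)^1 = ((-7.1 : ℝ) : ℂ) := by
  rw [uu0, uu1, uu2, uu3]; push_cast; ring
lemma mom2 (q : ℝ) : (1 + 2 * (q:ℂ)) * (uu 0)^2 - q * (uu 1)^2 - q * (uu 2)^2 - (uu 3)^2 = ((-85.91+84.2*q : ℝ) : ℂ) := by
  rw [uu0, uu1, uu2, uu3]
  have := sqWI
  generalize ((√42.1 : ℝ) : ℂ) * Complex.I = X at *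
  push_cast; linear_combination (-2*q) * this
lemma mom3 (q : ℝ) : (1 + 2 * (q:ℂ)) * (uu 0)^3 - q * (uu 1)^3 - q * (uu 2)^3 - (uu 3)^3 = ((-869.111+631.5*q : ℝ) : ℂ) := by
  rw [uu0, uu1, uu2, uu3]
  have := sqWI
  generalize ((√42.1 : ℝ) : ℂ) * Complex.I = X at *
  push_cast; linear_combination (-15*q) * this
lemma mom4 (q : ℝ) : (1 + 2 * (q:ℂ)) * (uu 0)^4 - q * (uu 1)^4 - q * (uu 2)^4 - (uu 3)^4 = ((-8454.4031-387.32*q : ℝ) : ℂ) := by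
  rw [uu0, uu1, uu2, uu3]
  have := sqWI
  generalize ((√42.1 : ℝ) : ℂ) * Complex.I = X at *
  push_cast; linear_combination (-75*q - 2 * q * (X^2 - 42.1)) * this

lemma re_pows (y : ℂ) (c : ℝ) (hc : y.re = c) (hy : Complex.normSq y = 1) :
    (y^2).re = 2*c^2-1 ∧ (y^3).re = 4*c^3-3*c ∧ (y^4).re = 8*c^4-8*c^2+1 := by
  rw [Complex.normSq_apply] at hy
  have h : y.im * y.im = 1 - c*c := by rw [← hc]; linarith
  have e2 : (y^2).re = 2*c^2-1 := by
    rw [sq, Complex.mul_re, h, hc]; ring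
  have i2 : (y^2).im = 2*c*y.im := by
    rw [sq, Complex.mul_im, hc]; ring
  refine ⟨e2, ?_, ?_⟩
  · rw [pow_succ, Complex.mul_re, e2, i2, hc, mul_assoc, h]; ring
  · rw [show y^4 = y^2*y^2 by ring, Complex.mul_re, e2, i2]
    linear_combination (-4*c^2) * h

lemma KK_approx (q ε R : ℝ) (hq : 0 ≤ q) (hq1 : q ≤ 1) (z : ℂ) (hR : 0 < R) (hz : ‖z‖ = R) (c e : ℝ) (hc : c = z.re / R)
    (he : e = ε / R) (hε : 0 < ε) (he2 : e ≤ 0.0081) :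
    |KK q ε z - 2 * (-7.1*e*c + (-85.91+84.2*q)*e^2*(2*c^2-1) + (-869.111+631.5*q)*e^3*(4*c^3-3*c) + (-8454.4031-387.32*q)*e^4*(8*c^4-8*c^2+1))|
      ≤ 248600*e^5 := by
  have hz0 : z ≠ 0 := by rw [← norm_pos_iff, hz]; exact hR
  have he0 : 0 < e := by rw [he]; positivity
  set y : ℂ := ε / z with hy
  have hy' : y = e * (starRingEnd ℂ z / R) := by
    have : (starRingEnd ℂ) z * z = R^2 := by
      rw [mul_comm, Complex.mul_conj, Complex.normSq_eq_norm_sq, hz]; push_cast; rfl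
    have hR' : (R:ℂ) ≠ 0 := by exact_mod_cast hR.ne'
    rw [hy, he]; push_cast; field_simp; linear_combination (-(ε:ℂ)) * this
  set y0 : ℂ := starRingEnd ℂ z / R with hy0
  have hny0 : ‖y0‖ = 1 := by
    rw [hy0, norm_div, Complex.norm_conj, hz, Complex.norm_real, Real.norm_eq_abs, abs_of_pos hR, div_self hR.ne']
  have hre : y0.re = c := by
    rw [hy0, Complex.div_ofReal_re, Complex.conj_re, hc]
  obtain ⟨p2, p3, p4⟩ := re_pows y0 c hre (by rw [Complex.normSq_eq_norm_sq, hny0, one_pow])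
  have hyn : ‖y‖ = e := by
    rw [hy', norm_mul, hny0, mul_one, Complex.norm_real, Real.norm_eq_abs, abs_of_pos he0]
  have hyk (k : ℕ) : (y^k).re = e^k * (y0^k).re := by
    rw [hy', mul_pow, ← Complex.ofReal_pow, Complex.re_ofReal_mul]
  have hW (j : ℕ) : ‖y * uu j‖ ≤ 0.08 := by
    rw [norm_mul, hyn]
    have := uu_norm j
    have := norm_nonneg (uu j)
    nlinarith
  have hg (j : ℕ) := geo5 (y * uu j) (hW j)
  have hP (j : ℕ) : poissonKernel 0 (ε * uu j) z = ((1 + y * uu j) / (1 - y * uu j)).re := by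
    rw [poisson_eq ε _ _ hz0, hy]; congr 3 <;> ring
  have m1 := mom q y 1 _ (mom1 q)
  have m2 := mom q y 2 _ (mom2 q)
  have m3 := mom q y 3 _ (mom3 q)
  have m4 := mom q y 4 _ (mom4 q)
  rw [cc_sum, hyk] at m1 m2 m3 m4
  rw [p2] at m2
  rw [p3] at m3
  rw [p4] at m4
  simp only [pow_one, hre] at m1
  unfold KK
  rw [cc_sum, hP, hP, hP, hP]
  have g0 := hg 0
  have g1 := hg 1
  have g2 := hg 2
  have g3 := hg 3
  rw [norm_mul, hyn, mul_pow e] at g0 g1 g2 g3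
  have n0 := uu_n0
  have n1 := uu_n1
  have n2 := uu_n2
  have n3 := uu_n3
  set G0 := ((1 + y * uu 0) / (1 - y * uu 0)).re - (1 + 2 * ((y * uu 0).re + ((y * uu 0)^2).re + ((y * uu 0)^3).re + ((y * uu 0)^4).re)) with hG0
  set G1 := ((1 + y * uu 1) / (1 - y * uu 1)).re - (1 + 2 * ((y * uu 1).re + ((y * uu 1)^2).re + ((y * uu 1)^3).re + ((y * uu 1)^4).re)) with hG1
  set G2 := ((1 + y * uu 2) / (1 - y * uu 2)).re - (1 + 2 * ((y * uu 2).re + ((y * uu 2)^2).re + ((y * uu 2)^3).re + ((y * uu 2)^4).re)) with hG2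
  set G3 := ((1 + y * uu 3) / (1 - y * uu 3)).re - (1 + 2 * ((y * uu 3).re + ((y * uu 3)^2).re + ((y * uu 3)^3).re + ((y * uu 3)^4).re)) with hG3
  have E : (1 + 2 * q) * ((1 + y * uu 0) / (1 - y * uu 0)).re - q * ((1 + y * uu 1) / (1 - y * uu 1)).re - q * ((1 + y * uu 2) / (1 - y * uu 2)).re - ((1 + y * uu 3) / (1 - y * uu 3)).re - 2 * (-7.1*e*c + (-85.91+84.2*q)*e^2*(2*c^2-1) + (-869.111+631.5*q)*e^3*(4*c^3-3*c) + (-8454.4031-387.32*q)*e^4*(8*c^4-8*c^2+1)) = (1+2*q)*G0 - q*G1 - q*G2 - G3 := by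
    rw [hG0, hG1, hG2, hG3]
    linear_combination (2:ℝ) * m1 + (2:ℝ) * m2 + (2:ℝ)*m3 + (2:ℝ)*m4
  rw [E]
  clear E hG0 hG1 hG2 hG3 m1 m2 m3 m4
  have e5 : 0 ≤ e^5 := by positivity
  have k0 : |G0| ≤ 2/0.92*(e^5*98) := g0.trans (by gcongr)
  have k1 : |G1| ≤ 2/0.92*(e^5*16260) := g1.trans (by gcongr)
  have k2 : |G2| ≤ 2/0.92*(e^5*16260) := g2.trans (by gcongr)
  have k3 : |G3| ≤ 2/0.92*(e^5*81538) := g3.trans (by gcongr)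
  have : |(1+2*q)*G0 - q*G1 - q*G2 - G3| ≤ 3 * |G0| + |G1| + |G2| + |G3| := by
    have t1 := abs_sub ((1+2*q)*G0 - q*G1 - q*G2) G3
    have t2 := abs_sub ((1+2*q)*G0 - q*G1) (q*G2)
    have t3 := abs_sub ((1+2*q)*G0) (q*G1)
    rw [abs_mul, abs_mul, abs_of_nonneg (by linarith : 0 ≤ 1+2*q), abs_of_nonneg hq] at t3
    rw [abs_mul q, abs_of_nonneg hq] at t2
    have u0 : (1+2*q)*|G0| ≤ 3*|G0| := by gcongr; linarith
    have u1 : q*|G1| ≤ 1*|G1| := by gcongr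
    have u2 : q*|G2| ≤ 1*|G2| := by gcongr
    linarith
  linarith

lemma KK_key (A B e : ℝ) (he : 0 < e) (e3 : e^3 ≤ 0.0081^2*e) (es : e^2 ≤ 0.0081*e) (hA : A ≤ -1.7) (hB : B ≤ 0) (hB2 : -870 ≤ B) (d : ℝ) (d0 : 0 ≤ d) (d1 : d ≤ 1) : -(2*B*e^3*(4*d^3-3*d)) ≤ -2*B*0.0081^2*(e*d) ∧ -2*870*3*0.0081^2*(e*d) ≤ -(2*B*e^3*(4*d^3-3*d)) ∧ -(2*A*e^2*(2*d^2)) ≤ -4*A*0.0081*(e*d)   := by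
  have e30 : 0 ≤ e^3 := by positivity
  have ds : d^2 ≤ 1 := by nlinarith only [d0, d1]
  have dq : 4*d^3-3*d ≤ d := by nlinarith only [d0, ds]
  have dq2 : -(3*d) ≤ 4*d^3-3*d := by linarith only [pow_nonneg d0 3]
  have f1 : 0 ≤ -(2*B) := by linarith
  refine ⟨?_, ?_, ?_⟩
  · calc -(2*B*e^3*(4*d^3-3*d)) = (-(2*B))*e^3*(4*d^3-3*d) := by ring
      _ ≤ (-(2*B))*e^3*d := by gcongr
      _ ≤ (-(2*B))*(0.0081^2*e)*d := by gcongr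
      _ = _ := by ring
  · calc -(2*B*e^3*(4*d^3-3*d)) = (-(2*B))*e^3*(4*d^3-3*d) := by ring
      _ ≥ (-(2*B))*e^3*(-(3*d)) := by gcongr
      _ = -((-(2*B))*e^3*(3*d)) := by ring
      _ ≥ -(1740*(0.0081^2*e)*(3*d)) := by gcongr; linarith
      _ = _ := by ring
  · have f2 : 0 ≤ -(4*A) := by linarith
    calc -(2*A*e^2*(2*d^2)) = (-(4*A))*e^2*d^2 := by ring
      _ ≤ (-(4*A))*(0.0081*e)*d := by
        gcongr
        nlinarith only [d0, d1]
      _ = _ := by ring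

lemma KK_bounds (A B C Dd e c K : ℝ) (hK : |K - 2*(-7.1*e*c + A*e^2*(2*c^2-1) + B*e^3*(4*c^3-3*c) + C*e^4*(8*c^4-8*c^2+1))| ≤ 248600*e^5)
    (he : 0 < e) (he2 : e ≤ 0.0081) (hc : |c| ≤ 1) (al ga : ℝ)
    (hA : A ≤ -1.7) (hA2 : -86 ≤ A) (hB : B ≤ 0) (hB2 : -870 ≤ B) (hC : C ≤ 0) (hC2 : -8850 ≤ C)
    (hal : 14.2 - 4*A*0.0081 - 2 * B * 0.0081^2 ≤ al) (hga : -2*A + 1.31 ≤ ga) :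
    -(al*e*max c 0) ≤ K ∧ K ≤ al*e*max (-c) 0 + ga*e^2 := by
  obtain ⟨h1, h2⟩ := abs_le.1 hK
  obtain ⟨c1, c2⟩ := abs_le.1 hc
  have e5 : 248600*e^5 ≤ 0.14*e^2 := by
    have : e^3 ≤ 0.0081^3 := by gcongr
    calc 248600*e^5 = 248600 * e^2 * e^3 := by ring
      _ ≤ 248600 * e^2 * 0.0081^3 := by gcongr
      _ ≤ _ := by nlinarith only [sq_nonneg e]
  have e4 : e^4 ≤ 0.0081^2*e^2 := by
    have : e^2 ≤ 0.0081^2 := by gcongr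
    nlinarith only [this, sq_nonneg e]
  have e2 : 0 < e^2 := by positivity
  have cs : c^2 ≤ 1 := by nlinarith only [c1, c2]
  have P1 : 8*c^4-8*c^2+1 ≤ 1 := by nlinarith only [cs, sq_nonneg c]
  have P2 : -1 ≤ 8*c^4-8*c^2+1 := by nlinarith only [sq_nonneg (2*c^2-1)]
  have e4' : 0 ≤ e^4 := by positivity
  have C1 : |2*C*e^4*(8*c^4-8*c^2+1)| ≤ 1.17*e^2 := by
    rw [abs_mul, abs_mul, abs_of_nonneg e4', abs_of_nonpos (by linarith : 2*C ≤ 0)]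
    have : |8*c^4-8*c^2+1| ≤ 1 := abs_le.2 ⟨P2, P1⟩
    calc -(2*C)*e^4*|8*c^4-8*c^2+1| ≤ 17700 * (0.0081^2*e^2)*1 := by gcongr; linarith
      _ ≤ _ := by nlinarith only [e2]
  obtain ⟨C2, C3⟩ := abs_le.1 C1
  have h3 : 2 * (-7.1*e*c + A*e^2*(2*c^2-1) + B*e^3*(4*c^3-3*c) + C*e^4*(8*c^4-8*c^2+1)) = -14.2*e*c + 2*A*e^2*(2*c^2-1) + 2*B*e^3*(4*c^3-3*c) + 2*C*e^4*(8*c^4-8*c^2+1) := by ring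
  rw [h3] at h1 h2
  generalize 2*C*e^4*(8*c^4-8*c^2+1) = X at h1 h2 C2 C3
  clear C1 P1 P2 h3 hK
  have es : e^2 ≤ 0.0081*e := by nlinarith only [he, he2]
  have e3 : e^3 ≤ 0.0081^2*e := by
    have : e^2 ≤ 0.0081^2 := by gcongr
    nlinarith only [this, he]
  have e30 : 0 ≤ e^3 := by positivity
  have key := KK_key A B e he e3 es hA hB hB2
  have Ae : -(2*A)*e^2 ≥ 3.4*e^2 := by
    gcongr; linarith
  have gae : (-2*A+1.31)*e^2 ≤ ga*e^2 := by gcongr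
  have Ac : 0 ≤ -(2*A*e^2*(2*c^2)) := by
    have : 0 ≤ (-A)*(e^2*(4*c^2)) := mul_nonneg (by linarith) (by positivity)
    linarith
  rcases le_total 0 c with c0 | c0
  · obtain ⟨k1, k2, k3⟩ := key c c0 c2
    have ec : 0 ≤ e*c := by positivity
    have alc : (14.2 - 4*A*0.0081 - 2 * B * 0.0081^2)*(e*c) ≤ al*(e*c) := by gcongr
    rw [max_eq_left c0, max_eq_right (by linarith)]
    constructor <;> linarith
  · obtain ⟨k1, k2, k3⟩ := key (-c) (by linarith) (by linarith)
    have ec : 0 ≤ e*(-c) := mul_nonneg he.le (by linarith)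
    have alc : (14.2 - 4*A*0.0081 - 2 * B * 0.0081^2)*(e*(-c)) ≤ al*(e*(-c)) := by gcongr
    have Bp : 0 ≤ -B*(e*(-c)) := mul_nonneg (by linarith) ec
    have Ap : 0 ≤ (86+A)*(e*(-c)) := mul_nonneg (by linarith) ec
    have Ap2 : 0 ≤ (-A)*(e*(-c)) := mul_nonneg (by linarith) ec
    rw [show 4*(-c)^3-3*(-c) = -(4*c^3-3*c) by ring] at k1 k2
    rw [neg_sq] at k3
    rw [max_eq_right c0, max_eq_left (by linarith)]
    constructor <;> linarith

lemma KK_strong (ε R : ℝ) (z : ℂ) (hR : 0 < R) (hz : ‖z‖ = R) (hε : 0 < ε) (he2 : ε / R ≤ 0.0081) :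
    -(14.3*(ε/R)*max (z.re/R) 0) ≤ KK 1 ε z ∧ KK 1 ε z ≤ 14.3*(ε/R)*max (-(z.re/R)) 0 + 4.9*(ε/R)^2 := by
  have h := KK_approx 1 ε R zero_le_one le_rfl z hR hz _ _ rfl rfl hε he2
  have hc : |z.re / R| ≤ 1 := by
    rw [abs_div, abs_of_pos hR, div_le_one hR, ← hz]; exact Complex.abs_re_le_norm z
  refine KK_bounds _ _ _ 0 _ _ _ h (by positivity) he2 hc _ _ ?_ ?_ ?_ ?_ ?_ ?_ ?_ ?_ <;> norm_num

lemma KK_weak (ε R : ℝ) (z : ℂ) (hR : 0 < R) (hz : ‖z‖ = R) (hε : 0 < ε) (he2 : ε / R ≤ 0.0081) :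
    -(18*(ε/R)*max (z.re/R) 0) ≤ KK 0 ε z ∧ KK 0 ε z ≤ 18*(ε/R)*max (-(z.re/R)) 0 + 180*(ε/R)^2 := by
  have h := KK_approx 0 ε R le_rfl zero_le_one z hR hz _ _ rfl rfl hε he2
  have hc : |z.re / R| ≤ 1 := by
    rw [abs_div, abs_of_pos hR, div_le_one hR, ← hz]; exact Complex.abs_re_le_norm z
  refine KK_bounds _ _ _ 0 _ _ _ h (by positivity) he2 hc _ _ ?_ ?_ ?_ ?_ ?_ ?_ ?_ ?_ <;> norm_num

end

section
open Finset

lemma arc_den (w : ℂ) (hw : ‖w‖ < 1) : 0 < Complex.normSq (1 - w * Complex.I) := by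
  rw [Complex.normSq_pos]
  intro h
  have h2 : w * Complex.I = 1 := by linear_combination -h
  have := congrArg norm h2
  rw [norm_mul, Complex.norm_I, mul_one, norm_one] at this
  linarith

lemma arc_Q (w : ℂ) : ((1 + w * Complex.I) / (1 - w * Complex.I)).re = (1 - ‖w‖^2) / Complex.normSq (1 - w * Complex.I) ∧
    ((1 + w * Complex.I) / (1 - w * Complex.I)).im = 2 * w.re / Complex.normSq (1 - w * Complex.I) := by
  rw [← Complex.normSq_eq_norm_sq, Complex.div_re, Complex.div_im, ← add_div, ← sub_div, Complex.normSq_apply w]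
  constructor
  · congr 1; simp; ring
  · congr 1; simp; ring

lemma arc_Qpos (w : ℂ) (hw : ‖w‖ < 1) : 0 < ((1 + w * Complex.I) / (1 - w * Complex.I)).re := by
  rw [(arc_Q w).1]
  apply div_pos _ (arc_den w hw)
  nlinarith [norm_nonneg w]

lemma arc_re (w : ℂ) (hw : ‖w‖ < 1) : (Complex.arctan w).re = Real.arctan (2 * w.re / (1 - ‖w‖^2)) / 2 := by
  have hp := arc_Qpos w hw
  have hd := arc_den w hw
  have hq := arc_Q w
  have e : (Complex.arctan w).re = ((1 + w * Complex.I) / (1 - w * Complex.I)).arg / 2 := by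
    unfold Complex.arctan
    generalize (1 + w * Complex.I) / (1 - w * Complex.I) = Q
    rw [show -Complex.I / 2 * Complex.log Q = ((1/2:ℝ):ℂ) * (-(Complex.I * Complex.log Q)) by push_cast; ring, Complex.re_ofReal_mul]
    simp [Complex.log_im]; ring
  rw [e]
  have ha := Complex.abs_arg_lt_pi_div_two_iff.2 (Or.inl hp)
  rw [abs_lt] at ha
  rw [← Real.arctan_tan ha.1 ha.2, Complex.tan_arg, hq.1, hq.2, div_div_div_cancel_right₀ hd.ne']

lemma arc_im (w : ℂ) (R : ℝ) (hw : ‖w‖ ≤ R) (hR : R ≤ 0.9995) : |(Complex.arctan w).im| ≤ 4.2 := by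
  have e : (Complex.arctan w).im = -(Real.log ‖(1 + w * Complex.I) / (1 - w * Complex.I)‖ / 2) := by
    unfold Complex.arctan
    generalize (1 + w * Complex.I) / (1 - w * Complex.I) = Q
    rw [show -Complex.I / 2 * Complex.log Q = ((1/2:ℝ):ℂ) * (-(Complex.I * Complex.log Q)) by push_cast; ring, Complex.im_ofReal_mul]
    simp [Complex.log_re]; ring
  rw [e, abs_neg, abs_div, abs_two]
  have n1 : ‖w * Complex.I‖ ≤ 0.9995 := by rw [norm_mul, Complex.norm_I, mul_one]; linarith
  have a1 : ‖1 + w * Complex.I‖ ≤ 1.9995 := by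
    have := norm_add_le 1 (w * Complex.I); rw [norm_one] at this; linarith
  have a2 : ‖1 - w * Complex.I‖ ≤ 1.9995 := by
    have := norm_sub_le 1 (w * Complex.I); rw [norm_one] at this; linarith
  have a3 : 0.0005 ≤ ‖1 - w * Complex.I‖ := by
    have := norm_sub_norm_le 1 (w * Complex.I); rw [norm_one] at this; linarith
  have a4 : 0.0005 ≤ ‖1 + w * Complex.I‖ := by
    have := norm_sub_norm_le 1 (-(w * Complex.I)); rw [norm_one, norm_neg, sub_neg_eq_add] at this; linarith
  have hexp : (3999:ℝ) ≤ Real.exp 8.4 := exp_lb 3999 84 10 (by norm_num) (by norm_num) (by norm_num)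
  have hl : Real.log 3999 ≤ 8.4 := by rw [Real.log_le_iff_le_exp (by norm_num)]; exact hexp
  rw [norm_div]
  generalize ‖1 - w * Complex.I‖ = B at *
  generalize ‖1 + w * Complex.I‖ = A at *
  have b0 : 0 < B := by linarith
  have b1 : A / B ≤ 3999 := by rw [div_le_iff₀ b0]; linarith
  have b2 : 3999⁻¹ ≤ A / B := by rw [le_div_iff₀ b0]; linarith
  have b3 : 0 < A / B := by have : 0 < A := by linarith
                            positivity
  have l1 : Real.log (A/B) ≤ Real.log 3999 := Real.log_le_log b3 b1
  have l2 : Real.log (3999⁻¹) ≤ Real.log (A/B) := Real.log_le_log (by norm_num) b2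
  rw [Real.log_inv] at l2
  rw [div_le_iff₀ (by norm_num), abs_le]; constructor <;> linarith

lemma arc_an (w : ℂ) (hw : ‖w‖ < 1) : AnalyticAt ℂ Complex.arctan w := by
  have hd : 1 - w * Complex.I ≠ 0 := Complex.normSq_pos.1 (arc_den w hw)
  have h1 : AnalyticAt ℂ (fun z : ℂ => (1 + z * Complex.I) / (1 - z * Complex.I)) w := by
    refine AnalyticAt.fun_div (f := fun z : ℂ => 1 + z * Complex.I) (g := fun z : ℂ => 1 - z * Complex.I) ?_ ?_ hd <;> fun_prop
  have h2 := h1.clog (Or.inl (arc_Qpos w hw))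
  unfold Complex.arctan
  exact analyticAt_const.mul h2

lemma arc_tan (w : ℂ) (hw : ‖w‖ < 1) : Complex.tan (Complex.arctan w) = w := by
  apply Complex.tan_arctan
  · rintro rfl; simp at hw
  · rintro rfl; simp at hw

lemma arc_conj (w : ℂ) (hw : ‖w‖ < 1) : Complex.arctan ((starRingEnd ℂ) w) = (starRingEnd ℂ) (Complex.arctan w) := by
  have hp := arc_Qpos w hw
  have hd : 1 - w * Complex.I ≠ 0 := Complex.normSq_pos.1 (arc_den w hw)
  have hw' : ‖(starRingEnd ℂ) w‖ < 1 := by rwa [Complex.norm_conj]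
  have hp' := arc_Qpos _ hw'
  have hd' : 1 - (starRingEnd ℂ) w * Complex.I ≠ 0 := Complex.normSq_pos.1 (arc_den _ hw')
  have hd'' : 1 + (starRingEnd ℂ) w * Complex.I ≠ 0 := by
    have := (map_ne_zero (starRingEnd ℂ)).2 hd
    simpa using this
  unfold Complex.arctan
  have e : (starRingEnd ℂ) ((1 + w * Complex.I) / (1 - w * Complex.I)) = ((1 + (starRingEnd ℂ) w * Complex.I) / (1 - (starRingEnd ℂ) w * Complex.I))⁻¹ := by
    rw [inv_div, map_div₀]; simp; ring
  have hne : ∀ Q : ℂ, 0 < Q.re → Q.arg ≠ Real.pi := by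
    intro Q hQ h
    have := Complex.abs_arg_lt_pi_div_two_iff.2 (Or.inl hQ)
    rw [h, abs_of_pos Real.pi_pos] at this
    linarith [Real.pi_pos]
  rw [map_mul, ← Complex.log_conj _ (hne _ hp), e, Complex.log_inv _ (hne _ hp')]
  have : (starRingEnd ℂ) (-Complex.I / 2) = Complex.I / 2 := by rw [map_div₀, map_neg, Complex.conj_I, neg_neg, Complex.conj_ofNat]
  rw [this]; ring

lemma log3 (z : ℂ) (hz : ‖z‖ ≤ 0.1) : ‖Complex.log (1 + z) - (z - z^2/2)‖ ≤ ‖z‖^3 / 2.7 := by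
  have h := Complex.norm_log_sub_logTaylor_le 2 (z := z) (by linarith)
  have e : Complex.logTaylor (2+1) z = z - z^2/2 := by
    simp [Complex.logTaylor_succ, Complex.logTaylor_zero]; ring
  rw [e] at h
  refine h.trans ?_
  have : (1 - ‖z‖)⁻¹ ≤ 1/0.9 := by
    rw [inv_eq_one_div]; apply one_div_le_one_div_of_le <;> linarith
  calc ‖z‖^(2+1) * (1 - ‖z‖)⁻¹ / ((2:ℕ) + 1) ≤ ‖z‖^(2+1) * (1/0.9) / ((2:ℕ) + 1) := by gcongr
    _ = _ := by push_cast; ring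

lemma arc_approx (w : ℂ) (hw : ‖w‖ ≤ 0.1) : ‖Complex.arctan w - w‖ ≤ ‖w‖^3 / 2.7 := by
  have h0 := Complex.hasSum_arctan_aux (z := w) (by linarith)
  have n1 : ‖w * Complex.I‖ = ‖w‖ := by rw [norm_mul, Complex.norm_I, mul_one]
  have h1 := log3 (w * Complex.I) (by rw [n1]; exact hw)
  have h2 := log3 (-(w * Complex.I)) (by rw [norm_neg, n1]; exact hw)
  rw [norm_neg, n1] at h2
  rw [n1] at h1
  unfold Complex.arctan
  rw [← h0, sub_eq_add_neg 1]
  have e : -Complex.I / 2 * (Complex.log (1 + w * Complex.I) + -Complex.log (1 + -(w * Complex.I))) - w = -Complex.I / 2 * ((Complex.log (1 + w * Complex.I) - (w * Complex.I - (w * Complex.I)^2/2)) - (Complex.log (1 + -(w * Complex.I)) - (-(w * Complex.I) - (-(w * Complex.I))^2/2))) := by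
    linear_combination (-w:ℂ) * Complex.I_mul_I
  rw [e, norm_mul, norm_div, norm_neg, Complex.norm_I, Complex.norm_ofNat]
  have := norm_sub_le (Complex.log (1 + w * Complex.I) - (w * Complex.I - (w * Complex.I)^2/2)) (Complex.log (1 + -(w * Complex.I)) - (-(w * Complex.I) - (-(w * Complex.I))^2/2))
  linarith

/-- conformal map of the disc to the strip. -/
noncomputable def ph (w : ℂ) : ℂ := ((1.4 / Real.pi : ℝ) : ℂ) * Complex.arctan w

lemma ph_re (w : ℂ) (hw : ‖w‖ < 1) : (ph w).re = 0.7 / Real.pi * Real.arctan (2 * w.re / (1 - ‖w‖^2)) := by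
  unfold ph; rw [Complex.re_ofReal_mul, arc_re w hw]; ring

lemma ph_re_lt (w : ℂ) (hw : ‖w‖ < 1) : (ph w).re < 0.35 ∧ -0.35 < (ph w).re := by
  have hp := Real.pi_pos
  rw [ph_re w hw, div_mul_eq_mul_div, div_lt_iff₀ hp, lt_div_iff₀ hp]
  have := Real.arctan_lt_pi_div_two (2 * w.re / (1 - ‖w‖^2))
  have := Real.neg_pi_div_two_lt_arctan (2 * w.re / (1 - ‖w‖^2))
  constructor <;> linarith

lemma ph_im (w : ℂ) (R : ℝ) (hw : ‖w‖ ≤ R) (hR : R ≤ 0.9995) : |(ph w).im| ≤ 2 := by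
  unfold ph; rw [Complex.im_ofReal_mul, abs_mul, abs_of_pos (div_pos (by norm_num) Real.pi_pos), div_mul_eq_mul_div, div_le_iff₀ Real.pi_pos]
  have := arc_im w R hw hR
  have := Real.pi_gt_d2
  linarith

lemma ph_an (w : ℂ) (hw : ‖w‖ < 1) : AnalyticAt ℂ ph w := analyticAt_const.mul (arc_an w hw)

lemma ph_inv (w : ℂ) (hw : ‖w‖ < 1) : w = Complex.tan (((Real.pi / 1.4 : ℝ):ℂ) * ph w) := by
  unfold ph
  rw [← mul_assoc, ← Complex.ofReal_mul, show Real.pi / 1.4 * (1.4 / Real.pi) = 1 by field_simp, Complex.ofReal_one, one_mul, arc_tan w hw]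

lemma ph_conj (w : ℂ) (hw : ‖w‖ < 1) : ph ((starRingEnd ℂ) w) = (starRingEnd ℂ) (ph w) := by
  unfold ph; rw [map_mul, arc_conj w hw, Complex.conj_ofReal]

lemma ph_real (x : ℝ) : ph x = ((1.4 / Real.pi * Real.arctan x : ℝ) : ℂ) := by
  unfold ph; rw [← Complex.ofReal_arctan]; push_cast; rfl

lemma arctan_le (x : ℝ) (hx : 0 ≤ x) : Real.arctan x ≤ x := by
  have := Real.le_tan (Real.arctan_nonneg.2 hx) (Real.arctan_lt_pi_div_two x)
  rwa [Real.tan_arctan] at this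

lemma arctan_ge (x : ℝ) (hx : 0 ≤ x) : x * (1 - x^2/2) ≤ Real.arctan x := by
  have h := Real.sin_le (Real.arctan_nonneg.2 hx)
  rw [Real.sin_arctan] at h
  refine le_trans ?_ h
  have hs : √(1+x^2) ≤ 1 + x^2/2 := by
    rw [Real.sqrt_le_left (by positivity)]; nlinarith [sq_nonneg (x^2)]
  have h0 : 0 < √(1+x^2) := by positivity
  rw [le_div_iff₀ h0, mul_assoc]
  rcases le_total (1 - x^2/2) 0 with h1 | h1
  · have : x * ((1 - x^2/2) * √(1+x^2)) ≤ 0 := mul_nonpos_of_nonneg_of_nonpos hx (mul_nonpos_of_nonpos_of_nonneg h1 h0.le)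
    linarith
  · have : (1 - x^2/2) * √(1+x^2) ≤ 1 := by
      calc (1 - x^2/2) * √(1+x^2) ≤ (1 - x^2/2) * (1 + x^2/2) := by gcongr
        _ ≤ 1 := by nlinarith [sq_nonneg (x^2)]
    nlinarith

lemma ph_zero (w : ℂ) (hw : ‖w‖ < 1) (ε : ℝ) (h0 : 0 < ε) (h1 : ε ≤ 0.01) (h : 0.97 * (1.4 / Real.pi * Real.arctan ε) ≤ -(ph w).re) :
    0.969 * (1 - ‖w‖^2) * ε ≤ -w.re := by
  have hp := Real.pi_pos
  have hd : 0 < 1 - ‖w‖^2 := by nlinarith [norm_nonneg w]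
  rw [ph_re w hw] at h
  have ha := arctan_ge ε h0.le
  have h2 : 0.97 * (2 * Real.arctan ε) ≤ - Real.arctan (2 * w.re / (1 - ‖w‖^2)) := by
    have : 0.97 * (1.4 / Real.pi * Real.arctan ε) = (0.97 * (2 * Real.arctan ε)) * (0.7 / Real.pi) := by ring
    rw [this, ← mul_neg, mul_comm (0.7 / Real.pi)] at h
    exact le_of_mul_le_mul_right h (by positivity)
  rw [← Real.arctan_neg] at h2
  have hpos : 0 ≤ Real.arctan ε := Real.arctan_nonneg.2 h0.le
  have h3 : 0 ≤ -(2 * w.re / (1 - ‖w‖^2)) := Real.arctan_nonneg.1 (le_trans (by positivity) h2)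
  have h4 := h2.trans (arctan_le _ h3)
  have h5 : 0.969 * ε ≤ 0.97 * Real.arctan ε := by nlinarith
  have h6 : 0.969 * ε ≤ -w.re / (1 - ‖w‖^2) := by
    have : -(2 * w.re / (1 - ‖w‖^2)) = 2 * (-w.re / (1 - ‖w‖^2)) := by ring
    linarith
  rw [le_div_iff₀ hd] at h6
  linarith

lemma ph_zero0 (w : ℂ) (hw : ‖w‖ < 1) (h : 0 ≤ -(ph w).re) : 0 ≤ -w.re := by
  have hp := Real.pi_pos
  have hd : 0 < 1 - ‖w‖^2 := by nlinarith [norm_nonneg w]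
  rw [ph_re w hw] at h
  by_contra! hc
  have : 0 < Real.arctan (2 * w.re / (1 - ‖w‖^2)) := Real.arctan_pos.2 (div_pos (by linarith) hd)
  have : 0 < 0.7 / Real.pi * Real.arctan (2 * w.re / (1 - ‖w‖^2)) := by positivity
  linarith

lemma inv_arctan (y : ℝ) (hy : 0 < y) : 1 / Real.arctan y ≤ 2 / Real.pi + 1 / y := by
  have hp := Real.pi_pos
  set θ := Real.arctan y with hθ
  have t0 : 0 < θ := Real.arctan_pos.2 hy
  have t1 : θ < Real.pi / 2 := Real.arctan_lt_pi_div_two y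
  have ht : Real.tan θ = y := Real.tan_arctan y
  have hs : 0 < Real.sin θ := Real.sin_pos_of_pos_of_lt_pi t0 (by linarith)
  have hc : 2 / Real.pi * (Real.pi / 2 - θ) ≤ Real.cos θ := by
    rw [← Real.sin_pi_div_two_sub]; exact Real.mul_le_sin (by linarith) (by linarith)
  have h1 : 1 / y = Real.cos θ / Real.sin θ := by rw [← ht, Real.tan_eq_sin_div_cos, one_div_div]
  rw [h1]
  have h2 : (2 / Real.pi * (Real.pi / 2 - θ)) / θ ≤ Real.cos θ / Real.sin θ := by
    have : 0 ≤ Real.cos θ := Real.cos_nonneg_of_neg_pi_div_two_le_of_le (by linarith) t1.le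
    exact div_le_div₀ this hc hs (Real.sin_le t0.le)
  have h3 : (2 / Real.pi * (Real.pi / 2 - θ)) / θ = 1 / θ - 2 / Real.pi := by field_simp
  linarith

lemma ph_low (z : ℂ) (R T : ℝ) (hz : ‖z‖ = R) (hR : 0.9985 ≤ R) (hR1 : R < 1) (hc : 0 < z.re) :
    -Real.log ‖riemannZeta (1 + ph z + T * Complex.I)‖ ≤ Real.log (27/7) + 0.0018 / (z.re / R) := by
  have hp := Real.pi_pos
  have hz1 : ‖z‖ < 1 := by rw [hz]; exact hR1
  have hR2 : 0 < 1 - R^2 := by nlinarith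
  have e := ph_re z hz1
  rw [hz] at e
  set y := 2 * z.re / (1 - R^2) with hy
  have hy0 : 0 < y := by positivity
  have ha : 0 < Real.arctan y := Real.arctan_pos.2 hy0
  set x := (ph z).re with hx
  have hx0 : 0 < x := by rw [e]; positivity
  have h := zeta_lower' x ((ph z).im + T) hx0 (ph_re_lt z hz1).1.le
  have e2 : (1:ℂ) + ph z + T * Complex.I = 1 + x + (((ph z).im + T : ℝ):ℂ) * Complex.I := by
    nth_rewrite 1 [← Complex.re_add_im (ph z)]; push_cast; ring
  rw [e2]
  refine h.trans ?_
  have h1 : 1 + 1 / x ≤ 27/7 * (1 + 0.0018 / (z.re / R)) := by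
    have h2 : 1 / x = Real.pi / 0.7 * (1 / Real.arctan y) := by
      rw [e]; field_simp
    have h3 := inv_arctan y hy0
    have h4 : Real.pi / 0.7 * (1 / Real.arctan y) ≤ Real.pi / 0.7 * (2 / Real.pi + 1 / y) := by gcongr
    have h5 : Real.pi / 0.7 * (2 / Real.pi + 1 / y) = 20/7 + Real.pi / 0.7 * (1 / y) := by
      rw [mul_add]; congr 1; field_simp; norm_num
    have h6 : Real.pi / 0.7 * (1 / y) = (Real.pi * (1 - R^2)/1.4) / z.re := by
      rw [hy, one_div_div, div_mul_div_comm, div_div]; congr 1; ring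
    have h7 : 27/7 * (1 + 0.0018 / (z.re / R)) = 27/7 + (27/7*0.0018 * R)/z.re := by field_simp
    have h8 : (Real.pi * (1 - R^2)/1.4) / z.re ≤ (27/7*0.0018 * R)/z.re := by
      apply div_le_div_of_nonneg_right _ hc.le
      have := Real.pi_lt_d2
      have q1 : Real.pi * (1 - R^2) ≤ 3.15 * (1 - R^2) := by gcongr
      have q2 : 1 - R^2 ≤ 0.003 := by nlinarith only [hR]
      have q3 : Real.pi * (1 - R^2) ≤ 0.00945 := q1.trans (by linarith only [q2])
      rw [div_le_iff₀ (by norm_num)]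
      refine q3.trans ?_
      linarith only [hR]
    rw [h2, h7]; linarith
  have h9 : 0 < z.re / R := by positivity
  calc Real.log (1 + 1/x) ≤ Real.log (27/7 * (1 + 0.0018 / (z.re / R))) := Real.log_le_log (by positivity) h1
    _ = Real.log (27/7) + Real.log (1 + 0.0018 / (z.re / R)) := Real.log_mul (by norm_num) (by positivity)
    _ ≤ _ := by
      have := Real.log_le_sub_one_of_pos (show 0 < 1 + 0.0018 / (z.re / R) by positivity)
      linarith

end

section
open Finset

lemma avg_max (A B C R : ℝ) (hR : 0 < R) :
    Real.circleAverage (fun z : ℂ => A * max (-(z.re / R)) 0 + B * max (z.re / R) 0 + C) 0 R = (A + B) / Real.pi + C := by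
  have hp := Real.pi_pos
  rw [Real.circleAverage_def]
  have e : ∀ θ : ℝ, (circleMap 0 R θ).re / R = Real.cos θ := by
    intro θ
    rw [circleMap_zero, Complex.re_ofReal_mul, Complex.exp_ofReal_mul_I_re]
    field_simp
  have e2 : ∀ x : ℝ, max (-x) 0 = max x 0 - x := by
    intro x
    rcases le_total 0 x with h | h
    · rw [max_eq_right (by linarith), max_eq_left h]; ring
    · rw [max_eq_left (by linarith), max_eq_right h]; ring
  have e3 : (fun θ : ℝ => A * max (-((circleMap 0 R θ).re / R)) 0 + B * max ((circleMap 0 R θ).re / R) 0 + C) = fun θ => ((A+B) * max (Real.cos θ) 0 - A * Real.cos θ) + C := by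
    funext θ; rw [e, e2]; ring
  rw [e3]
  have c1 : Continuous fun θ : ℝ => max (Real.cos θ) 0 := Real.continuous_cos.max continuous_const
  have hper : Function.Periodic (fun θ : ℝ => max (Real.cos θ) 0) (2 * Real.pi) := by
    intro θ; simp only [Real.cos_add_two_pi]
  have i1 : ∫ θ in (0:ℝ)..(2 * Real.pi), max (Real.cos θ) 0 = 2 := by
    have h := hper.intervalIntegral_add_eq 0 (-(Real.pi/2))
    rw [zero_add] at h
    rw [h, ← intervalIntegral.integral_add_adjacent_intervals (b := Real.pi/2) (c1.intervalIntegrable _ _) (c1.intervalIntegrable _ _)]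
    have h1 : ∫ θ in (-(Real.pi/2))..(Real.pi/2), max (Real.cos θ) 0 = ∫ θ in (-(Real.pi/2))..(Real.pi/2), Real.cos θ := by
      apply intervalIntegral.integral_congr
      intro θ hθ
      rw [Set.uIcc_of_le (by linarith)] at hθ
      exact max_eq_left (Real.cos_nonneg_of_neg_pi_div_two_le_of_le hθ.1 hθ.2)
    have h2 : ∫ θ in (Real.pi/2)..(-(Real.pi/2) + 2 * Real.pi), max (Real.cos θ) 0 = ∫ θ in (Real.pi/2)..(-(Real.pi/2) + 2 * Real.pi), (0:ℝ) := by
      apply intervalIntegral.integral_congr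
      intro θ hθ
      rw [Set.uIcc_of_le (by linarith)] at hθ
      exact max_eq_right (Real.cos_nonpos_of_pi_div_two_le_of_le hθ.1 (by linarith [hθ.2]))
    rw [h1, h2, integral_cos, intervalIntegral.integral_zero, Real.sin_neg, Real.sin_pi_div_two]; norm_num
  rw [intervalIntegral.integral_add ((by fun_prop : Continuous _).intervalIntegrable _ _) (continuous_const.intervalIntegrable _ _),
    intervalIntegral.integral_sub ((by fun_prop : Continuous _).intervalIntegrable _ _) ((by fun_prop : Continuous _).intervalIntegrable _ _),
    intervalIntegral.integral_const_mul, intervalIntegral.integral_const_mul, i1, integral_cos, intervalIntegral.integral_const]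
  simp
  field_simp

/-- zeta transplanted to the disc. -/
noncomputable def FF (T : ℝ) (w : ℂ) : ℂ := riemannZeta (1 + ph w + T * Complex.I)

lemma FF_arg_re (T : ℝ) (w : ℂ) : (1 + ph w + T * Complex.I).re = 1 + (ph w).re := by simp
lemma FF_arg_im (T : ℝ) (w : ℂ) : (1 + ph w + T * Complex.I).im = (ph w).im + T := by simp

lemma FF_an (T : ℝ) (hT : 3 ≤ T) (R : ℝ) (hR : R ≤ 0.9995) : AnalyticOnNhd ℂ (FF T) (Metric.closedBall 0 R) := by
  intro w hw
  rw [mem_closedBall_zero_iff] at hw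
  have h1 : (1:ℂ) + ph w + T * Complex.I ≠ 1 := by
    intro h
    have := congrArg Complex.im h
    rw [FF_arg_im, Complex.one_im] at this
    have := abs_le.1 (ph_im w R hw hR)
    linarith
  have h2 : AnalyticAt ℂ riemannZeta (1 + ph w + T * Complex.I) := by
    have : AnalyticOnNhd ℂ riemannZeta {1}ᶜ := by
      apply DifferentiableOn.analyticOnNhd _ isOpen_compl_singleton
      intro s hs
      exact (differentiableAt_riemannZeta hs).differentiableWithinAt
    exact this _ h1
  have h3 : AnalyticAt ℂ (fun w => 1 + ph w + T * Complex.I) w :=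
    (analyticAt_const.add (ph_an w (by linarith))).add analyticAt_const
  exact AnalyticAt.comp' (f := fun w => 1 + ph w + T * Complex.I) h2 h3

lemma ph_injOn (T : ℝ) : Set.InjOn (fun w => 1 + ph w + T * Complex.I) (Metric.ball 0 1) := by
  intro w hw v hv h
  rw [mem_ball_zero_iff] at hw hv
  have : ph w = ph v := by simpa using h
  rw [ph_inv w hw, ph_inv v hv, this]

lemma FF_zeros_finite (T : ℝ) : {w : ℂ | ‖w‖ ≤ 0.9995 ∧ FF T w = 0}.Finite := by
  have hc : IsCompact (Set.image (fun w => 1 + ph w + T * Complex.I) (Metric.closedBall 0 0.9995)) := by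
    apply (isCompact_closedBall (0:ℂ) 0.9995).image_of_continuousOn
    intro w hw
    rw [mem_closedBall_zero_iff] at hw
    exact ((analyticAt_const.add (ph_an w (by linarith))).add analyticAt_const).continuousAt.continuousWithinAt
  have hf := hc.inter_riemannZetaZeros_finite
  apply Set.Finite.of_finite_image (f := fun w => 1 + ph w + T * Complex.I) (hf.subset _) ((ph_injOn T).mono _)
  · rintro _ ⟨w, ⟨hw, h⟩, rfl⟩
    exact ⟨⟨w, by simpa using hw, rfl⟩, h⟩
  · rintro w ⟨hw, h⟩
    rw [mem_ball_zero_iff]; linarith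

lemma good_R (t : ℝ) : ∃ R : ℝ, 0.9985 ≤ R ∧ R ≤ 0.9995 ∧ ∀ k ∈ range 5, ∀ w : ℂ, ‖w‖ = R → FF (k * t) w ≠ 0 := by
  have hfin : (⋃ k ∈ range 5, Set.image norm {w : ℂ | ‖w‖ ≤ 0.9995 ∧ FF (k * t) w = 0}).Finite := by
    apply Set.Finite.biUnion (Finset.finite_toSet _)
    intro k _
    exact (FF_zeros_finite _).image _
  have hinf : (Set.Icc (0.9985:ℝ) 0.9995).Infinite := Set.Icc_infinite (by norm_num)
  obtain ⟨R, hR, hn⟩ := (hinf.sdiff hfin).nonempty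
  refine ⟨R, hR.1, hR.2, fun k hk w hw h0 => hn ?_⟩
  simp only [Set.mem_iUnion]
  exact ⟨k, hk, w, ⟨by rw [hw]; exact hR.2, h0⟩, hw⟩

lemma perk (q al ga ε R T LM U : ℝ) (hε : 0 < ε) (hR : 0.9985 ≤ R) (hR2 : R ≤ 0.9995) (he : ε / R ≤ 0.0081) (hT : 3 ≤ T)
    (hal : 0 ≤ al) (hga : 0 ≤ ga) (hLM : 0 ≤ LM)
    (hKK : ∀ z : ℂ, ‖z‖ = R → -(al*(ε/R)*max (z.re/R) 0) ≤ KK q ε z ∧ KK q ε z ≤ al*(ε/R)*max (-(z.re/R)) 0 + ga*(ε/R)^2)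
    (hnz : ∀ z : ℂ, ‖z‖ = R → FF T z ≠ 0)
    (hM : ∀ z : ℂ, ‖z‖ = R → Real.log ‖FF T z‖ ≤ LM)
    (hTT : ∀ v : ℂ, ‖v‖ < R → FF T v = 0 → TT q ε R v ≤ 0)
    (hU : U = 0 ∨ ∃ v0 : ℂ, ‖v0‖ < R ∧ FF T v0 = 0 ∧ TT q ε R v0 ≤ -U) :
    ∑ j ∈ range 4, cc q j * Real.log ‖FF T (ε * uu j)‖ ≤ -U + (al*(ε/R)/Real.pi*(LM + Real.log (27/7)) + ga*(ε/R)^2*LM + al*(ε/R)*0.0018) := by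
  have hR0 : 0 < R := by linarith
  have he0 : 0 < ε / R := by positivity
  set e := ε / R with hedef
  have hεe : ε = e * R := by rw [hedef]; field_simp
  have hFan := FF_an T hT R hR2
  have hfin : {w : ℂ | ‖w‖ ≤ R ∧ FF T w = 0}.Finite := (FF_zeros_finite T).subset (fun w hw => ⟨hw.1.trans hR2, hw.2⟩)
  set S := hfin.toFinset with hS
  have memS : ∀ w, w ∈ S ↔ (‖w‖ ≤ R ∧ FF T w = 0) := by intro w; rw [hS, Set.Finite.mem_toFinset]; rfl
  have ltS : ∀ w ∈ S, ‖w‖ < R := by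
    intro w hw
    rw [memS] at hw
    exact lt_of_le_of_ne hw.1 (fun h => hnz w h hw.2)
  obtain ⟨m, hm1, hm⟩ := PJ R hR0 S.card S (FF T) rfl hFan (by
    intro z hz; rw [mem_closedBall_zero_iff] at hz; rw [memS]; exact ⟨fun h => ⟨hz, h⟩, fun h => h.2⟩) (by
    intro v hv; rw [mem_ball_zero_iff]; exact ltS v hv)
  have hwb (j : ℕ) : ‖(ε:ℂ) * uu j‖ < R := by
    rw [norm_mul, Complex.norm_real, Real.norm_eq_abs, abs_of_pos hε, hεe]
    have := uu_norm j
    have h2 : e * R * ‖uu j‖ ≤ 0.0081 * R * 9.6 := by gcongr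
    linarith
  have hwS (j : ℕ) : (ε:ℂ) * uu j ∉ S := by
    intro h
    rw [memS] at h
    refine riemannZeta_ne_zero_of_one_le_re ?_ h.2
    rw [FF_arg_re, ph_re _ (by linarith [hwb j])]
    have h1 : 0 ≤ ((ε:ℂ) * uu j).re := by
      rw [Complex.re_ofReal_mul]; have := uu_re j; positivity
    have h2 : 0 ≤ 1 - ‖(ε:ℂ) * uu j‖^2 := by
      have := hwb j; have := norm_nonneg ((ε:ℂ) * uu j); nlinarith
    have h3 : 0 ≤ Real.arctan (2 * ((ε:ℂ) * uu j).re / (1 - ‖(ε:ℂ) * uu j‖^2)) := Real.arctan_nonneg.2 (by positivity)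
    have := Real.pi_pos
    have : 0 ≤ 0.7 / Real.pi * Real.arctan (2 * ((ε:ℂ) * uu j).re / (1 - ‖(ε:ℂ) * uu j‖^2)) := by positivity
    linarith
  have hj (j : ℕ) := hm (ε * uu j) (by rw [mem_ball_zero_iff]; exact hwb j) (hwS j)
  have hcontL : ContinuousOn (fun z => Real.log ‖FF T z‖) (Metric.sphere 0 |R|) := by
    rw [abs_of_pos hR0]
    refine ContinuousOn.log ((hFan.continuousOn.mono Metric.sphere_subset_closedBall).norm) ?_
    intro z hz; rw [mem_sphere_zero_iff_norm] at hz; exact norm_ne_zero_iff.2 (hnz z hz)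
  have hcontP (j : ℕ) : ContinuousOn (fun z => poissonKernel 0 (ε * uu j) z) (Metric.sphere 0 |R|) := by
    simp only [poissonKernel_def]
    apply ContinuousOn.div (by fun_prop) (by fun_prop)
    intro z hz
    rw [mem_sphere_zero_iff_norm, abs_of_pos hR0] at hz
    have : z - ε * uu j ≠ 0 := by
      intro h
      have := hwb j
      rw [← sub_eq_zero.1 h, hz] at this
      linarith
    simpa using this
  have hI (j : ℕ) : CircleIntegrable (fun z => poissonKernel 0 (ε * uu j) z * Real.log ‖FF T z‖) 0 R :=
    ((hcontP j).mul hcontL).circleIntegrable'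
  have hsum : ∑ j ∈ range 4, cc q j * Real.log ‖FF T (ε * uu j)‖ = ∑ v ∈ S, m v * TT q ε R v + Real.circleAverage (fun z => KK q ε z * Real.log ‖FF T z‖) 0 R := by
    simp only [hj, mul_add, sum_add_distrib]
    congr 1
    · simp only [TT, mul_sum]
      rw [sum_comm]
      apply sum_congr rfl; intro v _; apply sum_congr rfl; intro j _; ring
    · have hI' : ∀ j ∈ range 4, CircleIntegrable (fun z => cc q j * (poissonKernel 0 (ε * uu j) z * Real.log ‖FF T z‖)) 0 R := by
        intro j _
        exact (continuousOn_const.mul ((hcontP j).mul hcontL)).circleIntegrable'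
      have := Real.circleAverage_fun_sum hI'
      have e1 : (fun z => KK q ε z * Real.log ‖FF T z‖) = fun z => ∑ j ∈ range 4, cc q j * (poissonKernel 0 (ε * uu j) z * Real.log ‖FF T z‖) := by
        funext z; rw [KK, sum_mul]; apply sum_congr rfl; intro j _; ring
      rw [e1, this]
      apply sum_congr rfl
      intro j _
      rw [← smul_eq_mul, ← Real.circleAverage_fun_smul]; rfl
  have hZ : ∑ v ∈ S, m v * TT q ε R v ≤ -U := by
    have h0 : ∀ v ∈ S, (m v:ℝ) * TT q ε R v ≤ 0 := by
      intro v hv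
      exact mul_nonpos_of_nonneg_of_nonpos (Nat.cast_nonneg _) (hTT v (ltS v hv) ((memS v).1 hv).2)
    rcases hU with rfl | ⟨v0, h1, h2, h3⟩
    · rw [neg_zero]; exact sum_nonpos h0
    · have hv0 : v0 ∈ S := (memS v0).2 ⟨h1.le, h2⟩
      rw [← add_sum_erase _ _ hv0]
      have h4 : ∑ v ∈ S.erase v0, (m v:ℝ) * TT q ε R v ≤ 0 := sum_nonpos (fun v hv => h0 v (mem_of_mem_erase hv))
      have h5 : (1:ℝ) ≤ m v0 := by exact_mod_cast hm1 v0 hv0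
      have h6 : TT q ε R v0 ≤ 0 := hTT v0 h1 h2
      have h7 : (m v0:ℝ) * TT q ε R v0 ≤ 1 * TT q ε R v0 := mul_le_mul_of_nonpos_right h5 h6
      linarith
  have hpt : ∀ z ∈ Metric.sphere (0:ℂ) |R|, KK q ε z * Real.log ‖FF T z‖ ≤ (al*e*LM) * max (-(z.re/R)) 0 + (al*e*Real.log (27/7)) * max (z.re/R) 0 + (ga*e^2*LM + al*e*0.0018) := by
    intro z hz
    rw [mem_sphere_zero_iff_norm, abs_of_pos hR0] at hz
    obtain ⟨k1, k2⟩ := hKK z hz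
    have hm' := hM z hz
    have hl : 0 ≤ Real.log (27/7) := Real.log_nonneg (by norm_num)
    have ae : 0 ≤ al * e := by positivity
    have mx1 : 0 ≤ max (-(z.re/R)) 0 := le_max_right _ _
    have mx2 : 0 ≤ max (z.re/R) 0 := le_max_right _ _
    rcases le_total 0 (Real.log ‖FF T z‖) with h0 | h0
    · have a1 : KK q ε z * Real.log ‖FF T z‖ ≤ (al*e*max (-(z.re/R)) 0 + ga*e^2) * LM := by
        calc KK q ε z * Real.log ‖FF T z‖ ≤ (al*e*max (-(z.re/R)) 0 + ga*e^2) * Real.log ‖FF T z‖ := by gcongr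
          _ ≤ _ := by gcongr
      have a2 : 0 ≤ (al*e*Real.log (27/7)) * max (z.re/R) 0 := by positivity
      have a3 : 0 ≤ al*e*0.0018 := by positivity
      linarith
    · have a1 : KK q ε z * Real.log ‖FF T z‖ ≤ (al*e*max (z.re/R) 0) * (-Real.log ‖FF T z‖) := by
        have := mul_le_mul_of_nonneg_right k1 (by linarith : 0 ≤ -Real.log ‖FF T z‖)
        linarith
      have a2 : 0 ≤ (al*e*LM) * max (-(z.re/R)) 0 := by positivity
      have a3 : 0 ≤ ga*e^2*LM := by positivity
      rcases le_or_gt z.re 0 with hc | hc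
      · have : max (z.re/R) 0 = 0 := max_eq_right (div_nonpos_of_nonpos_of_nonneg hc hR0.le)
        rw [this] at a1 ⊢
        have a3 : 0 ≤ al*e*0.0018 := by positivity
        linarith
      · have hc' : 0 < z.re / R := by positivity
        have hlow := ph_low z R T hz hR (by linarith) hc
        change -Real.log ‖FF T z‖ ≤ _ at hlow
        rw [max_eq_left hc'.le] at a1 ⊢
        have a4 : (al*e*(z.re/R)) * (-Real.log ‖FF T z‖) ≤ (al*e*(z.re/R)) * (Real.log (27/7) + 0.0018 / (z.re / R)) := by gcongr
        have a5 : (al*e*(z.re/R)) * (Real.log (27/7) + 0.0018 / (z.re / R)) = (al*e*Real.log (27/7)) * (z.re/R) + al*e*0.0018 := by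
          generalize z.re/R = c at *
          field_simp
        linarith
  have hI1 : CircleIntegrable (fun z => KK q ε z * Real.log ‖FF T z‖) 0 R := by
    apply ContinuousOn.circleIntegrable'
    refine ContinuousOn.mul ?_ hcontL
    unfold KK
    exact continuousOn_finsetSum _ (fun j _ => continuousOn_const.mul (hcontP j))
  have hI2 : CircleIntegrable (fun z : ℂ => (al*e*LM) * max (-(z.re/R)) 0 + (al*e*Real.log (27/7)) * max (z.re/R) 0 + (ga*e^2*LM + al*e*0.0018)) 0 R := by
    apply ContinuousOn.circleIntegrable'
    apply Continuous.continuousOn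
    fun_prop
  have hav := Real.circleAverage_mono hI1 hI2 hpt
  rw [avg_max _ _ _ R hR0] at hav
  rw [hsum]
  have : (al*e*LM + al*e*Real.log (27/7))/Real.pi = al*e/Real.pi*(LM + Real.log (27/7)) := by ring
  linarith

end

section
open Finset

lemma log_near (x y : ℝ) (hy0 : 0 ≤ y) (hy : y ≤ 0.01) (h : |x - 1| ≤ y) : |Real.log x| ≤ 1.011 * y := by
  obtain ⟨h1, h2⟩ := abs_le.1 h
  have hx : 0 < x := by linarith
  have u := Real.log_le_sub_one_of_pos hx
  have l := Real.log_le_sub_one_of_pos (inv_pos.2 hx)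
  rw [Real.log_inv] at l
  have l2 : x⁻¹ ≤ 1 + 1.011 * y := by
    rw [inv_eq_one_div, div_le_iff₀ hx]; nlinarith
  rw [abs_le]; constructor <;> linarith

lemma a0_bd : 0.4456 ≤ 1.4 / Real.pi ∧ 1.4 / Real.pi ≤ 0.4457 := by
  have := Real.pi_gt_d4
  have := Real.pi_lt_d4
  have := Real.pi_pos
  rw [div_le_iff₀ this, le_div_iff₀ this]; constructor <;> linarith

lemma zeta_pole (d : ℂ) (hd : d ≠ 0) (h : ‖d‖ ≤ 0.0352) (hd0 : 0 ≤ d.re) : ‖d * riemannZeta (1 + d) - 1 - 7/12 * d‖ ≤ 0.0908 * ‖d‖ := by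
  have hre := abs_le.1 ((Complex.abs_re_le_norm d).trans h)
  have hz := zeta_approx 1 le_rfl (1 + d) (by rw [Complex.add_re, Complex.one_re]; linarith) (by simpa using hd)
  simp only [Ico_self, sum_empty, Nat.cast_one, Complex.one_cpow, Real.one_rpow, mul_one, zero_add, add_sub_cancel_left] at hz
  have e : d * riemannZeta (1 + d) - 1 - 7/12 * d = d * (riemannZeta (1 + d) - (1/2 + (1+d)/12 + 1/d)) + d * (d / 12) := by
    field_simp; ring
  have n1 : ‖1 + d‖ ≤ 1.0352 := by have := norm_add_le 1 d; rw [norm_one] at this; linarith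
  have n2 : ‖1 + d + 1‖ ≤ 2.0352 := by
    have := norm_add_le (1 + d) 1; rw [norm_one] at this; linarith
  have h2 : ‖1 + d‖ * ‖1 + d + 1‖ / (12 * ((1 + d).re + 1)) ≤ 0.0878 := by
    rw [Complex.add_re, Complex.one_re, div_le_iff₀ (by linarith)]
    calc ‖1 + d‖ * ‖1 + d + 1‖ ≤ 1.0352 * 2.0352 := by gcongr
      _ ≤ _ := by linarith
  rw [e]
  refine (norm_add_le _ _).trans ?_
  rw [norm_mul, norm_mul, norm_div, Complex.norm_ofNat]
  have := norm_nonneg d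
  have a1 := mul_le_mul_of_nonneg_left (hz.trans h2) this
  have a2 := mul_le_mul_of_nonneg_left h this
  linarith

lemma log_G (X w : ℂ) (hw : ‖w‖ ≤ 0.078) (hX : ‖X - 0.26 * w‖ ≤ 0.0413 * ‖w‖) :
    |Real.log ‖1 + X‖ - 0.26 * w.re| ≤ 0.0413 * ‖w‖ + 0.047 * ‖w‖^2 := by
  have hXn : ‖X‖ ≤ 0.3013 * ‖w‖ := by
    have h1 := norm_add_le (X - 0.26 * w) (0.26 * w)
    rw [sub_add_cancel, norm_mul] at h1
    have : ‖(0.26:ℂ)‖ = 0.26 := by norm_num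
    rw [this] at h1; linarith
  have hX1 : ‖X‖ < 1 := by linarith
  have h2 := Complex.norm_log_one_add_sub_self_le hX1
  have h3 : ‖X‖^2 * (1 - ‖X‖)⁻¹ / 2 ≤ 0.047 * ‖w‖^2 := by
    have h4 : (1 - ‖X‖)⁻¹ ≤ 1.03 := by
      rw [inv_eq_one_div, div_le_iff₀ (by linarith)]; linarith
    calc ‖X‖^2 * (1 - ‖X‖)⁻¹ / 2 ≤ (0.3013 * ‖w‖)^2 * 1.03 / 2 := by gcongr
      _ ≤ _ := by nlinarith only [sq_nonneg ‖w‖]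
  have e : Real.log ‖1 + X‖ - 0.26 * w.re = ((Complex.log (1 + X) - X) + (X - 0.26 * w)).re := by
    have : ((0.26:ℂ) * w).re = 0.26 * w.re := by
      rw [show (0.26:ℂ) = ((0.26:ℝ):ℂ) by push_cast; rfl, Complex.re_ofReal_mul]
    rw [sub_add_sub_cancel, Complex.sub_re, this, Complex.log_re]
  rw [e]
  refine (Complex.abs_re_le_norm _).trans ((norm_add_le _ _).trans ?_)
  linarith

lemma pole_pt (w : ℂ) (hw0 : w ≠ 0) (hw : ‖w‖ ≤ 0.078) (hre : 0 ≤ w.re) :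
    |Real.log ‖riemannZeta (1 + ph w)‖ + Real.log (1.4 / Real.pi) + Real.log ‖w‖ - 0.26 * w.re| ≤ 0.0413 * ‖w‖ + 0.43 * ‖w‖^2 := by
  obtain ⟨a1, a2⟩ := a0_bd
  have hp := Real.pi_pos
  have hA := arc_approx w (by linarith)
  have hphre : 0 ≤ (ph w).re := by
    rw [ph_re w (by linarith)]
    have : 0 ≤ 1 - ‖w‖^2 := by nlinarith [norm_nonneg w]
    have := Real.arctan_nonneg.2 (show 0 ≤ 2 * w.re / (1 - ‖w‖^2) by positivity)
    positivity
  have n0 : 0 < ‖w‖ := norm_pos_iff.2 hw0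
  set A := Complex.arctan w with hAd
  have hy : ‖w‖^3 / 2.7 = ‖w‖ * (‖w‖^2/2.7) := by ring
  have hy1 : ‖w‖^2/2.7 ≤ 0.00226 := by
    rw [div_le_iff₀ (by norm_num)]; nlinarith
  have hAu : ‖A‖ ≤ ‖w‖ * (1 + ‖w‖^2/2.7) := by
    have := norm_add_le (A - w) w; rw [sub_add_cancel] at this; linarith
  have hAl : ‖w‖ * (1 - ‖w‖^2/2.7) ≤ ‖A‖ := by
    have := norm_sub_le A (A - w); rw [sub_sub_cancel] at this; linarith
  have hApos : 0 < ‖A‖ := lt_of_lt_of_le (mul_pos n0 (by linarith)) hAl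
  have hratio : |‖A‖/‖w‖ - 1| ≤ ‖w‖^2/2.7 := by
    have u : ‖A‖/‖w‖ ≤ 1 + ‖w‖^2/2.7 := by rw [div_le_iff₀ n0]; linarith
    have l : 1 - ‖w‖^2/2.7 ≤ ‖A‖/‖w‖ := by rw [le_div_iff₀ n0]; linarith
    rw [abs_le]; constructor <;> linarith
  have hlogA := log_near _ _ (by positivity) (by linarith) hratio
  rw [Real.log_div hApos.ne' n0.ne'] at hlogA
  have hd : ph w = ((1.4 / Real.pi : ℝ) : ℂ) * A := rfl
  have ha0 : 0 < 1.4 / Real.pi := by positivity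
  have hdn : ‖ph w‖ = 1.4 / Real.pi * ‖A‖ := by
    rw [hd, norm_mul, Complex.norm_real, Real.norm_eq_abs, abs_of_pos ha0]
  have hdu : ‖ph w‖ ≤ 0.44675 * ‖w‖ := by
    rw [hdn]
    calc 1.4 / Real.pi * ‖A‖ ≤ 0.4457 * (‖w‖ * (1 + 0.00226)) := by
          gcongr
          exact hAu.trans (by gcongr)
      _ ≤ _ := by linarith
  have hdne : ph w ≠ 0 := by rw [← norm_pos_iff, hdn]; positivity
  have hz := zeta_pole (ph w) hdne (by linarith) hphre
  set X := ph w * riemannZeta (1 + ph w) - 1 with hX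
  have hXw : ‖X - 0.26 * w‖ ≤ 0.0413 * ‖w‖ := by
    have e1 : X - 0.26 * w = (X - 7/12 * ph w) + (7/12 * (1.4 / Real.pi : ℝ) : ℂ) * (A - w) + ((7/12 * (1.4 / Real.pi) - 0.26 : ℝ):ℂ) * w := by
      rw [hd]; push_cast; ring
    rw [e1]
    refine (norm_add₃_le).trans ?_
    rw [norm_mul, norm_mul, norm_mul, Complex.norm_real, Complex.norm_real, Real.norm_eq_abs, Real.norm_eq_abs, abs_of_pos ha0]
    have n7 : ‖(7/12:ℂ)‖ = 7/12 := by norm_num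
    rw [n7]
    have c1 : |7/12 * (1.4 / Real.pi) - 0.26| ≤ 0.0001 := by rw [abs_le]; constructor <;> linarith
    have c2 : ‖A - w‖ ≤ 0.00226 * ‖w‖ := by
      refine hA.trans ?_
      rw [hy, mul_comm]; gcongr
    have c3 : 7/12 * (1.4 / Real.pi) * ‖A - w‖ ≤ 0.27 * (0.00226 * ‖w‖) := by gcongr; linarith
    have c4 : |7/12 * (1.4 / Real.pi) - 0.26| * ‖w‖ ≤ 0.0001 * ‖w‖ := by gcongr
    linarith
  have hG := log_G X w hw hXw
  have h1X : 1 + X = ph w * riemannZeta (1 + ph w) := by rw [hX]; ring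
  have hzne : riemannZeta (1 + ph w) ≠ 0 := riemannZeta_ne_zero_of_one_le_re (by rw [Complex.add_re, Complex.one_re]; linarith)
  rw [h1X, norm_mul, Real.log_mul (norm_ne_zero_iff.2 hdne) (norm_ne_zero_iff.2 hzne), hdn, Real.log_mul ha0.ne' hApos.ne'] at hG
  obtain ⟨g1, g2⟩ := abs_le.1 hG
  obtain ⟨g3, g4⟩ := abs_le.1 hlogA
  have w2 : 0 ≤ ‖w‖^2 := by positivity
  clear hG hlogA hXw hX
  generalize Real.log ‖A‖ = xa at *
  generalize Real.log ‖riemannZeta (1 + ph w)‖ = xb at *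
  generalize Real.log (1.4 / Real.pi) = xc at *
  generalize Real.log ‖w‖ = xd at *
  have w3 : ‖w‖^2 / 2.7 ≤ 0.371 * ‖w‖^2 := by rw [div_le_iff₀ (by norm_num)]; nlinarith only [w2]
  generalize ‖w‖^2 / 2.7 = y at *
  generalize ‖w‖^2 = y2 at *
  rw [abs_le]; constructor <;> linarith only [g1,g2,g3,g4,w2,w3]

lemma pole_sum (q ε : ℝ) (hq : 0 ≤ q) (hq1 : q ≤ 1) (hε : 0 < ε) (he : ε ≤ 0.0081) :
    ∑ j ∈ range 4, cc q j * Real.log ‖riemannZeta (1 + ph (ε * uu j))‖ ≤ -(∑ j ∈ range 4, cc q j * Real.log ‖uu j‖) + 0.2 * ε := by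
  have hu0 (j : ℕ) : uu j ≠ 0 := by
    intro h; have := uu_re j; rw [h, Complex.zero_re] at this; norm_num at this
  have hn (j : ℕ) : ‖(ε:ℂ) * uu j‖ = ε * ‖uu j‖ := by
    rw [norm_mul, Complex.norm_real, Real.norm_eq_abs, abs_of_pos hε]
  have hP (j : ℕ) := pole_pt (ε * uu j) (mul_ne_zero (by exact_mod_cast hε.ne') (hu0 j)) (by
    rw [hn]; have := uu_norm j; have : ε * ‖uu j‖ ≤ 0.0081 * 9.6 := by gcongr
    linarith) (by rw [Complex.re_ofReal_mul]; have := uu_re j; positivity)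
  simp only [hn, Complex.re_ofReal_mul] at hP
  have hl (j : ℕ) : Real.log (ε * ‖uu j‖) = Real.log ε + Real.log ‖uu j‖ := Real.log_mul hε.ne' (norm_ne_zero_iff.2 (hu0 j))
  simp only [hl] at hP
  have p0 := abs_le.1 (hP 0)
  have p1 := abs_le.1 (hP 1)
  have p2 := abs_le.1 (hP 2)
  have p3 := abs_le.1 (hP 3)
  rw [cc_sum, cc_sum]
  have r0 : (uu 0).re = 2.5 := by unfold uu; norm_num
  have r1 : (uu 1).re = 2.5 := by unfold uu; norm_num
  have r2 : (uu 2).re = 2.5 := by unfold uu; norm_num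
  have r3 : (uu 3).re = 9.6 := by unfold uu; norm_num
  have s0 : ‖uu 0‖ = 2.5 := by rw [uu0]; norm_num
  have s3 : ‖uu 3‖ = 9.6 := by rw [uu3]; norm_num
  have s1 : ‖uu 1‖^2 = 48.35 := by
    rw [← Complex.normSq_eq_norm_sq, Complex.normSq_apply, r1]
    have : (uu 1).im = √42.1 := by unfold uu; simp
    rw [this]; nlinarith only [sqW]
  have s2 : ‖uu 2‖^2 = 48.35 := by
    rw [← Complex.normSq_eq_norm_sq, Complex.normSq_apply, r2]
    have : (uu 2).im = -√42.1 := by unfold uu; simp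
    rw [this]; nlinarith only [sqW]
  have t1 : ‖uu 1‖ ≤ 6.954 := by nlinarith only [s1, norm_nonneg (uu 1)]
  have t2 : ‖uu 2‖ ≤ 6.954 := by nlinarith only [s2, norm_nonneg (uu 2)]
  rw [r0, mul_pow, s0] at p0
  rw [r1, mul_pow, s1] at p1
  rw [r2, mul_pow, s2] at p2
  rw [r3, mul_pow, s3] at p3
  rw [s0, s3]
  generalize Real.log ‖riemannZeta (1 + ph (ε * uu 0))‖ = X0 at *
  generalize Real.log ‖riemannZeta (1 + ph (ε * uu 1))‖ = X1 at *
  generalize Real.log ‖riemannZeta (1 + ph (ε * uu 2))‖ = X2 at *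
  generalize Real.log ‖riemannZeta (1 + ph (ε * uu 3))‖ = X3 at *
  generalize Real.log ‖uu 1‖ = L1 at *
  generalize Real.log ‖uu 2‖ = L2 at *
  generalize Real.log (1.4/Real.pi) + Real.log ε = Y at *
  have e2 : ε^2 ≤ 0.0081 * ε := by nlinarith only [hε, he]
  have k1 : ε * ‖uu 1‖ ≤ 6.954 * ε := by nlinarith only [t1, hε]
  have k2 : ε * ‖uu 2‖ ≤ 6.954 * ε := by nlinarith only [t2, hε]
  generalize Real.log (1.4/Real.pi) = Z at *
  generalize Real.log ε = E at *
  have m0 : X0 + Z + E + Real.log 2.5 - 0.26*2.5*ε ≤ 0.0413 * (2.5*ε) + 0.43*(0.0081*6.25)*ε := by nlinarith only [p0.2, e2]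
  have m1 : -(X1 + Z + E + L1 - 0.26*2.5*ε) ≤ 0.0413 * (6.954*ε) + 0.43*(0.0081*48.35)*ε := by nlinarith only [p1.1, e2, k1]
  have m2 : -(X2 + Z + E + L2 - 0.26*2.5*ε) ≤ 0.0413 * (6.954*ε) + 0.43*(0.0081*48.35)*ε := by nlinarith only [p2.1, e2, k2]
  have m3 : -(X3 + Z + E + Real.log 9.6 - 0.26*9.6*ε) ≤ 0.0413 * (9.6*ε) + 0.43*(0.0081*92.16)*ε := by nlinarith only [p3.1, e2]
  have M0 := mul_le_mul_of_nonneg_left m0 (by linarith : 0 ≤ 1+2*q)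
  have M1 := mul_le_mul_of_nonneg_left m1 hq
  have M2 := mul_le_mul_of_nonneg_left m2 hq
  have qe : q*ε ≤ ε := by nlinarith only [hε, hq1]
  have qe0 : 0 ≤ q*ε := by positivity
  linarith

end

section
open Finset

lemma euu_norm (ε : ℝ) (hε : 0 < ε) (he : ε ≤ 0.0081) (j : ℕ) : ‖(ε:ℂ) * uu j‖ < 1 := by
  rw [norm_mul, Complex.norm_real, Real.norm_eq_abs, abs_of_pos hε]
  have := uu_norm j
  calc ε * ‖uu j‖ ≤ 0.0081 * 9.6 := by gcongr
    _ < 1 := by norm_num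

lemma phu_re (ε : ℝ) (hε : 0 < ε) (he : ε ≤ 0.0081) (j : ℕ) :
    0 < (ph (ε * uu 0)).re ∧ (ph (ε * uu 0)).re ≤ (ph (ε * uu j)).re := by
  have hp := Real.pi_pos
  have hr := uu_re j
  have r0 : (uu 0).re = 5/2 := by unfold uu; norm_num
  have n0 : ‖uu 0‖ = 5/2 := by rw [uu0]; norm_num
  have hn : 5/2 ≤ ‖uu j‖ := hr.trans ((le_abs_self _).trans (Complex.abs_re_le_norm _))
  have hl := euu_norm ε hε he j
  rw [ph_re _ (euu_norm ε hε he 0), ph_re _ hl]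
  simp only [norm_mul, Complex.norm_real, Real.norm_eq_abs, abs_of_pos hε, Complex.re_ofReal_mul, r0, n0] at hl ⊢
  have h1 : 0 < 1 - (ε * ‖uu j‖)^2 := by nlinarith only [hl, mul_nonneg hε.le (norm_nonneg (uu j))]
  have h2 : 1 - (ε * ‖uu j‖)^2 ≤ 1 - (ε * (5/2))^2 := by gcongr
  constructor
  · have := Real.arctan_pos.2 (show 0 < 2 * (ε * (5/2)) / (1 - (ε * (5/2))^2) from div_pos (by positivity) (h1.trans_le h2))
    positivity
  · gcongr

lemma euler_hyp (q ε : ℝ) (hq : 0 ≤ q) (hε : 0 < ε) (he : ε ≤ 0.0081) (X : ℝ) (hX : 0 ≤ X) :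
    ∃ r : ℝ, 0 ≤ r ∧ ∑ j ∈ range 4, (cc q j : ℂ) * Complex.exp (-(X:ℂ) * ph (ε * uu j)) = r := by
  have p1 := (phu_re ε hε he 1).2
  have p3 := (phu_re ε hε he 3).2
  have e0 : ph (ε * uu 0) = ((ph (ε * uu 0)).re : ℂ) := by
    rw [uu0, show (ε:ℂ) * (5/2) = ((ε * (5/2) : ℝ):ℂ) by push_cast; ring, ph_real, Complex.ofReal_re]
  have e3 : ph (ε * uu 3) = ((ph (ε * uu 3)).re : ℂ) := by
    rw [uu3, show (ε:ℂ) * (48/5) = ((ε * (48/5) : ℝ):ℂ) by push_cast; ring, ph_real, Complex.ofReal_re]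
  have e2 : ph (ε * uu 2) = (starRingEnd ℂ) (ph (ε * uu 1)) := by
    rw [← ph_conj _ (euu_norm ε hε he 1), map_mul, Complex.conj_ofReal, uu1, uu2]
    congr 2
    apply Complex.ext
    · rw [Complex.conj_re]; norm_num
    · rw [Complex.conj_im]; norm_num
  set d0 := (ph (ε * uu 0)).re
  set d3 := (ph (ε * uu 3)).re
  set P := ph (ε * uu 1) with hP
  set E := Complex.exp (-(X:ℂ) * P) with hE
  refine ⟨(1 + 2*q) * Real.exp (-X * d0) - 2 * q * E.re - Real.exp (-X * d3), ?_, ?_⟩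
  · have h1 : E.re ≤ Real.exp (-X * d0) := by
      refine ((le_abs_self _).trans (Complex.abs_re_le_norm _)).trans ?_
      rw [hE, Complex.norm_exp]
      apply Real.exp_le_exp.2
      have : (-(X:ℂ) * P).re = -X * P.re := by rw [← Complex.ofReal_neg, Complex.re_ofReal_mul]
      rw [this]; nlinarith only [hX, p1]
    have h3 : Real.exp (-X * d3) ≤ Real.exp (-X * d0) := by
      apply Real.exp_le_exp.2; nlinarith only [hX, p3]
    nlinarith only [h1, h3, hq]
  · have c2 : Complex.exp (-(X:ℂ) * (starRingEnd ℂ) P) = (starRingEnd ℂ) E := by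
      rw [hE, ← Complex.exp_conj, map_mul, map_neg, Complex.conj_ofReal]
    have hs : E + (starRingEnd ℂ) E = ((2 * E.re : ℝ) : ℂ) := Complex.add_conj E
    rw [sum_range_succ, sum_range_succ, sum_range_succ, sum_range_one, e0, e2, e3, c2, ← hP, ← hE]
    have k0 : cc q 0 = 1 + 2*q := by simp [cc]
    have k1 : cc q 1 = -q := by simp [cc]
    have k2 : cc q 2 = -q := by simp [cc]
    have k3 : cc q 3 = -1 := by simp [cc]
    rw [k0, k1, k2, k3]
    push_cast at hs ⊢
    linear_combination -(q:ℂ) * hs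

/-- growth bound on the circle -/
noncomputable def LMf (T : ℝ) : ℝ := Real.log 98.5 + 0.1 * (Real.log (T + 2) - Real.log (2 * Real.pi))

lemma growth (T R : ℝ) (hR : R ≤ 0.9995) (hT : 2 * Real.pi * Real.exp 24 + 2 ≤ T) (z : ℂ) (hz : ‖z‖ = R) (hnz : FF T z ≠ 0) :
    Real.log ‖FF T z‖ ≤ LMf T := by
  have hp := Real.pi_pos
  obtain ⟨a, b⟩ := ph_re_lt z (by linarith)
  obtain ⟨c, d⟩ := abs_le.1 (ph_im z R hz.le hR)
  have hY : 2 * Real.pi * Real.exp 24 ≤ (ph z).im + T := by linarith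
  have hpos : 0 < 2 * Real.pi * Real.exp 24 := by positivity
  have hY0 := hpos.trans_le hY
  have hx : (ph z).im + T = 2 * Real.pi * Real.exp (Real.log (((ph z).im + T) / (2 * Real.pi))) := by
    rw [Real.exp_log (by positivity)]; field_simp
  have hx24 : 24 ≤ Real.log (((ph z).im + T) / (2 * Real.pi)) := by
    rw [Real.le_log_iff_exp_le (by positivity), le_div_iff₀ (by positivity)]; linarith
  have h := zeta_growth (1 + (ph z).re) _ _ (by linarith) (by linarith) hx hx24
  have e : FF T z = riemannZeta (((1 + (ph z).re : ℝ):ℂ) + (((ph z).im + T : ℝ):ℂ) * Complex.I) := by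
    unfold FF; congr 1
    apply Complex.ext
    · rw [FF_arg_re]; simp
    · rw [FF_arg_im]; simp
  rw [← e] at h
  have h2 := Real.log_le_log (norm_pos_iff.2 hnz) h
  rw [Real.log_mul (by norm_num) (Real.exp_pos _).ne', Real.log_exp, Real.log_div hY0.ne' (by positivity)] at h2
  have h3 : Real.log ((ph z).im + T) ≤ Real.log (T + 2) := Real.log_le_log hY0 (by linarith)
  unfold LMf; linarith

lemma LMf_nonneg (T : ℝ) (hT : 2 * Real.pi * Real.exp 24 + 2 ≤ T) : 0 ≤ LMf T := by
  have hp := Real.pi_pos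
  have h1 : Real.log (2 * Real.pi) ≤ Real.log (T + 2) := by
    apply Real.log_le_log (by positivity)
    have : 1 ≤ Real.exp 24 := Real.one_le_exp (by norm_num)
    nlinarith only [this, hT, hp]
  have : 0 ≤ Real.log 98.5 := Real.log_nonneg (by norm_num)
  unfold LMf; linarith

/-- cosine polynomial coefficients -/
noncomputable def bb (k : ℕ) : ℝ :=
  if k = 0 then 1.311875 else if k = 1 then 2.2425 else if k = 2 then 1.38625 else if k = 3 then 0.575 else 0.125

lemma bb_pos (θ : ℝ) : 0 ≤ ∑ k ∈ range 5, bb k * Real.cos (k * θ) := by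
  have c2 := Real.cos_two_mul θ
  have c3 := Real.cos_three_mul θ
  have c4 : Real.cos (4 * θ) = 2 * (2 * Real.cos θ ^2 - 1)^2 - 1 := by
    rw [← c2, ← Real.cos_two_mul]; congr 1; ring
  have : ∑ k ∈ range 5, bb k * Real.cos (k * θ) = ((0.9 + Real.cos θ) * (0.25 + Real.cos θ))^2 := by
    simp only [sum_range_succ, range_zero, sum_empty]
    norm_num [bb, c2, c3, c4]; ring
  rw [this]; positivity

end

section
open Finset

/-- error term for one height -/
noncomputable def ER (al ga e T : ℝ) : ℝ :=
  al * e / Real.pi * (LMf T + Real.log (27/7)) + ga * e^2 * LMf T + al * e * 0.0018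

lemma main_gen (q al ga ε R t U1 : ℝ) (hq : 0 ≤ q) (hq1 : q ≤ 1) (hε : 0 < ε) (hR : 0.9985 ≤ R) (hR2 : R ≤ 0.9995)
    (he : ε / R ≤ 0.0081) (ht : 2 * Real.pi * Real.exp 24 + 2 ≤ t) (hal : 0 ≤ al) (hga : 0 ≤ ga)
    (hKK : ∀ z : ℂ, ‖z‖ = R → -(al*(ε/R)*max (z.re/R) 0) ≤ KK q ε z ∧ KK q ε z ≤ al*(ε/R)*max (-(z.re/R)) 0 + ga*(ε/R)^2)
    (hnz : ∀ k ∈ range 5, ∀ w : ℂ, ‖w‖ = R → FF (k * t) w ≠ 0)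
    (hTT : ∀ k : ℕ, 1 ≤ k → k ≤ 4 → ∀ v : ℂ, ‖v‖ < R → FF (k * t) v = 0 → TT q ε R v ≤ 0)
    (v0 : ℂ) (hv0 : ‖v0‖ < R) (hv1 : FF t v0 = 0) (hv2 : TT q ε R v0 ≤ -U1) :
    0 ≤ 1.311875 * (-(∑ j ∈ range 4, cc q j * Real.log ‖uu j‖) + 0.2 * ε) - 2.2425 * U1
      + (2.2425 * ER al ga (ε/R) (1 * t) + 1.38625 * ER al ga (ε/R) (2 * t) + 0.575 * ER al ga (ε/R) (3 * t) + 0.125 * ER al ga (ε/R) (4 * t)) := by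
  have hε2 : ε ≤ 0.0081 := by
    rw [div_le_iff₀ (by linarith)] at he; linarith
  have hbig : 0 < 2 * Real.pi * Real.exp 24 := by have := Real.pi_pos; positivity
  have h0 := euler_pos ℕ (range 4) (cc q) (fun j => ph (ε * uu j))
    (fun j _ => (phu_re ε hε hε2 j).1.trans_le (phu_re ε hε hε2 j).2) (euler_hyp q ε hq hε hε2) bb 5 bb_pos t
  have hp := pole_sum q ε hq hq1 hε hε2
  have hk : ∀ k : ℕ, 1 ≤ k → k ≤ 4 → ∀ U : ℝ, (U = 0 ∨ (U = U1 ∧ k = 1)) →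
      ∑ j ∈ range 4, cc q j * Real.log ‖FF (k * t) (ε * uu j)‖ ≤ -U + ER al ga (ε/R) (k * t) := by
    intro k k1 k4 U hU
    have k1' : (1:ℝ) ≤ k := by exact_mod_cast k1
    have hkt : 2 * Real.pi * Real.exp 24 + 2 ≤ k * t := by nlinarith only [k1', ht, hbig]
    have hbig2 : 1 ≤ 2 * Real.pi * Real.exp 24 := by
      have := Real.pi_gt_three
      have : 1 ≤ Real.exp 24 := Real.one_le_exp (by norm_num)
      nlinarith
    have hmem : k ∈ range 5 := mem_range.2 (by omega)
    refine perk q al ga ε R (k * t) (LMf (k * t)) U hε hR hR2 he (by linarith) hal hga (LMf_nonneg _ hkt) hKK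
      (hnz k hmem) (fun z hz => growth _ R hR2 hkt z hz (hnz k hmem z hz)) (hTT k k1 k4) ?_
    rcases hU with h | ⟨h, rfl⟩
    · exact Or.inl h
    · right; refine ⟨v0, hv0, ?_, ?_⟩
      · rw [Nat.cast_one, one_mul]; exact hv1
      · rw [h]; exact hv2
  have a1 := hk 1 (by norm_num) (by norm_num) U1 (Or.inr ⟨rfl, rfl⟩)
  have a2 := hk 2 (by norm_num) (by norm_num) 0 (Or.inl rfl)
  have a3 := hk 3 (by norm_num) (by norm_num) 0 (Or.inl rfl)
  have a4 := hk 4 (by norm_num) (by norm_num) 0 (Or.inl rfl)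
  clear hk hTT hnz hKK
  rw [sum_range_succ, sum_range_succ, sum_range_succ, sum_range_succ, sum_range_one] at h0
  have b0 : bb 0 = 1.311875 := by simp [bb]
  have b1 : bb 1 = 2.2425 := by simp [bb]
  have b2 : bb 2 = 1.38625 := by simp [bb]
  have b3 : bb 3 = 0.575 := by simp [bb]
  have b4 : bb 4 = 0.125 := by simp [bb]
  rw [b0, b1, b2, b3, b4] at h0
  unfold FF at a1 a2 a3 a4
  rw [show (((0:ℕ):ℝ) * t) = 0 by simp] at h0
  simp only [Complex.ofReal_zero, zero_mul, add_zero] at h0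
  push_cast at h0 a1 a2 a3 a4
  linarith only [h0, a1, a2, a3, a4, hp]

lemma log_ub (a : ℝ) (ha : 0 < a) (p q : ℕ) (hq : q ≠ 0) (h : a^q ≤ 2.7182^p) : Real.log a ≤ p / q :=
  (Real.log_le_iff_le_exp ha).2 (exp_lb a p q hq rfl h)
lemma log_lb (a : ℝ) (ha : 0 < a) (p q : ℕ) (hq : q ≠ 0) (h : 2.7183^p ≤ a^q) : (p:ℝ) / q ≤ Real.log a :=
  (Real.le_log_iff_exp_le ha).2 (exp_ub a p q hq le_rfl ha h)

lemma LMf_le (k t : ℝ) (l : ℝ) (hk : 1 ≤ k) (hl : Real.log k ≤ l) (ht : 1000000 ≤ t) : LMf (k * t) ≤ 4.4074 + 0.1 * (Real.log t + l) := by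
  have h1 : Real.log 98.5 ≤ 4.591 := (log_ub 98.5 (by norm_num) 101 22 (by norm_num) (by norm_num)).trans (by norm_num)
  have h2 : 1.8372 ≤ Real.log (2 * Real.pi) := by
    have := log_lb 6.282 (by norm_num) 79 43 (by norm_num) (by norm_num)
    refine le_trans (le_trans ?_ this) (Real.log_le_log (by norm_num) ?_)
    · norm_num
    · have := Real.pi_gt_d4; linarith
  have h3 : Real.log (k * t + 2) ≤ Real.log k + Real.log t + 0.000003 := by
    have e : k * t + 2 ≤ k * t * 1.000002 := by nlinarith
    have := Real.log_le_log (by positivity) e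
    rw [Real.log_mul (by positivity) (by norm_num), Real.log_mul (by positivity) (by positivity)] at this
    have := Real.log_le_sub_one_of_pos (show (0:ℝ) < 1.000002 by norm_num)
    norm_num at this ⊢
    linarith
  unfold LMf; linarith

lemma ER_sum (al ga e t : ℝ) (hal : 0 ≤ al) (hga : 0 ≤ ga) (he : 0 ≤ e) (ht : 1000000 ≤ t) :
    2.2425 * ER al ga e (1 * t) + 1.38625 * ER al ga e (2 * t) + 0.575 * ER al ga e (3 * t) + 0.125 * ER al ga e (4 * t)
    ≤ al * e / Real.pi * (25.1 + 0.432875 * Real.log t) + ga * e^2 * (19.26 + 0.432875 * Real.log t) + 0.0078 * (al * e) := by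
  have hp := Real.pi_pos
  have l1 := LMf_le 1 t 0 le_rfl (by rw [Real.log_one]) ht
  have l2 := LMf_le 2 t 0.69315 (by norm_num) (by have := Real.log_two_lt_d9; linarith) ht
  have l3 := LMf_le 3 t 1.1 (by norm_num) ((log_ub 3 (by norm_num) 11 10 (by norm_num) (by norm_num)).trans (by norm_num)) ht
  have l4 := LMf_le 4 t 1.387 (by norm_num) ((log_ub 4 (by norm_num) 61 44 (by norm_num) (by norm_num)).trans (by norm_num)) ht
  have l5 : Real.log (27/7) ≤ 1.35 := (log_ub (27/7) (by norm_num) 27 20 (by norm_num) (by norm_num)).trans (by norm_num)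
  unfold ER
  generalize LMf (1 * t) = x1 at *
  generalize LMf (2 * t) = x2 at *
  generalize LMf (3 * t) = x3 at *
  generalize LMf (4 * t) = x4 at *
  generalize Real.log (27/7) = y at *
  generalize Real.log t = L at *
  have hA : 0 ≤ al * e / Real.pi := by positivity
  have hB : 0 ≤ ga * e^2 := by positivity
  have hC : 0 ≤ al * e := by positivity
  generalize al * e / Real.pi = A at *
  generalize ga * e^2 = B at *
  generalize al * e = C at *
  have m1 := mul_le_mul_of_nonneg_left (show 2.2425 * (x1 + y) + 1.38625 * (x2 + y) + 0.575 * (x3 + y) + 0.125 * (x4 + y) ≤ 25.1 + 0.432875 * L by linarith) hA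
  have m2 := mul_le_mul_of_nonneg_left (show 2.2425 * x1 + 1.38625 * x2 + 0.575 * x3 + 0.125 * x4 ≤ 19.26 + 0.432875 * L by linarith) hB
  linarith

lemma strong_num (e ε t D : ℝ) (he0 : 0 < e) (he : e ≤ 0.0081) (hε : ε ≤ 0.0081) (ht : 1000000 ≤ t)
    (hD : D = 3.25 * Real.log t + 194) (heD : e * D ≤ 2.2476)
    (h : 0 ≤ 1.311875 * (-(∑ j ∈ range 4, cc 1 j * Real.log ‖uu j‖) + 0.2 * ε) - 2.2425 * (Real.log 180.3 / 2)
      + (2.2425 * ER 14.3 4.9 e (1 * t) + 1.38625 * ER 14.3 4.9 e (2 * t) + 0.575 * ER 14.3 4.9 e (3 * t) + 0.125 * ER 14.3 4.9 e (4 * t))) : False := by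
  have hs := ER_sum 14.3 4.9 e t (by norm_num) (by norm_num) he0.le ht
  have hL : 0 ≤ Real.log t := Real.log_nonneg (by linarith)
  have s0 : ‖uu 0‖ = 2.5 := by rw [uu0]; norm_num
  have s3 : ‖uu 3‖ = 9.6 := by rw [uu3]; norm_num
  have s12 : ‖uu 1‖ * ‖uu 2‖ = 48.35 := by
    rw [← norm_mul, uu1, uu2]
    have : (5/2 + (√42.1 : ℝ) * Complex.I) * (5/2 - (√42.1 : ℝ) * Complex.I) = 48.35 := by
      have := sqWI
      linear_combination -this
    rw [this]; norm_num
  have u1 : ‖uu 1‖ ≠ 0 := by intro h; rw [h] at s12; norm_num at s12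
  have u2 : ‖uu 2‖ ≠ 0 := by intro h; rw [h] at s12; norm_num at s12
  have hU : -(∑ j ∈ range 4, cc 1 j * Real.log ‖uu j‖) ≤ 3.393 := by
    rw [cc_sum, s0, s3]
    have a : Real.log (9.6 * 48.35 / 2.5^3) ≤ 3.393 := (log_ub _ (by norm_num) 95 28 (by norm_num) (by norm_num)).trans (by norm_num)
    rw [Real.log_div (by norm_num) (by norm_num), Real.log_mul (by norm_num) (by norm_num), ← s12, Real.log_mul u1 u2, Real.log_pow] at a
    push_cast at a
    linarith
  have hU1 : 5.194 ≤ Real.log 180.3 := le_trans (by norm_num) (log_lb 180.3 (by norm_num) 187 36 (by norm_num) (by norm_num))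
  have hpi : 14.3 * e / Real.pi ≤ 4.552 * e := by
    rw [div_le_iff₀ Real.pi_pos]; have := Real.pi_gt_d4; nlinarith
  generalize Real.log t = L at *
  have m1 := mul_le_mul_of_nonneg_right hpi (show 0 ≤ 25.1 + 0.432875 * L by linarith)
  have m2 : 4.9 * e^2 * (19.26 + 0.432875 * L) ≤ e * 1.47 := by
    have : e * (19.26 + 0.432875 * L) ≤ 0.13345 * 2.2476 := by
      calc e * (19.26 + 0.432875 * L) ≤ e * (0.13345 * D) := by gcongr; rw [hD]; linarith
        _ ≤ _ := by linarith
    have := mul_le_mul_of_nonneg_left this (show 0 ≤ 4.9 * e by positivity)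
    linarith
  have m3 : e * (117.6 + 1.97046 * L) ≤ 0.60631 * (e * D) := by
    rw [hD]; nlinarith [mul_nonneg he0.le hL]
  nlinarith only [m1, m2, m3, hs, h, hU, hU1, heD, he0, hε]

lemma weak_num (e ε t : ℝ) (he0 : 0 < e) (he : e ≤ 0.0081) (hε : ε ≤ 0.0081) (ht : 1000000 ≤ t)
    (heD : e * (Real.log t + 60) ≤ 0.2)
    (h : 0 ≤ 1.311875 * (-(∑ j ∈ range 4, cc 0 j * Real.log ‖uu j‖) + 0.2 * ε) - 2.2425 * (Real.log 9.16 / 2)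
      + (2.2425 * ER 18 180 e (1 * t) + 1.38625 * ER 18 180 e (2 * t) + 0.575 * ER 18 180 e (3 * t) + 0.125 * ER 18 180 e (4 * t))) : False := by
  have hs := ER_sum 18 180 e t (by norm_num) (by norm_num) he0.le ht
  have hL : 0 ≤ Real.log t := Real.log_nonneg (by linarith)
  have s0 : ‖uu 0‖ = 2.5 := by rw [uu0]; norm_num
  have s3 : ‖uu 3‖ = 9.6 := by rw [uu3]; norm_num
  have hU : -(∑ j ∈ range 4, cc 0 j * Real.log ‖uu j‖) ≤ 1.347 := by
    rw [cc_sum, s0, s3]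
    have a : Real.log (9.6 / 2.5) ≤ 1.347 := (log_ub _ (by norm_num) 35 26 (by norm_num) (by norm_num)).trans (by norm_num)
    rw [Real.log_div (by norm_num) (by norm_num)] at a
    linarith
  have hU1 : 2.214 ≤ Real.log 9.16 := le_trans (by norm_num) (log_lb 9.16 (by norm_num) 31 14 (by norm_num) (by norm_num))
  have hpi : 18 * e / Real.pi ≤ 5.73 * e := by
    rw [div_le_iff₀ Real.pi_pos]; have := Real.pi_gt_d4; nlinarith
  generalize Real.log t = L at *
  have m1 := mul_le_mul_of_nonneg_right hpi (show 0 ≤ 25.1 + 0.432875 * L by linarith)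
  have m2 : 180 * e^2 * (19.26 + 0.432875 * L) ≤ 1.458 * (e * (19.26 + 0.432875 * L)) := by
    have := mul_le_mul_of_nonneg_right he (show 0 ≤ e * (19.26 + 0.432875 * L) by positivity)
    linarith
  have m3 : 0 ≤ e * L := by positivity
  nlinarith only [m1, m2, m3, hs, h, hU, hU1, heD, he0, hε]

end

section
open Finset

lemma eps_setup (η : ℝ) (h0 : 0 < η) (h : η ≤ 0.0036) : ∃ ε : ℝ, 0 < ε ∧ ε ≤ 2.2442 * η ∧ 1.4 / Real.pi * Real.arctan ε = η := by
  have hp := Real.pi_pos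
  have hp2 := Real.pi_lt_d4
  have ha : Real.pi / 1.4 * η < 0.00809 := by
    rw [div_mul_eq_mul_div, div_lt_iff₀ (by norm_num)]; nlinarith
  have ha0 : 0 < Real.pi / 1.4 * η := by positivity
  have hat : Real.arctan (Real.tan (Real.pi / 1.4 * η)) = Real.pi / 1.4 * η :=
    Real.arctan_tan (by linarith) (by have := Real.pi_gt_three; linarith)
  have hpos : 0 < Real.tan (Real.pi / 1.4 * η) := Real.tan_pos_of_pos_of_lt_pi_div_two ha0 (by have := Real.pi_gt_three; linarith)
  set ε := Real.tan (Real.pi / 1.4 * η)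
  have hle : ε ≤ 0.0081 := by
    by_contra! hc
    have h1 := Real.arctan_mono hc.le
    have h2 := arctan_ge 0.0081 (by norm_num)
    rw [hat] at h1
    norm_num at h1 h2 ha
    linarith
  have hge := arctan_ge ε hpos.le
  refine ⟨ε, hpos, ?_, ?_⟩
  · rw [hat] at hge
    have h3 : Real.pi / 1.4 * η ≤ 2.244 * η := by gcongr; rw [div_le_iff₀ (by norm_num)]; linarith
    have h4 : ε * (1 - 0.0081^2/2) ≤ ε * (1 - ε^2/2) := by gcongr
    norm_num at h4 ⊢
    linarith
  · rw [hat]; field_simp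

lemma FF_neg (t ε η : ℝ) (h : 1.4 / Real.pi * Real.arctan ε = η) (s : ℂ) (hs : s.im = t) (hr : 1 - s.re = η) : FF t (-(ε:ℂ)) = riemannZeta s := by
  unfold FF
  rw [← Complex.ofReal_neg, ph_real, Real.arctan_neg, mul_neg, h]
  congr 1
  apply Complex.ext
  · simp; linarith
  · simp [hs]

lemma T0_bd (t : ℝ) (h : 26.1 ≤ Real.log t) (ht : 0 < t) : 2 * Real.pi * Real.exp 24 + 2 ≤ t ∧ 1000000 ≤ t := by
  have h1 : Real.exp 26.1 ≤ t := (Real.le_log_iff_exp_le ht).1 h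
  have h2 : Real.exp 26.1 = Real.exp 2.1 * Real.exp 24 := by rw [← Real.exp_add]; norm_num
  have h3 : 8 ≤ Real.exp 2.1 := exp_lb 8 21 10 (by norm_num) (by norm_num) (by norm_num)
  have h4 : 1000000 ≤ Real.exp 24 := exp_lb 1000000 24 1 (by norm_num) (by norm_num) (by norm_num)
  have hp := Real.pi_lt_d4
  constructor <;> nlinarith

lemma zero_re_pos (s : ℂ) (h0 : riemannZeta s = 0) : 0 < 1 - s.re := by
  by_contra! h
  exact riemannZeta_ne_zero_of_one_le_re (by linarith) h0

lemma zdata (ε R : ℝ) (hε : 0 < ε) (hR : 0 < R) (v : ℂ) (hv : ‖v‖ < R) :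
    ∃ z : ℂ, v = -(ε * z) ∧ z.re = -v.re / ε ∧ ε^2/R^2 * Complex.normSq z = ‖v‖^2 / R^2 ∧ ‖v‖^2 / R^2 < 1 := by
  have hne : (ε:ℂ) ≠ 0 := by exact_mod_cast hε.ne'
  refine ⟨-(v / ε), by field_simp, ?_, ?_, ?_⟩
  · rw [Complex.neg_re, Complex.div_ofReal_re]; ring
  · rw [Complex.normSq_neg, Complex.normSq_eq_norm_sq, norm_div, Complex.norm_real, Real.norm_eq_abs, abs_of_pos hε]
    field_simp
  · rw [div_lt_one (by positivity)]; have := norm_nonneg v; gcongr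

lemma strong_step (s : ℂ) (hL : 26.1 ≤ Real.log s.im) (hi : 0 < s.im) (h0 : riemannZeta s = 0)
    (hη : (1 - s.re) * (3.25 * Real.log s.im + 194) ≤ 1) :
    ∃ s' : ℂ, riemannZeta s' = 0 ∧ 1 - s'.re ≤ 0.97 * (1 - s.re) ∧ s.im - 2 ≤ s'.im ∧ s'.im ≤ 4 * s.im + 2 := by
  by_contra! hcon
  have hη0 := zero_re_pos s h0
  obtain ⟨t1, t2⟩ := T0_bd _ hL hi
  obtain ⟨R, hR1, hR2, hnz⟩ := good_R s.im
  have hηs : 1 - s.re ≤ 0.003587 := by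
    nlinarith only [hη, hL, hη0]
  obtain ⟨ε, e1, e2, e3⟩ := eps_setup (1 - s.re) hη0 (by linarith)
  have hR0 : 0 < R := by linarith
  have heR : ε / R ≤ 2.2476 * (1 - s.re) := by
    rw [div_le_iff₀ hR0]; nlinarith only [e2, hR1, hη0]
  have he : ε / R ≤ 0.0081 := by linarith
  have hε : ε ≤ 0.0081 := by linarith
  have hl2 : ε^2 / R^2 ≤ 0.000069 := by
    rw [← div_pow]
    have : 0 < ε / R := by positivity
    calc (ε/R)^2 ≤ 0.0081^2 := by gcongr
      _ ≤ _ := by norm_num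
  have hneg : ‖(-(ε:ℂ))‖ < R := by
    rw [norm_neg, Complex.norm_real, Real.norm_eq_abs, abs_of_pos e1]; linarith
  have key := main_gen 1 14.3 4.9 ε R s.im (Real.log 180.3 / 2) (by norm_num) le_rfl e1 hR1 hR2 he t1 (by norm_num) (by norm_num)
    (fun z hz => KK_strong ε R z hR0 hz e1 he) hnz ?_ (-(ε:ℂ)) hneg (by rw [FF_neg _ ε _ e3 s rfl rfl, h0])
    (TT_str1 ε R e1 hR0 _ rfl hl2)
  · refine strong_num (ε/R) ε s.im _ (by positivity) he hε t2 rfl ?_ key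
    calc ε / R * (3.25 * Real.log s.im + 194) ≤ 2.2476 * (1 - s.re) * (3.25 * Real.log s.im + 194) := by gcongr
      _ ≤ _ := by linarith
  · intro k k1 k4 v hv hF
    have k1' : (1:ℝ) ≤ k := by exact_mod_cast k1
    have k4' : (k:ℝ) ≤ 4 := by exact_mod_cast k4
    obtain ⟨i1, i2⟩ := abs_le.1 (ph_im v R hv.le hR2)
    have hv1 : ‖v‖ < 1 := by linarith
    have hc : 0.97 * (1 - s.re) ≤ -(ph v).re := by
      by_contra! hlt
      have := hcon _ hF (by rw [FF_arg_re]; linarith) (by rw [FF_arg_im]; nlinarith only [i1, k1', hi])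
      rw [FF_arg_im] at this
      nlinarith only [i2, this, k4', hi]
    have hz := ph_zero v hv1 ε e1 (by linarith) (by rw [e3]; exact hc)
    obtain ⟨z, z1, z2, z3, z4⟩ := zdata ε R e1 hR0 v hv
    rw [z1]
    refine TT_str ε R e1 hR0 z _ rfl hl2 ?_ (by rw [z3]; exact z4)
    rw [z3, z2, le_div_iff₀ e1]
    have : ‖v‖^2 ≤ ‖v‖^2 / R^2 := by
      rw [le_div_iff₀ (by positivity)]
      have : R^2 ≤ 1 := by nlinarith only [hR0, hR2]
      nlinarith only [this, sq_nonneg ‖v‖]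
    nlinarith only [this, hz, e1]

lemma weak_bd (s : ℂ) (hL : 26.1 ≤ Real.log s.im) (hi : 0 < s.im) (h0 : riemannZeta s = 0) :
    1 ≤ 100 * Real.log s.im * (1 - s.re) := by
  by_contra! hη
  have hη0 := zero_re_pos s h0
  obtain ⟨t1, t2⟩ := T0_bd _ hL hi
  obtain ⟨R, hR1, hR2, hnz⟩ := good_R s.im
  have hηs : 1 - s.re ≤ 0.003587 := by
    nlinarith only [hη, hL, hη0]
  obtain ⟨ε, e1, e2, e3⟩ := eps_setup (1 - s.re) hη0 (by linarith)
  have hR0 : 0 < R := by linarith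
  have heR : ε / R ≤ 2.2476 * (1 - s.re) := by
    rw [div_le_iff₀ hR0]; nlinarith only [e2, hR1, hη0]
  have he : ε / R ≤ 0.0081 := by linarith
  have hε : ε ≤ 0.0081 := by linarith
  have hl2 : ε^2 / R^2 ≤ 0.000069 := by
    rw [← div_pow]
    have : 0 < ε / R := by positivity
    calc (ε/R)^2 ≤ 0.0081^2 := by gcongr
      _ ≤ _ := by norm_num
  have hneg : ‖(-(ε:ℂ))‖ < R := by
    rw [norm_neg, Complex.norm_real, Real.norm_eq_abs, abs_of_pos e1]; linarith
  have key := main_gen 0 18 180 ε R s.im (Real.log 9.16 / 2) le_rfl (by norm_num) e1 hR1 hR2 he t1 (by norm_num) (by norm_num)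
    (fun z hz => KK_weak ε R z hR0 hz e1 he) hnz ?_ (-(ε:ℂ)) hneg (by rw [FF_neg _ ε _ e3 s rfl rfl, h0])
    (TT_weak1 ε R e1 hR0 _ rfl hl2)
  · refine weak_num (ε/R) ε s.im (by positivity) he hε t2 ?_ key
    calc ε / R * (Real.log s.im + 60) ≤ 2.2476 * (1 - s.re) * (Real.log s.im + 60) := by gcongr
      _ ≤ _ := by nlinarith only [hη, hL, hη0]
  · intro k k1 k4 v hv hF
    have hv1 : ‖v‖ < 1 := by linarith
    have hc : 0 ≤ -(ph v).re := by
      have := zero_re_pos _ hF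
      rw [FF_arg_re] at this; linarith
    have hz := ph_zero0 v hv1 hc
    obtain ⟨z, z1, z2, z3, z4⟩ := zdata ε R e1 hR0 v hv
    rw [z1]
    refine TT_weak ε R e1 hR0 z _ rfl hl2 ?_ (by rw [z3]; exact z4)
    rw [z2]; positivity

end

section
open Finset

lemma chain_log (x y : ℝ) (hx : 1000000 ≤ x) (hy : 0 < y) (h : y ≤ 4 * x + 2) : Real.log y ≤ Real.log x + 1.41 := by
  have h1 : y ≤ 4.0001 * x := by linarith
  have h2 := Real.log_le_log hy h1
  rw [Real.log_mul (by norm_num) (by linarith)] at h2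
  have h3 : Real.log 4.0001 ≤ 1.4 := (log_ub 4.0001 (by norm_num) 7 5 (by norm_num) (by norm_num)).trans (by norm_num)
  linarith

lemma log_low (t u : ℝ) (ht0 : 0 < t) (ht : 26.15 ≤ Real.log t) (hu : t - 400 ≤ u) : 26.1 ≤ Real.log u ∧ 0 < u := by
  have h1 : Real.exp 26.15 ≤ t := (Real.le_log_iff_exp_le ht0).1 ht
  have h2 : Real.exp 26.15 = Real.exp 0.05 * Real.exp 26.1 := by rw [← Real.exp_add]; norm_num
  have h3 : (1.05:ℝ) ≤ Real.exp 0.05 := by have := Real.add_one_le_exp (0.05:ℝ); norm_num at this ⊢; linarith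
  have h4 : 1000000 ≤ Real.exp 26.1 := (exp_lb 1000000 26 1 (by norm_num) rfl (by norm_num)).trans (Real.exp_le_exp.2 (by norm_num))
  have h5 : Real.exp 26.1 ≤ u := by nlinarith
  have h6 : 0 < u := (Real.exp_pos _).trans_le h5
  exact ⟨(Real.le_log_iff_exp_le h6).2 h5, h6⟩

lemma chain (s0 : ℂ) (hi : 0 < s0.im) (hL : 26.15 ≤ Real.log s0.im) (h0 : riemannZeta s0 = 0)
    (hη : (1 - s0.re) * (3.25 * Real.log s0.im + 194) ≤ 1) (n : ℕ) : n ≤ 200 →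
    ∃ s : ℂ, riemannZeta s = 0 ∧ 1 - s.re ≤ 0.97^n * (1 - s0.re) ∧ s0.im - 2 * n ≤ s.im ∧ Real.log s.im ≤ Real.log s0.im + 1.41 * n
      ∧ (1 - s.re) * (3.25 * Real.log s.im + 194) ≤ 1 := by
  induction n with
  | zero => intro _; exact ⟨s0, h0, by simp, by simp, by simp, hη⟩
  | succ n ih =>
    intro hn
    obtain ⟨s, a1, a2, a3, a4, a5⟩ := ih (by omega)
    have hn' : (n:ℝ) + 1 ≤ 200 := by exact_mod_cast hn
    obtain ⟨b1, b2⟩ := log_low _ s.im hi hL (by linarith)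
    obtain ⟨s', c1, c2, c3, c4⟩ := strong_step s b1 b2 a1 a5
    have c5 := (T0_bd _ b1 b2).2
    have c6 := chain_log s.im s'.im c5 (by linarith) c4
    have pos := zero_re_pos s a1
    obtain ⟨d1, _⟩ := log_low _ s'.im hi hL (by linarith)
    refine ⟨s', c1, ?_, ?_, ?_, ?_⟩
    · rw [pow_succ]; linarith
    · push_cast; linarith
    · push_cast; linarith
    · calc (1 - s'.re) * (3.25 * Real.log s'.im + 194) ≤ 0.97 * (1 - s.re) * (3.25 * (Real.log s.im + 1.41) + 194) := by gcongr
        _ ≤ (1 - s.re) * (3.25 * Real.log s.im + 194) := by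
          rw [mul_comm (0.97:ℝ), mul_assoc]; gcongr; linarith
        _ ≤ 1 := a5

lemma no_bad (s0 : ℂ) (hi : 0 < s0.im) (hL : 26.15 ≤ Real.log s0.im) (h0 : riemannZeta s0 = 0)
    (hη : (1 - s0.re) * (3.25 * Real.log s0.im + 194) ≤ 1) : False := by
  obtain ⟨s, a1, a2, a3, a4, a5⟩ := chain s0 hi hL h0 hη 200 le_rfl
  push_cast at a3 a4
  obtain ⟨b1, b2⟩ := log_low _ s.im hi hL (by linarith)
  have w := weak_bd s b1 b2 a1
  have pos := zero_re_pos s a1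
  have pos0 := zero_re_pos s0 h0
  have e1 : (0.97:ℝ)^200 ≤ 0.0023 := by norm_num
  have e2 : 1 - s.re ≤ 0.0023 * (1 - s0.re) := a2.trans (by gcongr)
  have e3 : Real.log s.im * (1 - s.re) ≤ (Real.log s0.im + 282) * (0.0023 * (1 - s0.re)) := by
    apply mul_le_mul (by linarith) e2 pos.le (by linarith)
  nlinarith only [w, e3, hη, pos0, hL]

lemma range_ineq (L : ℝ) (hL : 26.15 ≤ L) : (3.25 * L + 194) * (1 - 8.02 * Real.log L / L) ≤ 3.359 * L := by
  have hL0 : 0 < L := by linarith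
  have key : ∀ c m : ℝ, 0 < c → m ≤ Real.log c → m + 1 - c / L ≤ Real.log L := by
    intro c m hc hm
    have := Real.one_sub_inv_le_log_of_pos (show 0 < L / c by positivity)
    rw [Real.log_div hL0.ne' hc.ne', inv_div] at this
    linarith
  have red : ∀ c m : ℝ, m + 1 - c / L ≤ Real.log L → 0 ≤ 0.109 * L^3 - 194 * L^2 + (26.065 * L + 1555.88) * ((m + 1) * L - c) →
      (3.25 * L + 194) * (1 - 8.02 * Real.log L / L) ≤ 3.359 * L := by
    intro c m h1 h2
    have h3 : (m + 1) * L - c ≤ Real.log L * L := by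
      have := mul_le_mul_of_nonneg_right h1 hL0.le
      rwa [sub_mul, div_mul_cancel₀ _ hL0.ne'] at this
    have h4 := mul_le_mul_of_nonneg_left h3 (show 0 ≤ 26.065 * L + 1555.88 by linarith)
    have h5 : (3.25 * L + 194) * (1 - 8.02 * Real.log L / L) = (3.25 * L + 194) * (L - 8.02 * Real.log L) / L := by
      field_simp
    rw [h5, div_le_iff₀ hL0]
    have h6 : 0 ≤ L * (3.359 * L * L - (3.25 * L + 194) * (L - 8.02 * Real.log L)) := by
      nlinarith only [h4, h2]
    have := nonneg_of_mul_nonneg_right h6 hL0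
    linarith
  rcases le_total L 70 with h | h
  · refine red 40 3.68 (key 40 3.68 (by norm_num) (le_trans (by norm_num) (log_lb 40 (by norm_num) 92 25 (by norm_num) (by norm_num)))) ?_
    nlinarith only [mul_nonneg (sub_nonneg.2 hL) (sub_nonneg.2 h), pow_pos hL0 3, hL, h]
  · refine red 148.43 5 (key 148.43 5 (by norm_num) (le_trans (by norm_num) (log_lb 148.43 (by norm_num) 5 1 (by norm_num) (by norm_num)))) ?_
    nlinarith only [mul_nonneg (sub_nonneg.2 h) (sq_nonneg (L - 136)), h]

lemma mid_range (L : ℝ) (h1 : 1.1565 ≤ L) (h2 : L ≤ 26.15) : L ≤ 8.02 * Real.log L := by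
  have ha : 1.1565 ≤ 8.02 * Real.log 1.1565 := by
    have := log_lb 1.1565 (by norm_num) 11 76 (by norm_num) (by norm_num)
    norm_num at this ⊢; linarith
  have hb : 26.15 ≤ 8.02 * Real.log 26.15 := by
    have := log_lb 26.15 (by norm_num) 75 23 (by norm_num) (by norm_num)
    norm_num at this ⊢; linarith
  have hcc := strictConcaveOn_log_Ioi.concaveOn.2
  have hc := @hcc (1.1565:ℝ) (by norm_num) (26.15:ℝ) (by norm_num)
    ((26.15 - L)/(26.15 - 1.1565)) ((L - 1.1565)/(26.15 - 1.1565))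
    (div_nonneg (by linarith) (by norm_num)) (div_nonneg (by linarith) (by norm_num)) (by norm_num; ring)
  have e : (26.15 - L)/(26.15 - 1.1565) * 1.1565 + (L - 1.1565)/(26.15 - 1.1565) * 26.15 = L := by ring
  simp only [smul_eq_mul] at hc
  rw [e] at hc
  have m1 := mul_le_mul_of_nonneg_left ha (show 0 ≤ (26.15 - L)/(26.15 - 1.1565) from div_nonneg (by linarith) (by norm_num))
  have m2 := mul_le_mul_of_nonneg_left hb (show 0 ≤ (L - 1.1565)/(26.15 - 1.1565) from div_nonneg (by linarith) (by norm_num))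
  linarith

lemma small_t (t β : ℝ) (h1 : 3 ≤ t) (h2 : t ≤ 3.18) (hb : 0.9 ≤ β) (hb1 : β < 1) : riemannZeta ((β:ℂ) + t * Complex.I) ≠ 0 := by
  intro h0
  set s : ℂ := (β:ℂ) + t * Complex.I with hs
  have hr : s.re = β := by simp [hs]
  have hi : s.im = t := by simp [hs]
  have hz := zeta_approx 1 le_rfl s (by rw [hr]; linarith) (by
    intro h; have := congrArg Complex.im h; rw [hi] at this; simp at this; linarith)
  rw [h0] at hz
  simp only [Ico_self, sum_empty, Nat.cast_one, Complex.one_cpow, Real.one_rpow, mul_one, zero_add, zero_sub, norm_neg, hr] at hz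
  have n1 : ‖s‖ ≤ 3.334 := by
    have := Complex.sq_norm s
    rw [Complex.normSq_apply, hr, hi] at this
    nlinarith [norm_nonneg s]
  have n2 : ‖s + 1‖ ≤ 3.757 := by
    have := Complex.sq_norm (s + 1)
    rw [Complex.normSq_apply, Complex.add_re, Complex.add_im, hr, hi, Complex.one_re, Complex.one_im] at this
    nlinarith [norm_nonneg (s + 1)]
  have err : ‖s‖ * ‖s + 1‖ / (12 * (β + 1)) ≤ 0.55 := by
    rw [div_le_iff₀ (by linarith)]
    calc ‖s‖ * ‖s + 1‖ ≤ 3.334 * 3.757 := by gcongr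
      _ ≤ _ := by linarith
  have hre := (le_abs_self _).trans ((Complex.abs_re_le_norm _).trans (hz.trans err))
  have hq : (s - 1).re = β - 1 ∧ (s - 1).im = t := by
    rw [Complex.sub_re, Complex.sub_im, hr, hi]; simp
  have e1 : (1 / (s - 1)).re ≥ -0.0112 := by
    rw [one_div, Complex.inv_re, Complex.normSq_apply, hq.1, hq.2, ge_iff_le, le_div_iff₀ (by nlinarith)]
    nlinarith
  have e2 : (1 / 2 + s / 12 + 1 / (s - 1)).re = 1/2 + β/12 + (1 / (s - 1)).re := by
    rw [Complex.add_re, Complex.add_re]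
    have : (s / 12).re = β / 12 := by
      rw [show (12:ℂ) = ((12:ℝ):ℂ) by norm_num, Complex.div_ofReal_re, hr]
    rw [this]; norm_num
  rw [e2] at hre
  linarith

lemma final_pos (t β : ℝ) (ht : 3 ≤ t) (hβ : 1 - 1 / (3.359 * Real.log t) * (1 - 8.02 * Real.log (Real.log t) / Real.log t) ≤ β) :
    riemannZeta ((β : ℂ) + (t : ℂ) * Complex.I) ≠ 0 := by
  rcases le_or_gt 1 β with h1 | h1
  · exact riemannZeta_ne_zero_of_one_le_re (by simpa using h1)
  have hl3 : 1.098 ≤ Real.log t := by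
    refine le_trans (le_trans ?_ (log_lb 3 (by norm_num) 56 51 (by norm_num) (by norm_num))) (Real.log_le_log (by norm_num) ht)
    norm_num
  have hL0 : 0 < Real.log t := by linarith
  rcases le_or_gt t 3.18 with h2 | h2
  · apply small_t t β ht h2 _ h1
    have u : Real.log t ≤ 1.158 := by
      refine (Real.log_le_log (by linarith) h2).trans ((log_ub 3.18 (by norm_num) 22 19 (by norm_num) (by norm_num)).trans ?_)
      norm_num
    have v : 0.093 ≤ Real.log (Real.log t) := by
      refine le_trans (le_trans ?_ (log_lb 1.098 (by norm_num) 4 43 (by norm_num) (by norm_num))) (Real.log_le_log (by norm_num) hl3)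
      norm_num
    generalize Real.log (Real.log t) = M at *
    generalize Real.log t = L at *
    have a1 : 0.644 ≤ 8.02 * M / L := by rw [le_div_iff₀ hL0]; linarith
    have a2 : 1 / (3.359 * L) ≤ 0.2712 := by rw [div_le_iff₀ (by linarith)]; linarith
    have a3 : 0 < 1 / (3.359 * L) := by positivity
    nlinarith only [hβ, a1, a2, a3]
  · have hl4 : 1.1565 ≤ Real.log t := by
      refine le_trans (le_trans ?_ (log_lb 3.18 (by norm_num) 96 83 (by norm_num) (by norm_num))) (Real.log_le_log (by norm_num) h2.le)
      norm_num
    rcases le_or_gt (Real.log t) 26.15 with h3 | h3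
    · exfalso
      have m := mid_range _ hl4 h3
      have a1 : 1 ≤ 8.02 * Real.log (Real.log t) / Real.log t := by rw [le_div_iff₀ hL0]; linarith
      have a3 : 0 < 1 / (3.359 * Real.log t) := by positivity
      nlinarith only [hβ, a1, a3, h1]
    · intro h0
      have hr : ((β : ℂ) + (t : ℂ) * Complex.I).re = β := by simp
      have hi : ((β : ℂ) + (t : ℂ) * Complex.I).im = t := by simp
      refine no_bad _ (by rw [hi]; linarith) (by rw [hi]; exact h3.le) h0 ?_
      rw [hr, hi]
      have ri := range_ineq _ h3.le
      have hp : 0 < 3.25 * Real.log t + 194 := by linarith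
      calc (1 - β) * (3.25 * Real.log t + 194)
          ≤ (1 / (3.359 * Real.log t) * (1 - 8.02 * Real.log (Real.log t) / Real.log t)) * (3.25 * Real.log t + 194) := by
            gcongr; linarith
        _ = ((3.25 * Real.log t + 194) * (1 - 8.02 * Real.log (Real.log t) / Real.log t)) / (3.359 * Real.log t) := by ring
        _ ≤ 1 := by rw [div_le_one (by positivity)]; exact ri

end

theorem zero_free_region_nu2 (t β : ℝ) (ht : 3 ≤ |t|) (hβ : 1 - nu2 t ≤ β) :
    riemannZeta ((β : ℂ) + (t : ℂ) * Complex.I) ≠ 0 := by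
  have h := final_pos |t| β ht hβ
  rcases abs_choice t with h1 | h1
  · rwa [h1] at h
  · rw [h1] at h
    intro h0
    apply h
    have e : (β : ℂ) + ((-t : ℝ) : ℂ) * Complex.I = (starRingEnd ℂ) ((β : ℂ) + (t : ℂ) * Complex.I) := by
      apply Complex.ext <;> simp
    rw [e, riemannZeta_conj, h0, map_zero]
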